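/- Suppose M is spherically symmetric about p and nonpositively curved. Let x = (f(θ),θ) ∈ ∂Ω with f(θ) < ∞, and let γ : [0,T] → M∖Ω be a path of constant speed λ from q to x realizing the intrinsic distance, i.e. d_Ω(γ(t),q) = λt for all t ∈ [0,T]. Then there exists t_0 ∈ (0,T] such that γ restricted to [0,t_0] is a Riemannian geodesic of M, while γ(t) ∈ ∂Ω and d(γ(t),p) = t for all t ∈ [t_0,T]. Consequently, writing γ(t) = (r_0 + (t − t_0), η(t)) in polar coordinates for t ≥ t_0 (with r_0 = d(γ(t_0),p) = t_0), the angular component η is Lipschitz with |η′(t)| = √(λ²−1)/G(r_0 + (t − t_0)) almost everywhere. -/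

import Mathlib

/-!
Formalization framework for "growth competitions" (after the paper's
Section 2), at the metric-space level.

Since Mathlib does not yet have Riemannian metrics, a complete Riemannian
manifold is represented by a proper (hence complete; Hopf-Rinow) metric
space whose distance is the induced length (intrinsic) metric, and
spherical symmetry about `p` with warping function `G` is expressed through
global geodesic polar normal coordinates `Φ : ℝⁿ ≃ M` with `Φ 0 = p` and
`dist (Φ x) p = ‖x‖`, in which the Riemannian distance is the infimum of
lengths of Lipschitz curves measured in the warped metric
`g = dr² + G(r)² dθ²`.
-/

open Set Metric Filter MeasureTheory InnerProductGeometry NNReal ENNReal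
open scoped RealInnerProductSpace Classical

noncomputable section

namespace GrowthComp

variable {M : Type*} [MetricSpace M]

/-- Length of the path `γ : ℝ → M` over the time interval `[0, T]`
(the total variation of `γ` on `[0, T]`, valued in `ℝ≥0∞`). -/
def pathLength (γ : ℝ → M) (T : ℝ) : ℝ≥0∞ := eVariationOn γ (Set.Icc 0 T)

/-- The intrinsic metric `d_S` of `M ∖ S`: the infimum of lengths of Lipschitz
paths from `x` to `y` avoiding `S` (with `sInf ∅ = ∞`). -/
def dCompl (S : Set M) (x y : M) : ℝ≥0∞ :=
  sInf {L : ℝ≥0∞ | ∃ (T : ℝ) (γ : ℝ → M), 0 ≤ T ∧ γ 0 = x ∧ γ T = y ∧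
    (∃ K : ℝ≥0, LipschitzOnWith K γ (Set.Icc 0 T)) ∧
    (∀ t ∈ Set.Icc 0 T, γ t ∉ S) ∧ L = pathLength γ T}

/-- The distance of `M` is the induced length metric (true for every
complete Riemannian manifold). -/
def IsLengthSpace (M : Type*) [MetricSpace M] : Prop :=
  ∀ x y : M, ENNReal.ofReal (dist x y) = dCompl (∅ : Set M) x y

/-- A path `γ : [0, T] → M` *avoids* the (time-indexed) family `B`:
it starts at `q`, is `λ`-Lipschitz, and `γ s ∉ B s` for all `s ∈ [0, T]`. -/
def AvoidsB (q : M) (lam : ℝ) (B : ℝ → Set M) (T : ℝ) (γ : ℝ → M) : Prop :=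
  γ 0 = q ∧ LipschitzOnWith (Real.toNNReal lam) γ (Set.Icc 0 T) ∧
    ∀ s ∈ Set.Icc 0 T, γ s ∉ B s

/-- A path `η : [0, T] → M` *avoids* the family `A`:
it starts at `p`, is `1`-Lipschitz, and `η s ∉ A s` for all `s ∈ [0, T]`. -/
def AvoidsA (p : M) (A : ℝ → Set M) (T : ℝ) (η : ℝ → M) : Prop :=
  η 0 = p ∧ LipschitzOnWith 1 η (Set.Icc 0 T) ∧ ∀ s ∈ Set.Icc 0 T, η s ∉ A s

/-- `{A_t, B_t}_{t ≥ 0}` is a *growth competition* between `p` and `q` with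
speed ratio `λ`: both families are increasing, `A 0 = {q}`, `B 0 = {p}`, and
for `t > 0`, `A t` is the union of `γ([0,t])` over paths `γ` avoiding `B`
and `B t` is the union of `η([0,t))` over paths `η` avoiding `A`. -/
structure IsGrowthCompetition (p q : M) (lam : ℝ) (A B : ℝ → Set M) : Prop where
  monoA : ∀ ⦃t₁ t₂ : ℝ⦄, 0 ≤ t₁ → t₁ ≤ t₂ → A t₁ ⊆ A t₂
  monoB : ∀ ⦃t₁ t₂ : ℝ⦄, 0 ≤ t₁ → t₁ ≤ t₂ → B t₁ ⊆ B t₂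
  A_zero : A 0 = {q}
  B_zero : B 0 = {p}
  A_eq : ∀ t : ℝ, 0 < t →
    A t = {x | ∃ γ : ℝ → M, AvoidsB q lam B t γ ∧ x ∈ γ '' Set.Icc 0 t}
  B_eq : ∀ t : ℝ, 0 < t →
    B t = {x | ∃ η : ℝ → M, AvoidsA p A t η ∧ x ∈ η '' Set.Ico 0 t}

/-- `A_∞ = ⋃_{t ≥ 0} A_t`. -/
def Ainfty (A : ℝ → Set M) : Set M := ⋃ t ∈ Set.Ici (0 : ℝ), A t

/-- `B_∞ = ⋃_{t ≥ 0} B_t`. -/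
def Binfty (B : ℝ → Set M) : Set M := ⋃ t ∈ Set.Ici (0 : ℝ), B t

/-- The recursively defined sets `Ω_n`:
`Ω_0 = ∅`, `Ω_{n+1} = Ω_n ∪ {x ∈ M ∖ Ω_n | d_{Ω_n}(x, q) > λ d(x, p)}`. -/
def OmegaSeq (p q : M) (lam : ℝ) : ℕ → Set M
  | 0 => ∅
  | n + 1 => OmegaSeq p q lam n ∪
      {x | x ∉ OmegaSeq p q lam n ∧
        ENNReal.ofReal (lam * dist x p) < dCompl (OmegaSeq p q lam n) x q}

/-- `Ω = ⋃_{n ≥ 1} Ω_n`. -/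
def Omega (p q : M) (lam : ℝ) : Set M := ⋃ n : ℕ, OmegaSeq p q lam (n + 1)

/-- `γ` is a unit-speed minimizing geodesic from `x` to `y`, parametrized on
`[0, dist x y]`. -/
def IsMinGeodesicFromTo (γ : ℝ → M) (x y : M) : Prop :=
  γ 0 = x ∧ γ (dist x y) = y ∧
    ∀ s ∈ Set.Icc (0 : ℝ) (dist x y), ∀ t ∈ Set.Icc (0 : ℝ) (dist x y),
      dist (γ s) (γ t) = |s - t|

/-- `S` is star-shaped about `p`: every minimizing geodesic from `p` to a
point of `S` lies inside `S`. -/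
def StarShapedAbout (p : M) (S : Set M) : Prop :=
  ∀ x ∈ S, ∀ γ : ℝ → M, IsMinGeodesicFromTo γ p x →
    ∀ t ∈ Set.Icc (0 : ℝ) (dist p x), γ t ∈ S

/-- `x` is *visible* from `q` through the obstacle `S`: no minimizing
geodesic joining `q` and `x` intersects `S`.  (On a nonpositively curved
simply connected manifold minimizing geodesics are unique, so this matches
"the minimizing geodesic joining `q` and `x` does not intersect `S`".) -/
def VisibleThrough (S : Set M) (q x : M) : Prop :=
  ∀ γ : ℝ → M, IsMinGeodesicFromTo γ q x →
    ∀ t ∈ Set.Icc (0 : ℝ) (dist q x), γ t ∉ S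

/-! ### Spherically symmetric manifolds, via polar normal coordinates -/

/-- Euclidean `n`-space, the model space for polar normal coordinates. -/
abbrev Euc (n : ℕ) : Type := EuclideanSpace ℝ (Fin n)

/-- The norm of the tangent vector `v` at the point `x ∈ ℝⁿ ∖ {0}` in the
spherically symmetric (warped product) metric `g = dr² + G(r)² dθ²`:
`g_x(v,v) = ⟨v, x̂⟩² + (G(‖x‖)²/‖x‖²) (‖v‖² − ⟨v, x̂⟩²)`. -/
def warpNorm {n : ℕ} (G : ℝ → ℝ) (x v : Euc n) : ℝ :=
  if x = 0 then ‖v‖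
  else Real.sqrt (⟪v, ‖x‖⁻¹ • x⟫ ^ 2 +
    (G ‖x‖ / ‖x‖) ^ 2 * (‖v‖ ^ 2 - ⟪v, ‖x‖⁻¹ • x⟫ ^ 2))

/-- The length of a (Lipschitz, hence a.e. differentiable) curve `c` on
`[0, T]` in the warped metric `dr² + G(r)² dθ²`. -/
def warpLength {n : ℕ} (G : ℝ → ℝ) (c : ℝ → Euc n) (T : ℝ) : ℝ≥0∞ :=
  ∫⁻ t in Set.Icc (0 : ℝ) T, ENNReal.ofReal (warpNorm G (c t) (deriv c t))

/-- `G` is an admissible warping function: positive and smooth on `(0,∞)`,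
with `G(r) → 0` and `G(r)/r → 1` as `r → 0⁺`. -/
def IsWarping (G : ℝ → ℝ) : Prop :=
  (∀ r : ℝ, 0 < r → 0 < G r) ∧ ContDiffOn ℝ (⊤ : ℕ∞) G (Set.Ioi 0) ∧
    Tendsto G (nhdsWithin 0 (Set.Ioi 0)) (nhds 0) ∧
    Tendsto (fun r => G r / r) (nhdsWithin 0 (Set.Ioi 0)) (nhds 1)

/-- `Φ : ℝⁿ ≃ M` realizes `M` as spherically symmetric about `p` with
warping function `G`: `Φ` is a global geodesic polar normal coordinate
chart — `Φ 0 = p` and the radial coordinate is the distance to `p` — and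
the Riemannian distance of `M` is the infimum of warped lengths of
Lipschitz curves computed in the chart. -/
def IsSphericallySymmetric {n : ℕ} (p : M) (G : ℝ → ℝ) (Φ : Euc n ≃ M) : Prop :=
  IsWarping G ∧ Φ 0 = p ∧ (∀ x : Euc n, dist (Φ x) p = ‖x‖) ∧
    ∀ x y : Euc n, ENNReal.ofReal (dist (Φ x) (Φ y)) =
      sInf {L : ℝ≥0∞ | ∃ (T : ℝ) (c : ℝ → Euc n), 0 ≤ T ∧ c 0 = x ∧ c T = y ∧
        (∃ K : ℝ≥0, LipschitzOnWith K c (Set.Icc 0 T)) ∧ L = warpLength G c T}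

/-- The angular polar coordinate `θ(x) ∈ S_pM ≅ S^{n-1}` of a point
`x ≠ p`, read off through the polar chart `Φ`. -/
def polarTheta {n : ℕ} {M : Type*} [MetricSpace M] (Φ : Euc n ≃ M) (x : M) : Euc n :=
  ‖Φ.symm x‖⁻¹ • Φ.symm x

/-- Nonpositive sectional curvature for the spherically symmetric metric
`dr² + G(r)² dθ²`: the radial sectional curvature is `−G''/G ≤ 0`,
i.e. `G` is convex, and the tangential one is `(1 − G'²)/G² ≤ 0`,
i.e. `G' ≥ 1`. -/
def NonposCurvWarping (G : ℝ → ℝ) : Prop :=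
  ConvexOn ℝ (Set.Ioi 0) G ∧ ∀ r : ℝ, 0 < r → 1 ≤ deriv G r

/-- `∫₁^∞ dr / G(r) = ∞`.  For a surface of revolution this is, by a theorem
of Milnor cited in the paper, equivalent to parabolicity, i.e. conformal
equivalence to the Euclidean plane. -/
def ParabolicWarping (G : ℝ → ℝ) : Prop :=
  ∫⁻ r in Set.Ici (1 : ℝ), ENNReal.ofReal ((G r)⁻¹) = ⊤

/-- `∫₁^∞ dr / G(r) < ∞`.  For a surface of revolution this is, by a theorem
of Milnor cited in the paper, equivalent to hyperbolicity, i.e. conformal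
equivalence to the hyperbolic plane. -/
def HyperbolicWarping (G : ℝ → ℝ) : Prop :=
  ∫⁻ r in Set.Ici (1 : ℝ), ENNReal.ofReal ((G r)⁻¹) < ⊤

open scoped Topology

section Warping

variable {G : ℝ → ℝ}

theorem IsWarping.hasDerivAt (hG : IsWarping G) {r : ℝ} (hr : 0 < r) :
    HasDerivAt G (deriv G r) r := by
  have h := (hG.2.1.differentiableOn (by simp)).differentiableAt (Ioi_mem_nhds hr)
  exact h.hasDerivAt

theorem IsWarping.continuousOn (hG : IsWarping G) : ContinuousOn G (Ioi 0) :=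
  hG.2.1.continuousOn

theorem IsWarping.contDiffOn_deriv (hG : IsWarping G) :
    ContDiffOn ℝ (⊤ : ℕ∞) (deriv G) (Ioi 0) :=
  hG.2.1.deriv_of_isOpen isOpen_Ioi (by simp)

theorem IsWarping.map_mul_le (hG : IsWarping G) (hc : NonposCurvWarping G) {s r : ℝ}
    (hs0 : 0 < s) (hs1 : s ≤ 1) (hr : 0 < r) : G (s * r) ≤ s * G r := by
  have hcont : ContinuousAt G (s * r) :=
    hG.continuousOn.continuousAt (Ioi_mem_nhds (by positivity))
  have h1 : Tendsto (fun e : ℝ => G (s * r + (1 - s) * e)) (𝓝[>] 0) (𝓝 (G (s * r))) := by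
    refine hcont.tendsto.comp ?_
    have : Tendsto (fun e : ℝ => s * r + (1 - s) * e) (𝓝 0) (𝓝 (s * r + (1 - s) * 0)) :=
      Continuous.tendsto (by fun_prop) 0
    simpa using this.mono_left nhdsWithin_le_nhds
  have h2 : Tendsto (fun e : ℝ => s * G r + (1 - s) * G e) (𝓝[>] 0) (𝓝 (s * G r)) := by
    simpa using (hG.2.2.1.const_mul (1 - s)).const_add (s * G r)
  refine le_of_tendsto_of_tendsto h1 h2 ?_
  filter_upwards [self_mem_nhdsWithin] with e he
  simpa using hc.1.2 (show r ∈ Ioi 0 from hr) he hs0.le (by linarith : 0 ≤ 1 - s) (by ring)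

theorem IsWarping.ratio_mono (hG : IsWarping G) (hc : NonposCurvWarping G) {r r' : ℝ}
    (hr : 0 < r) (hrr : r ≤ r') : G r / r ≤ G r' / r' := by
  have hr' : 0 < r' := hr.trans_le hrr
  have h := hG.map_mul_le hc (div_pos hr hr') (by rw [div_le_one hr']; exact hrr) hr'
  rw [div_mul_cancel₀ _ hr'.ne'] at h
  rw [div_le_iff₀ hr]
  calc G r ≤ r / r' * G r' := h
    _ = G r' / r' * r := by ring

theorem IsWarping.one_le_ratio (hG : IsWarping G) (hc : NonposCurvWarping G) {r : ℝ}
    (hr : 0 < r) : 1 ≤ G r / r := by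
  refine le_of_tendsto hG.2.2.2 ?_
  filter_upwards [Ioo_mem_nhdsGT hr] with e he
  exact hG.ratio_mono hc he.1 he.2.le

theorem IsWarping.self_le (hG : IsWarping G) (hc : NonposCurvWarping G) {r : ℝ}
    (hr : 0 < r) : r ≤ G r := by
  have := hG.one_le_ratio hc hr
  rwa [le_div_iff₀ hr, one_mul] at this

theorem IsWarping.deriv_mono (hG : IsWarping G) (hc : NonposCurvWarping G) :
    MonotoneOn (deriv G) (Ioi 0) := by
  intro x hx y hy hxy
  rcases hxy.eq_or_lt with rfl | h
  · exact le_rfl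
  · exact (hc.1.deriv_le_slope hx hy h (hG.hasDerivAt hx).differentiableAt).trans
      (hc.1.slope_le_deriv hx hy h (hG.hasDerivAt hy).differentiableAt)

end Warping

section WarpNorm

variable {n : ℕ} {G : ℝ → ℝ}

theorem inner_unit_sq_le (x v : Euc n) : ⟪v, ‖x‖⁻¹ • x⟫ ^ 2 ≤ ‖v‖ ^ 2 := by
  have h := abs_real_inner_le_norm v (‖x‖⁻¹ • x)
  have h1 : ‖‖x‖⁻¹ • x‖ ≤ 1 := by
    rw [norm_smul, norm_inv, norm_norm]
    exact inv_mul_le_one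
  rw [← sq_abs]
  exact pow_le_pow_left₀ (abs_nonneg _)
    (h.trans (mul_le_of_le_one_right (norm_nonneg _) h1)) 2

theorem warpNorm_nonneg (x v : Euc n) : 0 ≤ warpNorm G x v := by
  unfold warpNorm; split_ifs <;> positivity

theorem warpNorm_zero_left (v : Euc n) : warpNorm G 0 v = ‖v‖ := by simp [warpNorm]

theorem warpNorm_sq {x : Euc n} (hx : x ≠ 0) (v : Euc n) :
    warpNorm G x v ^ 2 = ⟪v, ‖x‖⁻¹ • x⟫ ^ 2 +
      (G ‖x‖ / ‖x‖) ^ 2 * (‖v‖ ^ 2 - ⟪v, ‖x‖⁻¹ • x⟫ ^ 2) := by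
  unfold warpNorm
  rw [if_neg hx, Real.sq_sqrt]
  have := inner_unit_sq_le x v
  have : 0 ≤ ‖v‖ ^ 2 - ⟪v, ‖x‖⁻¹ • x⟫ ^ 2 := by linarith
  positivity

theorem norm_le_warpNorm (hG : IsWarping G) (hc : NonposCurvWarping G) (x v : Euc n) :
    ‖v‖ ≤ warpNorm G x v := by
  by_cases hx : x = 0
  · rw [hx, warpNorm_zero_left]
  · refine le_of_sq_le_sq ?_ (warpNorm_nonneg _ _)
    rw [warpNorm_sq hx]
    have h1 := hG.one_le_ratio hc (norm_pos_iff.2 hx)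
    have h2 := inner_unit_sq_le x v
    nlinarith [mul_le_mul_of_nonneg_right (one_le_pow₀ h1 (n := 2))
      (sub_nonneg.2 h2)]

theorem warpNorm_le (hG : IsWarping G) (hc : NonposCurvWarping G) {x : Euc n} {R : ℝ}
    (hR : 0 < R) (hx : ‖x‖ ≤ R) (v : Euc n) : warpNorm G x v ≤ G R / R * ‖v‖ := by
  have hk := hG.one_le_ratio hc hR
  by_cases h0 : x = 0
  · rw [h0, warpNorm_zero_left]
    nlinarith [norm_nonneg v]
  · refine le_of_sq_le_sq ?_ (by positivity)
    rw [warpNorm_sq h0, mul_pow]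
    have h1 := hG.one_le_ratio hc (norm_pos_iff.2 h0)
    have h2 := inner_unit_sq_le x v
    have h3 := hG.ratio_mono hc (norm_pos_iff.2 h0) hx
    have h4 : (G ‖x‖ / ‖x‖) ^ 2 ≤ (G R / R) ^ 2 := pow_le_pow_left₀ (by linarith) h3 2
    nlinarith [mul_le_mul_of_nonneg_right h4 (sub_nonneg.2 h2),
      mul_nonneg (sub_nonneg.2 (one_le_pow₀ hk (n := 2))) (sq_nonneg ⟪v, ‖x‖⁻¹ • x⟫)]

theorem warpNorm_polar_sq {ρ : ℝ} (hρ : 0 < ρ) {e w : Euc n} (he : ‖e‖ = 1)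
    (hew : ⟪e, w⟫ = 0) (ρ' : ℝ) :
    warpNorm G (ρ • e) (ρ' • e + ρ • w) ^ 2 = ρ' ^ 2 + G ρ ^ 2 * ‖w‖ ^ 2 := by
  have hne : ρ • e ≠ 0 := by
    rw [Ne, smul_eq_zero, not_or]
    exact ⟨hρ.ne', fun h => by simp [h] at he⟩
  have hn : ‖ρ • e‖ = ρ := by rw [norm_smul, he, Real.norm_of_nonneg hρ.le, mul_one]
  have hu : ρ⁻¹ • ρ • e = e := by rw [smul_smul, inv_mul_cancel₀ hρ.ne', one_smul]
  have hi : ⟪ρ' • e + ρ • w, e⟫ = ρ' := by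
    rw [inner_add_left, real_inner_smul_left, real_inner_smul_left, real_inner_self_eq_norm_sq,
      he, real_inner_comm e w, hew]
    ring
  have hv : ‖ρ' • e + ρ • w‖ ^ 2 = ρ' ^ 2 + ρ ^ 2 * ‖w‖ ^ 2 := by
    rw [norm_add_sq_real, real_inner_smul_left, real_inner_smul_right, hew, norm_smul, norm_smul,
      he, mul_pow, Real.norm_eq_abs, Real.norm_eq_abs, mul_pow, sq_abs, sq_abs]
    ring
  rw [warpNorm_sq hne, hn, hu, hi, hv]
  field_simp
  ring

/-- For `x ≠ 0`, the linear map `A` with `‖A v‖ = warpNorm G x v`. -/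
def warpMap (G : ℝ → ℝ) (x : Euc n) : Euc n →L[ℝ] Euc n :=
  (G ‖x‖ / ‖x‖) • ContinuousLinearMap.id ℝ (Euc n) +
    (1 - G ‖x‖ / ‖x‖) • (innerSL ℝ (‖x‖⁻¹ • x)).smulRight (‖x‖⁻¹ • x)

theorem norm_warpMap {x : Euc n} (hx : x ≠ 0) (v : Euc n) :
    ‖warpMap G x v‖ = warpNorm G x v := by
  rw [← sq_eq_sq₀ (norm_nonneg _) (warpNorm_nonneg _ _), warpNorm_sq hx]
  have he : ‖‖x‖⁻¹ • x‖ = 1 := by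
    rw [norm_smul, norm_inv, norm_norm, inv_mul_cancel₀ (norm_ne_zero_iff.2 hx)]
  have hA : warpMap G x v = (G ‖x‖ / ‖x‖) • v +
      ((1 - G ‖x‖ / ‖x‖) * ⟪‖x‖⁻¹ • x, v⟫) • (‖x‖⁻¹ • x) := by
    simp only [warpMap, add_apply, smul_apply,
      ContinuousLinearMap.id_apply, ContinuousLinearMap.smulRight_apply, innerSL_apply_apply,
      smul_smul, mul_assoc]
  rw [hA]
  generalize ‖x‖⁻¹ • x = e at he
  rw [norm_add_sq_real, real_inner_smul_left, real_inner_smul_right, norm_smul, norm_smul,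
    he, mul_pow, mul_pow, Real.norm_eq_abs, Real.norm_eq_abs, sq_abs, sq_abs, real_inner_comm v e]
  ring

theorem continuousAt_warpMap (hG : IsWarping G) {x : Euc n} (hx : x ≠ 0) :
    ContinuousAt (warpMap G) x := by
  have hpos := norm_pos_iff.2 hx
  have h1 : ContinuousAt (fun y : Euc n => G ‖y‖) x :=
    ContinuousAt.comp (f := fun y : Euc n => ‖y‖) (g := G)
      (hG.continuousOn.continuousAt (Ioi_mem_nhds hpos)) continuous_norm.continuousAt
  have h2 : ContinuousAt (fun y : Euc n => G ‖y‖ / ‖y‖) x :=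
    h1.div continuous_norm.continuousAt hpos.ne'
  have h3 : ContinuousAt (fun y : Euc n => ‖y‖⁻¹ • y) x :=
    (continuous_norm.continuousAt.inv₀ hpos.ne').smul continuousAt_id
  have h4 : ContinuousAt (fun y : Euc n => innerSL ℝ (‖y‖⁻¹ • y)) x :=
    (innerSL ℝ).continuous.continuousAt.comp h3
  have h5 : ContinuousAt (fun y : Euc n =>
      (innerSL ℝ (‖y‖⁻¹ • y)).smulRight (‖y‖⁻¹ • y)) x := by
    have := ((ContinuousLinearMap.smulRightL ℝ (Euc n) (Euc n)).continuous₂).continuousAt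
      (x := (innerSL ℝ (‖x‖⁻¹ • x), ‖x‖⁻¹ • x))
    exact ContinuousAt.comp (f := fun y : Euc n => (innerSL ℝ (‖y‖⁻¹ • y), ‖y‖⁻¹ • y))
      this (h4.prodMk h3)
  exact (h2.smul continuousAt_const).add ((continuousAt_const.sub h2).smul h5)

theorem le_warpNorm_of_near (hG : IsWarping G) (hc : NonposCurvWarping G) {x : Euc n}
    (hx : x ≠ 0) {ε : ℝ} (hε : 0 < ε) :
    ∃ δ > 0, ∀ y : Euc n, ‖y - x‖ < δ → ∀ v, ‖warpMap G x v‖ ≤ (1 + ε) * warpNorm G y v := by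
  have h := (continuousAt_warpMap hG hx).eventually
    (Metric.ball_mem_nhds (warpMap G x) hε)
  have h' := h.and (isOpen_ne.mem_nhds hx)
  obtain ⟨δ, hδ, H⟩ := Metric.eventually_nhds_iff.1 h'
  refine ⟨δ, hδ, fun y hy v => ?_⟩
  obtain ⟨h1, h2⟩ := H (by rwa [dist_eq_norm])
  rw [dist_eq_norm] at h1
  have h3 : ‖warpMap G x v‖ ≤ ‖warpMap G y v‖ + ‖(warpMap G y - warpMap G x) v‖ := by
    rw [sub_apply]
    have := norm_sub_norm_le (warpMap G x v) (warpMap G y v)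
    rw [norm_sub_rev] at this
    linarith
  have h4 := (warpMap G y - warpMap G x).le_opNorm v
  rw [norm_warpMap h2] at h3
  have h5 := norm_le_warpNorm hG hc y v
  nlinarith [mul_le_mul h1.le h5 (norm_nonneg v) hε.le]

theorem measurable_warpNorm (hG : IsWarping G) :
    Measurable (fun z : Euc n × Euc n => warpNorm G z.1 z.2) := by
  have hGm : Measurable ((Ioi (0 : ℝ)).piecewise G (fun _ => 0)) :=
    hG.continuousOn.measurable_piecewise continuousOn_const measurableSet_Ioi
  have key : (fun z : Euc n × Euc n => warpNorm G z.1 z.2) = fun z =>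
      if z.1 = 0 then ‖z.2‖ else Real.sqrt (⟪z.2, ‖z.1‖⁻¹ • z.1⟫ ^ 2 +
        ((Ioi (0 : ℝ)).piecewise G (fun _ => 0) ‖z.1‖ / ‖z.1‖) ^ 2 *
          (‖z.2‖ ^ 2 - ⟪z.2, ‖z.1‖⁻¹ • z.1⟫ ^ 2)) := by
    ext z
    unfold warpNorm
    split_ifs with h
    · rfl
    · rw [Set.piecewise_eq_of_mem _ _ _ (show ‖z.1‖ ∈ Ioi (0 : ℝ) from norm_pos_iff.2 h)]
  rw [key]
  have hi : Measurable fun z : Euc n × Euc n => ⟪z.2, ‖z.1‖⁻¹ • z.1⟫ :=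
    measurable_snd.inner (measurable_fst.norm.inv.smul measurable_fst)
  refine Measurable.ite (measurable_fst (measurableSet_singleton 0)) measurable_snd.norm ?_
  refine Measurable.sqrt ((hi.pow_const 2).add ?_)
  exact (((hGm.comp measurable_fst.norm).div measurable_fst.norm).pow_const 2).mul
    ((measurable_snd.norm.pow_const 2).sub (hi.pow_const 2))

end WarpNorm

section Lipschitz

theorem exists_lipschitzWith_eqOn_Icc {α : Type*} [PseudoEMetricSpace α] {K : ℝ≥0} {f : ℝ → α}
    {a b : ℝ} (hab : a ≤ b) (hf : LipschitzOnWith K f (Icc a b)) :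
    ∃ g : ℝ → α, LipschitzWith K g ∧ EqOn g f (Icc a b) ∧ ∀ t, ∃ s ∈ Icc a b, g t = f s := by
  refine ⟨fun t => f (projIcc a b hab t), fun s t => ?_, fun t ht => ?_,
    fun t => ⟨_, (projIcc a b hab t).2, rfl⟩⟩
  · refine (hf (projIcc a b hab s).2 (projIcc a b hab t).2).trans ?_
    gcongr
    have := (LipschitzWith.projIcc hab) s t
    rwa [ENNReal.coe_one, one_mul] at this
  · simp [projIcc_of_mem hab ht]

theorem integral_deriv_of_lipschitz {K : ℝ≥0} {h : ℝ → ℝ} (hh : LipschitzWith K h) (a b : ℝ) :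
    ∫ t in a..b, deriv h t = h b - h a :=
  (hh.lipschitzOnWith (s := uIcc a b)).absolutelyContinuousOnInterval.integral_deriv_eq_sub

theorem intervalIntegrable_of_abs_le {f : ℝ → ℝ} (hf : Measurable f) {a b C : ℝ}
    (hC : ∀ t ∈ uIcc a b, |f t| ≤ C) : IntervalIntegrable f volume a b := by
  refine (intervalIntegrable_const (c := C)).mono_fun' hf.aestronglyMeasurable ?_
  refine (ae_restrict_iff' measurableSet_uIoc).2 (Eventually.of_forall fun t ht => ?_)
  exact hC t (uIoc_subset_uIcc ht)

variable {n : ℕ} {c : ℝ → Euc n} {K : ℝ≥0}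

theorem intervalIntegrable_norm_deriv (hcl : LipschitzWith K c) (a b : ℝ) :
    IntervalIntegrable (fun t => ‖deriv c t‖) volume a b :=
  intervalIntegrable_of_abs_le (C := K) (measurable_deriv c).norm fun t _ => by
    rw [abs_norm]; exact norm_deriv_le_of_lipschitz hcl

theorem norm_sub_le_integral_norm_deriv (hcl : LipschitzWith K c) {a b : ℝ} (hab : a ≤ b) :
    ‖c b - c a‖ ≤ ∫ t in a..b, ‖deriv c t‖ := by
  set u := c b - c a with hu
  have hfl : LipschitzWith (‖u‖₊ * K) (fun t => ⟪u, c t⟫) := by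
    have := ((innerSL ℝ u).lipschitz).comp hcl
    rwa [show ‖innerSL ℝ u‖₊ = ‖u‖₊ from NNReal.eq (innerSL_apply_norm ℝ u)] at this
  have h1 := integral_deriv_of_lipschitz hfl a b
  have h2 : ∫ t in a..b, deriv (fun t => ⟪u, c t⟫) t ≤ ∫ t in a..b, ‖u‖ * ‖deriv c t‖ := by
    refine intervalIntegral.integral_mono_ae hab ?_ ?_ ?_
    · exact intervalIntegrable_of_abs_le (C := ‖u‖₊ * K) (measurable_deriv _) fun t _ => by
        rw [← Real.norm_eq_abs]; exact_mod_cast norm_deriv_le_of_lipschitz hfl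
    · exact (intervalIntegrable_norm_deriv hcl a b).const_mul _
    · filter_upwards [hcl.ae_differentiableAt_real] with t ht
      have : HasDerivAt (fun t => ⟪u, c t⟫) ⟪u, deriv c t⟫ t :=
        ((innerSL ℝ u).hasFDerivAt.comp_hasDerivAt t ht.hasDerivAt)
      rw [this.deriv]
      exact real_inner_le_norm _ _
  rw [h1, intervalIntegral.integral_const_mul, ← inner_sub_right, ← hu,
    real_inner_self_eq_norm_sq, sq] at h2
  by_cases h0 : ‖u‖ = 0
  · rw [h0]
    exact intervalIntegral.integral_nonneg hab fun t _ => norm_nonneg _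
  · exact le_of_mul_le_mul_left h2 (lt_of_le_of_ne (norm_nonneg _) (Ne.symm h0))

end Lipschitz

section WarpedLength

variable {n : ℕ} {G : ℝ → ℝ} {c : ℝ → Euc n} {K : ℝ≥0}

/-- The speed of the curve `c` in the warped metric. -/
def warpSpeed (G : ℝ → ℝ) (c : ℝ → Euc n) (t : ℝ) : ℝ := warpNorm G (c t) (deriv c t)

theorem warpSpeed_nonneg (t : ℝ) : 0 ≤ warpSpeed G c t := warpNorm_nonneg _ _

theorem measurable_warpSpeed (hG : IsWarping G) (hcc : Continuous c) :
    Measurable (warpSpeed G c) :=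
  (measurable_warpNorm hG).comp (hcc.measurable.prodMk (measurable_deriv c))

theorem exists_warpSpeed_le (hG : IsWarping G) (hc : NonposCurvWarping G)
    (hcl : LipschitzWith K c) (a b : ℝ) : ∃ C, 0 ≤ C ∧ ∀ t ∈ uIcc a b, warpSpeed G c t ≤ C := by
  obtain ⟨R, hR⟩ := (isCompact_uIcc (a := a) (b := b)).exists_bound_of_continuousOn
    hcl.continuous.continuousOn
  have hR' : 0 < max R 1 := lt_max_of_lt_right one_pos
  refine ⟨G (max R 1) / max R 1 * K, ?_, fun t ht => ?_⟩
  · have := hG.1 _ hR'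
    positivity
  · refine (warpNorm_le hG hc hR' ((hR t ht).trans (le_max_left _ _)) _).trans ?_
    have := hG.1 _ hR'
    gcongr
    exact norm_deriv_le_of_lipschitz hcl

theorem intervalIntegrable_warpSpeed (hG : IsWarping G) (hc : NonposCurvWarping G)
    (hcl : LipschitzWith K c) (a b : ℝ) : IntervalIntegrable (warpSpeed G c) volume a b := by
  obtain ⟨C, -, hC⟩ := exists_warpSpeed_le hG hc hcl a b
  refine intervalIntegrable_of_abs_le (C := C) (measurable_warpSpeed hG hcl.continuous)
    fun t ht => ?_
  rw [abs_of_nonneg (warpSpeed_nonneg t)]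
  exact hC t ht

theorem intervalIntegrable_warpSpeed_sq (hG : IsWarping G) (hc : NonposCurvWarping G)
    (hcl : LipschitzWith K c) (a b : ℝ) :
    IntervalIntegrable (fun t => warpSpeed G c t ^ 2) volume a b := by
  obtain ⟨C, hC0, hC⟩ := exists_warpSpeed_le hG hc hcl a b
  refine intervalIntegrable_of_abs_le (C := C ^ 2)
    ((measurable_warpSpeed hG hcl.continuous).pow_const 2) fun t ht => ?_
  rw [abs_of_nonneg (sq_nonneg _)]
  exact pow_le_pow_left₀ (warpSpeed_nonneg t) (hC t ht) 2

theorem warpLength_eq (hG : IsWarping G) (hc : NonposCurvWarping G)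
    (hcl : LipschitzWith K c) {T : ℝ} (hT : 0 ≤ T) :
    warpLength G c T = ENNReal.ofReal (∫ t in (0 : ℝ)..T, warpSpeed G c t) := by
  have hi := intervalIntegrable_warpSpeed hG hc hcl 0 T
  rw [intervalIntegral.integral_of_le hT, ofReal_integral_eq_lintegral_ofReal
    ((intervalIntegrable_iff_integrableOn_Ioc_of_le hT).1 hi)
    (Eventually.of_forall fun t => warpSpeed_nonneg t), warpLength,
    Measure.restrict_congr_set Ioc_ae_eq_Icc]
  rfl

theorem warpSpeed_eq_of_eqOn {c' : ℝ → Euc n} {a b : ℝ} (h : EqOn c c' (Icc a b)) {t : ℝ}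
    (ht : t ∈ Ioo a b) : warpSpeed G c t = warpSpeed G c' t := by
  have : c =ᶠ[𝓝 t] c' := by
    filter_upwards [Ioo_mem_nhds ht.1 ht.2] with s hs using h (Ioo_subset_Icc_self hs)
  rw [warpSpeed, warpSpeed, this.deriv_eq, this.eq_of_nhds]

end WarpedLength

section Chart

variable {n : ℕ} {G : ℝ → ℝ} {p : M} {Φ : Euc n ≃ M} {K : ℝ≥0}

theorem dist_le_integral_warpSpeed (hsym : IsSphericallySymmetric p G Φ)
    (hc : NonposCurvWarping G) {c : ℝ → Euc n} (hcl : LipschitzWith K c) {a b : ℝ}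
    (hab : a ≤ b) : dist (Φ (c a)) (Φ (c b)) ≤ ∫ t in a..b, warpSpeed G c t := by
  have hcl' : LipschitzWith K (fun t => c (a + t)) := by
    have := hcl.comp (f := c) (g := fun t : ℝ => a + t) (Kg := 1)
      (LipschitzWith.of_dist_le_mul fun x y => by simp)
    simpa [Function.comp_def] using this
  have hnn : 0 ≤ ∫ t in a..b, warpSpeed G c t :=
    intervalIntegral.integral_nonneg hab fun t _ => warpSpeed_nonneg t
  rw [← ENNReal.ofReal_le_ofReal_iff hnn, hsym.2.2.2]
  refine sInf_le_of_le ⟨b - a, fun t => c (a + t), sub_nonneg.2 hab, by simp, by simp,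
    ⟨K, hcl'.lipschitzOnWith⟩, rfl⟩ ?_
  rw [warpLength_eq hsym.1 hc hcl' (sub_nonneg.2 hab)]
  have : ∀ t, warpSpeed G (fun t => c (a + t)) t = warpSpeed G c (a + t) := fun t => by
    rw [warpSpeed, warpSpeed, deriv_comp_const_add]
  simp_rw [this]
  rw [intervalIntegral.integral_comp_add_left (fun t => warpSpeed G c t) a]
  simp

theorem exists_curve_lt (hsym : IsSphericallySymmetric p G Φ) (hc : NonposCurvWarping G)
    (x y : Euc n) {ε : ℝ} (hε : 0 < ε) : ∃ (T : ℝ) (c : ℝ → Euc n) (K : ℝ≥0), 0 ≤ T ∧ c 0 = x ∧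
      c T = y ∧ LipschitzWith K c ∧ ∫ t in (0 : ℝ)..T, warpSpeed G c t < dist (Φ x) (Φ y) + ε := by
  have h : ENNReal.ofReal (dist (Φ x) (Φ y)) < ENNReal.ofReal (dist (Φ x) (Φ y) + ε) :=
    (ENNReal.ofReal_lt_ofReal_iff (by positivity)).2 (by linarith)
  rw [hsym.2.2.2 x y, sInf_lt_iff] at h
  obtain ⟨_, ⟨T, c, hT, h0, h1, ⟨K, hK⟩, rfl⟩, hL⟩ := h
  obtain ⟨g, hg, hgc, -⟩ := exists_lipschitzWith_eqOn_Icc hT hK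
  refine ⟨T, g, K, hT, by rw [hgc ⟨le_rfl, hT⟩, h0], by rw [hgc ⟨hT, le_rfl⟩, h1], hg, ?_⟩
  have : warpLength G c T = warpLength G g T := by
    unfold warpLength
    rw [Measure.restrict_congr_set Ioo_ae_eq_Icc.symm]
    refine setLIntegral_congr_fun measurableSet_Ioo fun t ht => ?_
    exact congrArg ENNReal.ofReal (warpSpeed_eq_of_eqOn hgc ht).symm
  rw [this, warpLength_eq hsym.1 hc hg hT] at hL
  exact (ENNReal.ofReal_lt_ofReal_iff (by positivity)).1 hL

theorem norm_sub_le_integral_warpSpeed (hG : IsWarping G) (hc : NonposCurvWarping G)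
    {c : ℝ → Euc n} (hcl : LipschitzWith K c) {a b : ℝ} (hab : a ≤ b) :
    ‖c b - c a‖ ≤ ∫ t in a..b, warpSpeed G c t :=
  (norm_sub_le_integral_norm_deriv hcl hab).trans <|
    intervalIntegral.integral_mono_on hab (intervalIntegrable_norm_deriv hcl a b)
      (intervalIntegrable_warpSpeed hG hc hcl a b) fun _ _ => norm_le_warpNorm hG hc _ _

theorem norm_sub_le_dist (hsym : IsSphericallySymmetric p G Φ) (hc : NonposCurvWarping G)
    (x y : Euc n) : ‖x - y‖ ≤ dist (Φ x) (Φ y) := by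
  refine le_of_forall_pos_le_add fun ε hε => ?_
  obtain ⟨T, c, K, hT, rfl, rfl, hcl, hl⟩ := exists_curve_lt hsym hc x y hε
  rw [norm_sub_rev]
  exact (norm_sub_le_integral_warpSpeed hsym.1 hc hcl hT).trans hl.le

theorem lipschitzWith_symm_comp (hsym : IsSphericallySymmetric p G Φ)
    (hc : NonposCurvWarping G) {γ : ℝ → M} (hγ : LipschitzWith K γ) :
    LipschitzWith K (fun t => Φ.symm (γ t)) := by
  refine LipschitzWith.of_dist_le_mul fun s t => ?_
  rw [dist_eq_norm]
  refine (norm_sub_le_dist hsym hc _ _).trans ?_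
  simpa using hγ.dist_le_mul s t

theorem exists_min_le_dist (hsym : IsSphericallySymmetric p G Φ) (hc : NonposCurvWarping G)
    {x : Euc n} (hx : x ≠ 0) {ε : ℝ} (hε : 0 < ε) :
    ∃ δ > 0, ∀ y, min δ (‖warpMap G x (y - x)‖ / (1 + ε)) ≤ dist (Φ x) (Φ y) := by
  obtain ⟨δ, hδ, H⟩ := le_warpNorm_of_near hsym.1 hc hx hε
  refine ⟨δ, hδ, fun y => le_of_forall_pos_le_add fun ε' hε' => ?_⟩
  obtain ⟨T, c, K, hT, rfl, rfl, hcl, hl⟩ := exists_curve_lt hsym hc x y hε'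
  refine le_trans ?_ hl.le
  by_cases hs : ∃ s ∈ Icc 0 T, δ ≤ ‖c s - c 0‖
  · obtain ⟨s, hs, hδs⟩ := hs
    refine (min_le_left _ _).trans (hδs.trans ?_)
    refine (norm_sub_le_integral_warpSpeed hsym.1 hc hcl hs.1).trans ?_
    exact intervalIntegral.integral_mono_interval le_rfl hs.1 hs.2
      (Eventually.of_forall fun t => warpSpeed_nonneg t)
      (intervalIntegrable_warpSpeed hsym.1 hc hcl 0 T)
  · push Not at hs
    refine (min_le_right _ _).trans ?_
    rw [div_le_iff₀ (by linarith), map_sub, mul_comm, ← intervalIntegral.integral_const_mul]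
    have hA := ((warpMap G (c 0)).lipschitz).comp hcl
    refine (norm_sub_le_integral_norm_deriv hA hT).trans ?_
    refine intervalIntegral.integral_mono_ae_restrict hT (intervalIntegrable_norm_deriv hA 0 T)
      ((intervalIntegrable_warpSpeed hsym.1 hc hcl 0 T).const_mul _) ?_
    refine (ae_restrict_iff' measurableSet_Icc).2 ?_
    filter_upwards [hcl.ae_differentiableAt_real] with t ht htm
    have : HasDerivAt (warpMap G (c 0) ∘ c) (warpMap G (c 0) (deriv c t)) t :=
      (warpMap G (c 0)).hasFDerivAt.comp_hasDerivAt t ht.hasDerivAt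
    rw [this.deriv]
    exact H _ (hs t htm) _

theorem warpSpeed_le_of_lipschitzWith (hsym : IsSphericallySymmetric p G Φ)
    (hc : NonposCurvWarping G) {γ : ℝ → M} (hγ : LipschitzWith K γ) {t : ℝ}
    (ht : DifferentiableAt ℝ (fun t => Φ.symm (γ t)) t) :
    warpSpeed G (fun t => Φ.symm (γ t)) t ≤ K := by
  set c := fun t => Φ.symm (γ t) with hcdef
  have hcl : LipschitzWith K c := lipschitzWith_symm_comp hsym hc hγ
  by_cases h0 : c t = 0
  · rw [warpSpeed, h0, warpNorm_zero_left]
    exact norm_deriv_le_of_lipschitz hcl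
  rw [warpSpeed, ← norm_warpMap h0]
  have key : ∀ ε : ℝ, 0 < ε → ‖warpMap G (c t) (deriv c t)‖ ≤ (1 + ε) * K := by
    intro ε hε
    obtain ⟨δ, hδ, H⟩ := exists_min_le_dist hsym hc h0 hε
    have hd : HasDerivAt (fun s => warpMap G (c t) (c s)) (warpMap G (c t) (deriv c t)) t :=
      (warpMap G (c t)).hasFDerivAt.comp_hasDerivAt t ht.hasDerivAt
    refine hd.le_of_lip' (by positivity) ?_
    have hnear : ∀ᶠ s in 𝓝 t, dist (γ t) (γ s) < δ :=
      (continuous_const.dist hγ.continuous).continuousAt.eventually_lt continuousAt_const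
        (by simpa using hδ)
    filter_upwards [hnear] with s hs
    have h1 := H (c s)
    have h2 : dist (Φ (c t)) (Φ (c s)) = dist (γ t) (γ s) := by simp [hcdef]
    rw [h2] at h1
    have h3 := hγ.dist_le_mul t s
    rcases min_le_iff.1 h1 with h | h
    · linarith
    · rw [div_le_iff₀ (by linarith)] at h
      rw [← map_sub, ← dist_eq_norm s t, dist_comm s t]
      nlinarith
  refine le_of_tendsto_of_tendsto (f := fun _ : ℝ => ‖warpMap G (c t) (deriv c t)‖)
    (g := fun ε : ℝ => (1 + ε) * K) (b := 𝓝[>] (0 : ℝ)) tendsto_const_nhds ?_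
    (by filter_upwards [self_mem_nhdsWithin] with ε hε using key ε hε)
  have : Tendsto (fun ε : ℝ => (1 + ε) * (K : ℝ)) (𝓝 0) (𝓝 ((1 + 0) * K)) :=
    Continuous.tendsto (by fun_prop) 0
  simpa using this.mono_left nhdsWithin_le_nhds

theorem ae_warpSpeed_eq (hsym : IsSphericallySymmetric p G Φ)
    (hc : NonposCurvWarping G) {γ : ℝ → M} (hγ : LipschitzWith K γ) {a b : ℝ} (hab : a ≤ b)
    (h : K * (b - a) ≤ ∫ t in a..b, warpSpeed G (fun t => Φ.symm (γ t)) t) :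
    ∀ᵐ t ∂volume.restrict (Ioc a b), warpSpeed G (fun t => Φ.symm (γ t)) t = K := by
  have hcl := lipschitzWith_symm_comp hsym hc hγ
  set c := fun t => Φ.symm (γ t) with hcdef
  have hi := intervalIntegrable_warpSpeed hsym.1 hc hcl a b
  have hle : ∀ᵐ t, warpSpeed G c t ≤ K := by
    filter_upwards [hcl.ae_differentiableAt_real] with t ht
    exact warpSpeed_le_of_lipschitzWith hsym hc hγ ht
  have h0 : ∫ t in a..b, ((K : ℝ) - warpSpeed G c t) = 0 := by
    refine le_antisymm ?_ ?_
    · rw [intervalIntegral.integral_sub intervalIntegrable_const hi,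
        intervalIntegral.integral_const, smul_eq_mul]
      linarith
    · exact intervalIntegral.integral_nonneg_of_ae hab
        (hle.mono fun t ht => sub_nonneg.2 ht)
  rw [intervalIntegral.integral_of_le hab, integral_eq_zero_iff_of_nonneg_ae
    (ae_restrict_of_ae (hle.mono fun t ht => sub_nonneg.2 ht))] at h0
  · filter_upwards [h0] with t ht
    have : (K : ℝ) - warpSpeed G c t = 0 := ht
    linarith
  · exact (intervalIntegrable_iff_integrableOn_Ioc_of_le hab).1
      (intervalIntegrable_const.sub hi)

theorem eVariationOn_le_integral_warpSpeed (hsym : IsSphericallySymmetric p G Φ)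
    (hc : NonposCurvWarping G) {c : ℝ → Euc n} (hcl : LipschitzWith K c) {a b : ℝ}
    (hab : a ≤ b) : eVariationOn (fun t => Φ (c t)) (Icc a b) ≤
      ENNReal.ofReal (∫ t in a..b, warpSpeed G c t) := by
  have hi := fun a b => intervalIntegrable_warpSpeed hsym.1 hc hcl a b
  set F : ℝ → ℝ := fun t => ∫ s in a..t, warpSpeed G c s with hF
  have hd : ∀ s t, s ≤ t → dist (Φ (c s)) (Φ (c t)) ≤ F t - F s := by
    intro s t hst
    have := dist_le_integral_warpSpeed hsym hc hcl hst
    rw [hF]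
    simp only
    rw [intervalIntegral.integral_interval_sub_left (hi _ _) (hi _ _)]
    exact this
  have hm : MonotoneOn F (Icc a b) := fun s _ t _ hst => by
    linarith [hd s t hst, dist_nonneg (x := Φ (c s)) (y := Φ (c t))]
  have hFa : F a = 0 := by simp [hF]
  have hv := hm.eVariationOn_eq (left_mem_Icc.2 hab) (right_mem_Icc.2 hab)
  rw [inter_self, hFa, sub_zero] at hv
  refine le_trans ?_ hv.le
  refine iSup_mono fun q => Finset.sum_le_sum fun i _ => ?_
  have hst := q.2.2.1 (Nat.le_succ i)
  rw [edist_dist, edist_dist, Real.dist_eq]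
  refine ENNReal.ofReal_le_ofReal ?_
  rw [dist_comm]
  exact (hd _ _ hst).trans (le_abs_self _)

theorem isLengthSpace (hsym : IsSphericallySymmetric p G Φ) (hc : NonposCurvWarping G)
    (x y : M) : dCompl (∅ : Set M) x y ≤ ENNReal.ofReal (dist x y) := by
  refine ENNReal.le_of_forall_pos_le_add fun ε hε _ => ?_
  obtain ⟨T, c, K, hT, h0, h1, hcl, hl⟩ :=
    exists_curve_lt hsym hc (Φ.symm x) (Φ.symm y) (NNReal.coe_pos.2 hε)
  obtain ⟨C, hC0, hC⟩ := exists_warpSpeed_le hsym.1 hc hcl 0 T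
  rw [Φ.apply_symm_apply, Φ.apply_symm_apply] at hl
  have hle : pathLength (fun t => Φ (c t)) T ≤ ENNReal.ofReal (dist x y) + ε := by
    have hε' : (ε : ℝ≥0∞) = ENNReal.ofReal ε := (ENNReal.ofReal_coe_nnreal).symm
    rw [hε', ← ENNReal.ofReal_add dist_nonneg ε.coe_nonneg]
    exact (eVariationOn_le_integral_warpSpeed hsym hc hcl hT).trans
      (ENNReal.ofReal_le_ofReal hl.le)
  refine sInf_le_of_le ⟨T, fun t => Φ (c t), hT, by simp [h0], by simp [h1],
    ⟨C.toNNReal, ?_⟩, fun _ _ => notMem_empty _, rfl⟩ hle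
  have key : ∀ s ∈ Icc 0 T, ∀ t ∈ Icc 0 T, s ≤ t →
      dist (Φ (c s)) (Φ (c t)) ≤ C * |s - t| := by
    intro s hs t ht hst
    refine (dist_le_integral_warpSpeed hsym hc hcl hst).trans ?_
    refine (le_abs_self _).trans ?_
    rw [abs_sub_comm s t, ← Real.norm_eq_abs (∫ u in s..t, warpSpeed G c u)]
    refine intervalIntegral.norm_integral_le_of_norm_le_const fun u hu => ?_
    rw [Real.norm_of_nonneg (warpSpeed_nonneg u)]
    rw [uIoc_of_le hst] at hu
    refine hC u ?_
    rw [uIcc_of_le hT]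
    exact ⟨hs.1.trans hu.1.le, hu.2.trans ht.2⟩
  refine LipschitzOnWith.of_dist_le_mul fun s hs t ht => ?_
  rw [Real.coe_toNNReal _ hC0, Real.dist_eq]
  rcases le_total s t with h | h
  · exact key s hs t ht h
  · rw [dist_comm, abs_sub_comm]
    exact key t ht s hs h

end Chart

section Joins

/-- `x` and `y` are joined by a `1`-Lipschitz path on `[0, L]` avoiding `S`. -/
def Joins (S : Set M) (x y : M) (L : ℝ) : Prop :=
  0 ≤ L ∧ ∃ g : ℝ → M, LipschitzWith 1 g ∧ g 0 = x ∧ g L = y ∧ ∀ t, g t ∉ S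

variable {S : Set M} {x y z : M} {L L' : ℝ}

theorem Joins.of_icc (hL : 0 ≤ L) {g : ℝ → M} (hg : LipschitzOnWith 1 g (Icc 0 L))
    (h0 : g 0 = x) (h1 : g L = y) (hS : ∀ t ∈ Icc 0 L, g t ∉ S) : Joins S x y L := by
  have hp : LipschitzWith 1 (fun t => (projIcc 0 L hL t : ℝ)) := fun s t => by
    simpa [Subtype.edist_eq] using (LipschitzWith.projIcc hL) s t
  refine ⟨hL, fun t => g (projIcc 0 L hL t), ?_, ?_, ?_, fun t => hS _ (projIcc 0 L hL t).2⟩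
  · have := hg.comp (hp.lipschitzOnWith (s := univ)) (fun t _ => (projIcc 0 L hL t).2)
    rw [mul_one] at this
    exact lipschitzOnWith_univ.1 this
  · simp [h0]
  · simp [h1]

theorem Joins.mono (h : Joins S x y L) (hLL : L ≤ L') : Joins S x y L' := by
  obtain ⟨hL, g, hg, h0, h1, hS⟩ := h
  refine ⟨hL.trans hLL, fun t => g (min t L), ?_, by simp [hL, h0], by simp [hLL, h1],
    fun t => hS _⟩
  have := hg.comp (LipschitzWith.id.min_const L)
  rwa [mul_one] at this

theorem Joins.anti {S' : Set M} (h : Joins S x y L) (hS : S' ⊆ S) : Joins S' x y L := by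
  obtain ⟨hL, g, hg, h0, h1, hgS⟩ := h
  exact ⟨hL, g, hg, h0, h1, fun t ht => hgS t (hS ht)⟩

theorem Joins.symm (h : Joins S x y L) : Joins S y x L := by
  obtain ⟨hL, g, hg, h0, h1, hS⟩ := h
  refine ⟨hL, fun t => g (L - t), ?_, by simp [h1], by simp [h0], fun t => hS _⟩
  refine LipschitzWith.of_dist_le_mul fun s t => ?_
  refine (hg.dist_le_mul _ _).trans ?_
  rw [dist_sub_left]

theorem Joins.trans (h : Joins S x y L) (h' : Joins S y z L') : Joins S x z (L + L') := by
  obtain ⟨hL, g, hg, h0, h1, hS⟩ := h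
  obtain ⟨hL', k, hk, k0, k1, kS⟩ := h'
  set f : ℝ → M := fun t => if t ≤ L then g t else k (t - L) with hf
  have key : ∀ s t, s ≤ t → dist (f s) (f t) ≤ t - s := by
    intro s t hst
    have e1 : ∀ s t : ℝ, s ≤ t → dist (g s) (g t) ≤ t - s := fun s t hst => by
      have := hg.dist_le_mul s t
      rwa [NNReal.coe_one, one_mul, dist_comm s t, Real.dist_eq,
        abs_of_nonneg (sub_nonneg.2 hst)] at this
    have e2 : ∀ s t : ℝ, s ≤ t → dist (k s) (k t) ≤ t - s := fun s t hst => by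
      have := hk.dist_le_mul s t
      rwa [NNReal.coe_one, one_mul, dist_comm s t, Real.dist_eq,
        abs_of_nonneg (sub_nonneg.2 hst)] at this
    simp only [hf]
    split_ifs with h3 h4 h4
    · exact e1 s t hst
    · have a1 := e1 s L h3
      have a2 := e2 0 (t - L) (by linarith)
      rw [k0, ← h1] at a2
      linarith [dist_triangle (g s) (g L) (k (t - L))]
    · linarith
    · have := e2 (s - L) (t - L) (by linarith)
      linarith
  refine ⟨add_nonneg hL hL', f, LipschitzWith.of_dist_le_mul fun s t => ?_, by simp [hf, hL, h0],
    ?_, fun t => ?_⟩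
  · rw [NNReal.coe_one, one_mul, Real.dist_eq]
    rcases le_total s t with h | h
    · rw [abs_sub_comm, abs_of_nonneg (sub_nonneg.2 h)]
      exact key s t h
    · rw [dist_comm, abs_of_nonneg (sub_nonneg.2 h)]
      exact key t s h
  · rcases hL'.eq_or_lt with h | h
    · simp only [hf]
      rw [← h, add_zero, if_pos le_rfl, h1, ← k0, h, k1]
    · simp [hf, not_le.2 (by linarith : L < L + L'), k1]
  · simp only [hf]
    split_ifs
    · exact hS _
    · exact kS _

theorem Joins.dCompl_le (h : Joins S x y L) : dCompl S x y ≤ ENNReal.ofReal L := by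
  obtain ⟨hL, g, hg, h0, h1, hS⟩ := h
  have hle : pathLength g L ≤ ENNReal.ofReal L := by
    have hm : MonotoneOn (fun t : ℝ => t) (Icc 0 L) := fun s _ t _ h => h
    have hv := hm.eVariationOn_eq (left_mem_Icc.2 hL) (right_mem_Icc.2 hL)
    rw [inter_self, sub_zero] at hv
    rw [← hv]
    refine iSup_mono fun q => Finset.sum_le_sum fun i _ => ?_
    simpa using hg _ _
  exact sInf_le_of_le ⟨L, g, hL, h0, h1, ⟨1, hg.lipschitzOnWith⟩, fun t _ => hS t, rfl⟩ hle

theorem ofReal_dist_le_dCompl (S : Set M) (x y : M) :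
    ENNReal.ofReal (dist x y) ≤ dCompl S x y := by
  refine le_sInf ?_
  rintro _ ⟨T, g, hT, rfl, rfl, -, -, rfl⟩
  rw [← edist_dist]
  exact eVariationOn.edist_le g (left_mem_Icc.2 hT) (right_mem_Icc.2 hT)

theorem Joins.dist_le (h : Joins S x y L) : dist x y ≤ L :=
  (ENNReal.ofReal_le_ofReal_iff h.1).1 ((ofReal_dist_le_dCompl S x y).trans h.dCompl_le)

theorem Joins.of_dCompl_lt (h : dCompl S x y < ENNReal.ofReal L) : Joins S x y L := by
  obtain ⟨_, ⟨T, γ, hT, rfl, rfl, ⟨K, hK⟩, hS, rfl⟩, hl⟩ := sInf_lt_iff.1 h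
  have hL : 0 < L := ENNReal.ofReal_pos.1 (bot_le.trans_lt hl)
  have hbv : LocallyBoundedVariationOn γ (Icc 0 T) := fun a b _ _ =>
    ((eVariationOn.mono γ inter_subset_left).trans_lt (hl.trans ENNReal.ofReal_lt_top)).ne
  set v := variationOnFromTo γ (Icc 0 T) 0 with hv
  have h0m : (0 : ℝ) ∈ Icc 0 T := left_mem_Icc.2 hT
  have hTm : T ∈ Icc 0 T := right_mem_Icc.2 hT
  have hvm : MonotoneOn v (Icc 0 T) := variationOnFromTo.monotoneOn hbv h0m
  have hv0 : v 0 = 0 := variationOnFromTo.self _ _ _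
  have hvT : v T ≤ L := by
    rw [hv, variationOnFromTo.eq_of_le _ _ hT, inter_self]
    exact ENNReal.toReal_le_of_le_ofReal hL.le hl.le
  have hsub : ∀ s ∈ Icc 0 T, ∀ t ∈ Icc 0 T, s ≤ t →
      v t - v s = (eVariationOn γ (Icc 0 T ∩ Icc s t)).toReal := by
    intro s hs t ht hst
    have := variationOnFromTo.add hbv h0m hs ht
    rw [← hv, variationOnFromTo.eq_of_le _ _ hst] at this
    linarith
  have hd : ∀ s ∈ Icc 0 T, ∀ t ∈ Icc 0 T, s ≤ t → dist (γ s) (γ t) ≤ v t - v s := by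
    intro s hs t ht hst
    rw [hsub s hs t ht hst, dist_edist]
    exact ENNReal.toReal_mono (hbv s t hs ht)
      (eVariationOn.edist_le γ ⟨hs, le_rfl, hst⟩ ⟨ht, hst, le_rfl⟩)
  have hvK : ∀ s ∈ Icc 0 T, ∀ t ∈ Icc 0 T, s ≤ t → v t - v s ≤ K * (t - s) := by
    intro s hs t ht hst
    rw [hsub s hs t ht hst]
    refine ENNReal.toReal_le_of_le_ofReal (mul_nonneg K.coe_nonneg (sub_nonneg.2 hst)) ?_
    refine ((hK.mono inter_subset_left).comp_eVariationOn_le (g := id)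
      (mapsTo_id (Icc 0 T ∩ Icc s t))).trans ?_
    have hm : MonotoneOn (id : ℝ → ℝ) (Icc 0 T) := fun s _ t _ h => h
    rw [hm.eVariationOn_eq hs ht, ENNReal.ofReal_mul K.coe_nonneg, ENNReal.ofReal_coe_nnreal]
    rfl
  have hvc : ContinuousOn v (Icc 0 T) := by
    refine (LipschitzOnWith.of_dist_le_mul (K := K) fun s hs t ht => ?_).continuousOn
    rw [Real.dist_eq, Real.dist_eq]
    rcases le_total s t with h | h
    · rw [abs_sub_comm, abs_sub_comm s t, abs_of_nonneg (sub_nonneg.2 (hvm hs ht h)),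
        abs_of_nonneg (sub_nonneg.2 h)]
      exact hvK s hs t ht h
    · rw [abs_of_nonneg (sub_nonneg.2 (hvm ht hs h)), abs_of_nonneg (sub_nonneg.2 h)]
      exact hvK t ht s hs h
  have hivt : ∀ l ∈ Icc 0 (v T), ∃ t ∈ Icc 0 T, v t = l := fun l hl =>
    intermediate_value_Icc hT hvc (by rwa [hv0])
  choose! τ hτ hvτ using hivt
  have hdτ : ∀ s ∈ Icc 0 T, ∀ t ∈ Icc 0 T, dist (γ s) (γ t) ≤ |v s - v t| := by
    intro s hs t ht
    rcases le_total s t with h | h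
    · rw [abs_sub_comm]
      exact (hd s hs t ht h).trans (le_abs_self _)
    · rw [dist_comm]
      exact (hd t ht s hs h).trans (le_abs_self _)
  have hvT0 : 0 ≤ v T := hv0 ▸ hvm h0m hTm hT
  refine Joins.mono (L := v T) ?_ hvT
  refine Joins.of_icc hvT0 (g := fun l => γ (τ l)) ?_ ?_ ?_ fun l hl => hS _ (hτ _ hl)
  · refine LipschitzOnWith.of_dist_le_mul fun a ha b hb => ?_
    rw [NNReal.coe_one, one_mul, Real.dist_eq]
    have := hdτ _ (hτ _ ha) _ (hτ _ hb)
    rwa [hvτ _ ha, hvτ _ hb] at this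
  · have := hdτ _ (hτ _ (left_mem_Icc.2 hvT0)) _ h0m
    rw [hvτ _ (left_mem_Icc.2 hvT0), hv0, sub_zero, abs_zero] at this
    exact dist_le_zero.1 this
  · have := hdτ _ (hτ _ (right_mem_Icc.2 hvT0)) _ hTm
    rw [hvτ _ (right_mem_Icc.2 hvT0), sub_self, abs_zero] at this
    exact dist_le_zero.1 this

end Joins

section Compactness

variable [ProperSpace M]

theorem exists_limit_curve {q : M} (g : ℕ → ℝ → M) (hg : ∀ k, LipschitzWith 1 (g k))
    (h0 : ∀ k, g k 0 = q) : ∃ (U : Filter ℕ) (g' : ℝ → M), U.NeBot ∧ U ≤ atTop ∧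
      LipschitzWith 1 g' ∧ ∀ (s : ℕ → ℝ) (s₀ : ℝ), Tendsto s U (𝓝 s₀) →
        Tendsto (fun k => g k (s k)) U (𝓝 (g' s₀)) := by
  have hlim : ∀ t, ∃ z, Tendsto (fun k => g k t) (hyperfilter ℕ : Filter ℕ) (𝓝 z) := by
    intro t
    obtain ⟨z, -, hz⟩ := (isCompact_closedBall q |t|).ultrafilter_le_nhds
      ((hyperfilter ℕ).map fun k => g k t) (by
        rw [Filter.le_principal_iff]
        refine Filter.mem_map.2 (Filter.univ_mem' fun k => ?_)
        have := (hg k).dist_le_mul t 0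
        rw [h0, NNReal.coe_one, one_mul, Real.dist_eq, sub_zero] at this
        exact mem_closedBall.2 this)
    exact ⟨z, hz⟩
  choose g' hg' using hlim
  refine ⟨hyperfilter ℕ, g', inferInstance, Nat.hyperfilter_le_atTop, ?_, ?_⟩
  · refine LipschitzWith.of_dist_le_mul fun s t => ?_
    exact le_of_tendsto ((hg' s).dist (hg' t))
      (Eventually.of_forall fun k => (hg k).dist_le_mul s t)
  · intro s s₀ hs
    have h1 : Tendsto (fun k => dist (s k) s₀) (hyperfilter ℕ : Filter ℕ) (𝓝 0) :=
      tendsto_iff_dist_tendsto_zero.1 hs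
    have h2 := h1.add (tendsto_iff_dist_tendsto_zero.1 (hg' s₀))
    rw [add_zero] at h2
    rw [tendsto_iff_dist_tendsto_zero]
    refine squeeze_zero (fun _ => dist_nonneg) (fun k => ?_) h2
    refine (dist_triangle _ (g k s₀) _).trans (add_le_add ?_ le_rfl)
    simpa using (hg k).dist_le_mul (s k) s₀

theorem joins_of_tendsto {S : ℕ → Set M} (hS : Monotone S) (hSo : ∀ k, IsOpen (S k)) {q : M}
    {x : ℕ → M} {x₀ : M} {L : ℕ → ℝ} {L₀ : ℝ} (hx : Tendsto x atTop (𝓝 x₀))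
    (hL : Tendsto L atTop (𝓝 L₀)) (h : ∀ k, Joins (S k) q (x k) (L k)) :
    Joins (⋃ k, S k) q x₀ L₀ := by
  choose hL0 g hg h0 h1 hgS using h
  obtain ⟨U, g', hU, hUle, hg', hlim⟩ := exists_limit_curve g hg h0
  have hconst : ∀ t, Tendsto (fun k => g k t) U (𝓝 (g' t)) := fun t =>
    hlim _ t tendsto_const_nhds
  refine ⟨ge_of_tendsto' hL hL0, g', hg', ?_, ?_, fun t => ?_⟩
  · refine tendsto_nhds_unique (hconst 0) ?_
    simp_rw [h0]
    exact tendsto_const_nhds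
  · refine tendsto_nhds_unique (hlim L L₀ (hL.mono_left hUle)) ?_
    simp_rw [h1]
    exact hx.mono_left hUle
  · rw [mem_iUnion, not_exists]
    intro m
    refine (hSo m).isClosed_compl.mem_of_tendsto (hconst t) ?_
    filter_upwards [hUle (eventually_ge_atTop m)] with k hk ht
    exact hgS k t (hS hk ht)

theorem joins_of_dCompl_le {S : Set M} (hSo : IsOpen S) {x y : M} {L : ℝ} (hL : 0 ≤ L)
    (h : dCompl S x y ≤ ENNReal.ofReal L) : Joins S x y L := by
  have hk : ∀ k : ℕ, Joins S x y (L + 1 / ((k : ℝ) + 1)) := fun k => by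
    have : (0 : ℝ) < 1 / ((k : ℝ) + 1) := by positivity
    exact Joins.of_dCompl_lt (h.trans_lt ((ENNReal.ofReal_lt_ofReal_iff (by positivity)).2
      (by linarith)))
  have hlim : Tendsto (fun k : ℕ => L + 1 / ((k : ℝ) + 1)) atTop (𝓝 L) := by
    simpa using tendsto_one_div_add_atTop_nhds_zero_nat.const_add L
  have := joins_of_tendsto (S := fun _ => S) monotone_const (fun _ => hSo)
    (tendsto_const_nhds (x := y)) hlim hk
  rwa [iUnion_const] at this

theorem joins_dist (hlen : ∀ x y : M, dCompl (∅ : Set M) x y ≤ ENNReal.ofReal (dist x y))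
    (x y : M) : Joins ∅ x y (dist x y) :=
  joins_of_dCompl_le isOpen_empty dist_nonneg (hlen x y)

end Compactness

section Obstacle

variable {p q : M} {lam : ℝ}

theorem OmegaSeq_monotone (p q : M) (lam : ℝ) : Monotone (OmegaSeq p q lam) :=
  monotone_nat_of_le_succ fun _ => subset_union_left

theorem mem_Omega_iff {x : M} : x ∈ Omega p q lam ↔ ∃ m, x ∈ OmegaSeq p q lam m := by
  rw [Omega, mem_iUnion]
  exact ⟨fun ⟨m, h⟩ => ⟨m + 1, h⟩, fun ⟨m, h⟩ => ⟨m, OmegaSeq_monotone p q lam m.le_succ h⟩⟩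

theorem notMem_OmegaSeq_succ {x : M} {m : ℕ} : x ∉ OmegaSeq p q lam (m + 1) ↔
    x ∉ OmegaSeq p q lam m ∧
      dCompl (OmegaSeq p q lam m) x q ≤ ENNReal.ofReal (lam * dist x p) := by
  simp only [OmegaSeq, mem_union, mem_ofPred_eq, not_or, not_and, not_lt]
  exact ⟨fun h => ⟨h.1, h.2 h.1⟩, fun h => ⟨h.1, fun _ => h.2⟩⟩

theorem center_mem_Omega (hq : q ≠ p) : p ∈ Omega p q lam := by
  refine mem_Omega_iff.2 ⟨1, ?_⟩
  by_contra h
  have h1 := (notMem_OmegaSeq_succ.1 h).2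
  rw [dist_self, mul_zero, ENNReal.ofReal_zero] at h1
  have h2 := (ofReal_dist_le_dCompl _ _ _).trans h1
  rw [nonpos_iff_eq_zero, ENNReal.ofReal_eq_zero] at h2
  exact hq (dist_le_zero.1 h2).symm

variable [ProperSpace M]

theorem isOpen_OmegaSeq (hlam : 0 ≤ lam) (m : ℕ) : IsOpen (OmegaSeq p q lam m) := by
  induction m with
  | zero => exact isOpen_empty
  | succ m ih =>
    rw [← isClosed_compl_iff]
    refine IsSeqClosed.isClosed fun x x₀ hx hlim => ?_
    have hx' := fun k => notMem_OmegaSeq_succ.1 (hx k)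
    refine notMem_OmegaSeq_succ.2 ⟨?_, ?_⟩
    · exact ih.isClosed_compl.mem_of_tendsto hlim (Eventually.of_forall fun k => (hx' k).1)
    · have hj : ∀ k, Joins (OmegaSeq p q lam m) q (x k) (lam * dist (x k) p) := fun k =>
        (joins_of_dCompl_le ih (by positivity) (hx' k).2).symm
      have := joins_of_tendsto (S := fun _ => OmegaSeq p q lam m) monotone_const (fun _ => ih)
        hlim ((hlim.dist (tendsto_const_nhds (x := p))).const_mul lam) hj
      rw [iUnion_const] at this
      exact this.symm.dCompl_le

theorem isOpen_Omega (hlam : 0 ≤ lam) : IsOpen (Omega p q lam) :=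
  isOpen_iUnion fun m => isOpen_OmegaSeq hlam (m + 1)

theorem joins_of_notMem_Omega (hlam : 0 ≤ lam) {z : M} (hz : z ∉ Omega p q lam) :
    Joins (Omega p q lam) q z (lam * dist z p) := by
  have hz' : ∀ m, z ∉ OmegaSeq p q lam m := fun m h => hz (mem_Omega_iff.2 ⟨m, h⟩)
  have hj : ∀ m, Joins (OmegaSeq p q lam (m + 1)) q z (lam * dist z p) := fun m =>
    (joins_of_dCompl_le (isOpen_OmegaSeq hlam (m + 1)) (by positivity)
      (notMem_OmegaSeq_succ.1 (hz' (m + 2))).2).symm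
  exact joins_of_tendsto (fun a b hab => OmegaSeq_monotone p q lam (Nat.succ_le_succ hab))
    (fun m => isOpen_OmegaSeq hlam (m + 1)) tendsto_const_nhds tendsto_const_nhds hj

theorem source_notMem_closure_Omega (hlam : 1 < lam)
    (hlen : ∀ x y : M, dCompl (∅ : Set M) x y ≤ ENNReal.ofReal (dist x y)) (hq : q ≠ p) :
    q ∉ closure (Omega p q lam) := by
  have hd : 0 < dist q p := dist_pos.2 hq
  have key : ∀ m, ∀ x ∈ ball q (dist q p / 2), x ∉ OmegaSeq p q lam m := by
    intro m
    induction m with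
    | zero => exact fun _ _ => notMem_empty _
    | succ m ih =>
      intro x hx
      refine notMem_OmegaSeq_succ.2 ⟨ih x hx, ?_⟩
      rw [mem_ball] at hx
      obtain ⟨hL, g, hg, h0, h1, -⟩ := joins_dist hlen q x
      have hj : Joins (OmegaSeq p q lam m) q x (dist q x) := by
        refine Joins.of_icc hL hg.lipschitzOnWith h0 h1 fun t ht => ih _ ?_
        have hgt := hg.dist_le_mul t 0
        rw [h0, NNReal.coe_one, one_mul, Real.dist_eq, sub_zero, abs_of_nonneg ht.1] at hgt
        refine mem_ball.2 (hgt.trans_lt ?_)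
        exact ht.2.trans_lt (by rwa [dist_comm])
      refine hj.symm.dCompl_le.trans (ENNReal.ofReal_le_ofReal ?_)
      have := dist_triangle q x p
      rw [dist_comm] at hx
      nlinarith [dist_nonneg (x := x) (y := p)]
  rw [mem_closure_iff_nhds]
  push Not
  refine ⟨ball q (dist q p / 2), ball_mem_nhds _ (by positivity), ?_⟩
  rw [← disjoint_iff_inter_eq_empty, Set.disjoint_left]
  intro x hx hxΩ
  obtain ⟨m, hm⟩ := mem_Omega_iff.1 hxΩ
  exact key m x hx hm

theorem dist_le_of_mem_frontier (hlam : 0 < lam)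
    (hlen : ∀ x y : M, dCompl (∅ : Set M) x y ≤ ENNReal.ofReal (dist x y)) {z : M}
    (hz : z ∈ frontier (Omega p q lam)) {t : ℝ} (ht : Joins (Omega p q lam) q z (lam * t)) :
    dist z p ≤ t := by
  have hopen := isOpen_Omega (p := p) (q := q) hlam.le
  refine le_of_forall_pos_le_add fun ε hε => ?_
  have hε' : 0 < ε / (1 / lam + 1) := by positivity
  obtain ⟨y, hy, hzy⟩ := Metric.mem_closure_iff.1 (frontier_subset_closure hz) _ hε'
  obtain ⟨hL, g, hg, h0, h1, -⟩ := joins_dist hlen z y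
  have hex : ∃ m, ∃ τ ∈ Icc 0 (dist z y), g τ ∈ OmegaSeq p q lam m := by
    obtain ⟨m, hm⟩ := mem_Omega_iff.1 hy
    exact ⟨m, dist z y, right_mem_Icc.2 hL, by rwa [h1]⟩
  obtain ⟨τ, hτ, hτm⟩ := Nat.find_spec hex
  have hlt : ∀ m < Nat.find hex, ∀ τ ∈ Icc 0 (dist z y), g τ ∉ OmegaSeq p q lam m :=
    fun m hm τ hτ h => Nat.find_min hex hm ⟨τ, hτ, h⟩
  obtain ⟨m, hm⟩ : ∃ m, Nat.find hex = m + 1 := by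
    refine Nat.exists_eq_succ_of_ne_zero fun h => ?_
    rw [h] at hτm
    exact hτm
  rw [hm] at hτm hlt
  have hav := hlt m m.lt_succ_self
  have hj1 : Joins (OmegaSeq p q lam m) z (g τ) τ :=
    Joins.of_icc hτ.1 hg.lipschitzOnWith h0 rfl fun s hs => hav s ⟨hs.1, hs.2.trans hτ.2⟩
  have hj2 : Joins (OmegaSeq p q lam m) q (g τ) (lam * t + τ) :=
    (ht.anti fun x hx => mem_Omega_iff.2 ⟨m, hx⟩).trans hj1
  have h3 : lam * dist (g τ) p ≤ lam * t + τ := by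
    by_contra hcon
    push Not at hcon
    exact notMem_OmegaSeq_succ.2 ⟨hav τ hτ, hj2.symm.dCompl_le.trans
      (ENNReal.ofReal_le_ofReal hcon.le)⟩ hτm
  have h4 : dist z (g τ) ≤ τ := hj1.dist_le
  have h5 := dist_triangle z (g τ) p
  have h6 : dist (g τ) p ≤ t + τ / lam := by
    rw [← sub_le_iff_le_add', le_div_iff₀ hlam]
    linarith
  have h7 : τ * (1 / lam + 1) ≤ ε := by
    rw [← le_div_iff₀ (by positivity)]
    exact hτ.2.trans hzy.le
  have h8 : τ * (1 / lam + 1) = τ / lam + τ := by ring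
  linarith

end Obstacle

section Calculus

variable {a b : ℝ}

theorem exists_ae_eq_integral_add_const (hab : a < b) {v f : ℝ → ℝ} (hv : Measurable v) {C : ℝ}
    (hvC : ∀ t ∈ Ioc a b, |v t| ≤ C) (hf : Continuous f)
    (h : ∀ ψ : ℝ → ℝ, (∃ K, LipschitzWith K ψ) → (∃ B, ∀ t, |ψ t| ≤ B) → ψ a = 0 → ψ b = 0 →
      ∫ t in a..b, v t * deriv ψ t + f t * ψ t = 0) :
    ∃ k, ∀ᵐ t ∂volume.restrict (Ioc a b), v t = (∫ s in a..t, f s) + k := by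
  have hab' : b - a ≠ 0 := (sub_pos.2 hab).ne'
  set F : ℝ → ℝ := fun t => ∫ s in a..t, f s with hF
  have hFd : ∀ t, HasDerivAt F (f t) t := fun t =>
    intervalIntegral.integral_hasDerivAt_right (hf.intervalIntegrable _ _)
      hf.stronglyMeasurable.stronglyMeasurableAtFilter hf.continuousAt
  have hFc : Continuous F := continuous_iff_continuousAt.2 fun t => (hFd t).continuousAt
  set k : ℝ := (∫ t in a..b, (v t - F t)) / (b - a) with hk
  obtain ⟨CF, hCF⟩ := (isCompact_Icc (a := a) (b := b)).exists_bound_of_continuousOn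
    hFc.continuousOn
  set φ : ℝ → ℝ := (Ioc a b).indicator fun t => v t - F t - k with hφ
  have hφm : Measurable φ :=
    ((hv.sub hFc.measurable).sub_const k).indicator measurableSet_Ioc
  have hC0 : 0 ≤ C := (abs_nonneg _).trans (hvC b ⟨hab, le_rfl⟩)
  have hCF0 : 0 ≤ CF := (norm_nonneg _).trans (hCF b ⟨hab.le, le_rfl⟩)
  set B : ℝ := C + CF + |k| with hB
  have hB0 : 0 ≤ B := by positivity
  have hφB : ∀ t, |φ t| ≤ B := by
    intro t
    rw [hφ, indicator_apply]
    split_ifs with ht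
    · have h1 := hvC t ht
      have h2 := hCF t (Ioc_subset_Icc_self ht)
      rw [Real.norm_eq_abs] at h2
      calc |v t - F t - k| ≤ |v t - F t| + |k| := abs_sub _ _
        _ ≤ |v t| + |F t| + |k| := by gcongr; exact abs_sub _ _
        _ ≤ _ := by rw [hB]; gcongr
    · simpa using hB0
  have hφi : ∀ x y, IntervalIntegrable φ volume x y := fun x y =>
    intervalIntegrable_of_abs_le hφm fun t _ => hφB t
  have hφint : Integrable φ := by
    rw [hφ, integrable_indicator_iff measurableSet_Ioc]
    have := (intervalIntegrable_iff_integrableOn_Ioc_of_le hab.le).1 (hφi a b)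
    refine this.congr_fun (fun t ht => ?_) measurableSet_Ioc
    rw [hφ, indicator_of_mem ht]
  set ψ : ℝ → ℝ := fun t => ∫ s in a..t, φ s with hψ
  have hψl : LipschitzWith B.toNNReal ψ := by
    refine LipschitzWith.of_dist_le_mul fun s t => ?_
    rw [Real.coe_toNNReal _ hB0, Real.dist_eq, Real.dist_eq, hψ]
    simp only
    rw [intervalIntegral.integral_interval_sub_left (hφi _ _) (hφi _ _), ← Real.norm_eq_abs]
    exact intervalIntegral.norm_integral_le_of_norm_le_const fun x _ => hφB x
  have hψB : ∀ t, |ψ t| ≤ ∫ s, ‖φ s‖ := fun t =>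
    (intervalIntegral.norm_integral_le_integral_norm_uIoc).trans
      (setIntegral_le_integral hφint.norm (Eventually.of_forall fun _ => norm_nonneg _))
  have hψd : ∀ᵐ t, t ∈ Ioc a b → deriv ψ t = v t - F t - k := by
    filter_upwards [LocallyIntegrable.ae_hasDerivAt_integral hφint.locallyIntegrable] with t ht hts
    rw [(ht a).deriv, hφ, indicator_of_mem hts]
  have hvi : IntervalIntegrable v volume a b := by
    refine (intervalIntegrable_const (c := C)).mono_fun' hv.aestronglyMeasurable ?_
    rw [uIoc_of_le hab.le]
    exact (ae_restrict_iff' measurableSet_Ioc).2 (Eventually.of_forall hvC)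
  have hvFi : IntervalIntegrable (fun t => v t - F t) volume a b :=
    hvi.sub (hFc.intervalIntegrable _ _)
  have hψb : ψ b = 0 := by
    have h1 : ψ b = ∫ t in a..b, (v t - F t - k) := by
      refine intervalIntegral.integral_congr_ae (Eventually.of_forall fun t ht => ?_)
      rw [uIoc_of_le hab.le] at ht
      rw [hφ, indicator_of_mem ht]
    rw [h1, intervalIntegral.integral_sub hvFi intervalIntegrable_const,
      intervalIntegral.integral_const, hk, smul_eq_mul, mul_div_cancel₀ _ hab', sub_self]
  have hψa : ψ a = 0 := intervalIntegral.integral_same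
  have h0 := h ψ ⟨_, hψl⟩ ⟨_, hψB⟩ hψa hψb
  have hFac : AbsolutelyContinuousOnInterval F a b :=
    (hf.intervalIntegrable a b).absolutelyContinuousOnInterval_intervalIntegral (by simp)
  have hψac := (hψl.lipschitzOnWith (s := uIcc a b)).absolutelyContinuousOnInterval
  have h1 := hFac.integral_mul_deriv_eq_deriv_mul hψac
  rw [hψb, hψa, mul_zero, mul_zero, sub_zero, zero_sub] at h1
  simp only [fun t => (hFd t).deriv] at h1
  have hψdi : IntervalIntegrable (deriv ψ) volume a b := hψac.intervalIntegrable_deriv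
  have hψdv : IntervalIntegrable (fun t => v t * deriv ψ t) volume a b := by
    refine (hψdi.norm.const_mul C).mono_fun' (hv.mul (measurable_deriv ψ)).aestronglyMeasurable ?_
    rw [uIoc_of_le hab.le]
    refine (ae_restrict_iff' measurableSet_Ioc).2 (Eventually.of_forall fun t ht => ?_)
    simp only [norm_mul]
    gcongr
    exact hvC t ht
  rw [intervalIntegral.integral_add hψdv
    (show IntervalIntegrable (fun t => f t * ψ t) volume a b from
      (hf.mul hψl.continuous).intervalIntegrable _ _)] at h0
  have h2 : ∫ t in a..b, (v t - F t - k) * deriv ψ t = 0 := by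
    have h3 : ∫ t in a..b, deriv ψ t = 0 := by
      rw [integral_deriv_of_lipschitz hψl, hψb, hψa, sub_zero]
    have h4 : ∀ t, (v t - F t - k) * deriv ψ t =
        v t * deriv ψ t - F t * deriv ψ t - k * deriv ψ t := fun t => by ring
    have hi2 : IntervalIntegrable (fun t => F t * deriv ψ t) volume a b :=
      hψdi.continuousOn_mul hFc.continuousOn
    simp only [h4]
    rw [intervalIntegral.integral_sub (hψdv.sub hi2) (hψdi.const_mul k),
      intervalIntegral.integral_sub hψdv hi2, intervalIntegral.integral_const_mul, h3]
    linarith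
  have h5 : ∫ t in a..b, φ t ^ 2 = 0 := by
    rw [← h2]
    refine intervalIntegral.integral_congr_ae ?_
    filter_upwards [hψd] with t ht hts
    rw [uIoc_of_le hab.le] at hts
    rw [ht hts, hφ, indicator_of_mem hts, sq]
  refine ⟨k, ?_⟩
  rw [intervalIntegral.integral_eq_zero_iff_of_le_of_nonneg_ae hab.le
    (Eventually.of_forall fun t => sq_nonneg (φ t))] at h5
  · filter_upwards [h5, self_mem_ae_restrict measurableSet_Ioc] with t ht hts
    have h6 : φ t = 0 := by simpa using ht
    rw [hφ, indicator_of_mem hts] at h6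
    linarith
  · refine intervalIntegrable_of_abs_le (C := B ^ 2) (hφm.pow_const 2) fun t _ => ?_
    rw [abs_pow]
    exact pow_le_pow_left₀ (abs_nonneg _) (hφB t) 2

theorem exists_lipschitzWith_comp {ρ g g' : ℝ → ℝ} {r R : ℝ} (hρ : ∃ K, LipschitzWith K ρ)
    (hr : ∀ t, r ≤ ρ t) (hR : ∀ t, ρ t ≤ R) (hg : ∀ x ∈ Icc r R, HasDerivAt g (g' x) x)
    (hg' : ContinuousOn g' (Icc r R)) : ∃ K, LipschitzWith K fun t => g (ρ t) := by
  obtain ⟨K, hK⟩ := hρ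
  obtain ⟨C, hC⟩ := isCompact_Icc.exists_bound_of_continuousOn hg'
  have hl : LipschitzOnWith C.toNNReal g (Icc r R) :=
    (convex_Icc r R).lipschitzOnWith_of_nnnorm_hasDerivWithin_le
      (fun x hx => (hg x hx).hasDerivWithinAt) fun x hx => by
        rw [← NNReal.coe_le_coe, coe_nnnorm]
        exact (hC x hx).trans (Real.le_coe_toNNReal C)
  refine ⟨C.toNNReal * K, ?_⟩
  rw [← lipschitzOnWith_univ] at hK ⊢
  exact hl.comp hK fun t _ => ⟨hr t, hR t⟩

theorem exists_lipschitzWith_smul {E : Type*} [SeminormedAddCommGroup E] [NormedSpace ℝ E]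
    {f : ℝ → ℝ} {g : ℝ → E} {A B : ℝ} (hf : ∃ K, LipschitzWith K f) (hg : ∃ K, LipschitzWith K g)
    (hA : ∀ t, |f t| ≤ A) (hB : ∀ t, ‖g t‖ ≤ B) : ∃ K, LipschitzWith K fun t => f t • g t := by
  obtain ⟨K, hK⟩ := hf
  obtain ⟨L, hL⟩ := hg
  have hA0 : 0 ≤ A := (abs_nonneg _).trans (hA 0)
  have hB0 : 0 ≤ B := (norm_nonneg _).trans (hB 0)
  refine ⟨A.toNNReal * L + B.toNNReal * K, LipschitzWith.of_dist_le_mul fun s t => ?_⟩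
  have h1 := hK.dist_le_mul s t
  have h2 := hL.dist_le_mul s t
  rw [dist_eq_norm] at h1 h2 ⊢
  have : f s • g s - f t • g t = f s • (g s - g t) + (f s - f t) • g t := by module
  rw [this]
  push_cast
  rw [Real.coe_toNNReal _ hA0, Real.coe_toNNReal _ hB0]
  calc _ ≤ ‖f s • (g s - g t)‖ + ‖(f s - f t) • g t‖ := norm_add_le _ _
    _ = |f s| * ‖g s - g t‖ + ‖f s - f t‖ * ‖g t‖ := by
        rw [norm_smul, norm_smul, Real.norm_eq_abs (f s)]
    _ ≤ A * (L * dist s t) + (K * dist s t) * B := by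
        gcongr
        exacts [hA s, hB t]
    _ = _ := by ring

theorem nonpos_of_monotoneOn_deriv {D D' : ℝ → ℝ} (hD : ContinuousOn D (Icc a b))
    (hd : ∀ t ∈ Ioo a b, HasDerivAt D (D' t) t) (hm : MonotoneOn D' (Ioo a b))
    (ha : D a = 0) (hb : D b = 0) : ∀ t ∈ Icc a b, D t ≤ 0 := by
  have hcv : ConvexOn ℝ (Icc a b) D := by
    refine MonotoneOn.convexOn_of_deriv (convex_Icc a b) hD ?_ ?_
    · rw [interior_Icc]
      exact fun t ht => (hd t ht).differentiableAt.differentiableWithinAt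
    · rw [interior_Icc]
      exact hm.congr fun t ht => ((hd t ht).deriv).symm
  intro t ht
  have hab : a ≤ b := ht.1.trans ht.2
  have := hcv.le_max_of_mem_Icc (left_mem_Icc.2 hab) (right_mem_Icc.2 hab) ht
  rwa [ha, hb, max_self] at this

theorem nonpos_of_deriv_deriv_nonneg {D D' D'' : ℝ → ℝ} (hD : ContinuousOn D (Icc a b))
    (hd : ∀ t ∈ Ioo a b, HasDerivAt D (D' t) t) (hd' : ∀ t ∈ Ioo a b, HasDerivAt D' (D'' t) t)
    (h0 : ∀ t ∈ Ioo a b, 0 ≤ D'' t) (ha : D a = 0) (hb : D b = 0) :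
    ∀ t ∈ Icc a b, D t ≤ 0 := by
  refine nonpos_of_monotoneOn_deriv hD hd ?_ ha hb
  refine monotoneOn_of_deriv_nonneg (convex_Ioo a b)
    (fun t ht => (hd' t ht).continuousAt.continuousWithinAt) ?_ ?_
  · rw [interior_Ioo]
    exact fun t ht => (hd' t ht).differentiableAt.differentiableWithinAt
  · rw [interior_Ioo]
    exact fun t ht => by rw [(hd' t ht).deriv]; exact h0 t ht

end Calculus

section PolarCurves

variable {n : ℕ} {G : ℝ → ℝ} {ρ : ℝ → ℝ} {η : ℝ → Euc n} {a b : ℝ}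

/-- The odd extension of the warping function. -/
def oddWarp (G : ℝ → ℝ) (u : ℝ) : ℝ := if 0 < u then G u else if u < 0 then -G (-u) else 0

/-- The even primitive of the warping function. -/
def warpPrim (G : ℝ → ℝ) (u : ℝ) : ℝ := ∫ x in (0 : ℝ)..u, oddWarp G x

theorem oddWarp_neg (u : ℝ) : oddWarp G (-u) = -oddWarp G u := by
  rcases lt_trichotomy u 0 with h | rfl | h
  · simp [oddWarp, h, h.not_gt]
  · simp [oddWarp]
  · simp [oddWarp, h, h.not_gt]

theorem oddWarp_of_pos {u : ℝ} (hu : 0 < u) : oddWarp G u = G u := by simp [oddWarp, hu]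

theorem oddWarp_of_neg {u : ℝ} (hu : u < 0) : oddWarp G u = -G (-u) := by
  simp [oddWarp, hu, hu.not_gt]

theorem continuous_oddWarp (hG : IsWarping G) : Continuous (oddWarp G) := by
  have hpos : ∀ u, 0 < u → ContinuousAt (oddWarp G) u := fun u hu => by
    refine (hG.hasDerivAt hu).continuousAt.congr ?_
    filter_upwards [Ioi_mem_nhds hu] with v hv using (oddWarp_of_pos hv).symm
  have hneg : oddWarp G = fun u => -oddWarp G (-u) := by
    funext u; rw [oddWarp_neg, neg_neg]
  refine continuous_iff_continuousAt.2 fun u => ?_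
  rcases lt_trichotomy u 0 with h | rfl | h
  · rw [hneg]
    exact ((hpos (-u) (neg_pos.2 h)).comp (f := fun u => -u) continuous_neg.continuousAt).neg
  · have h0 : oddWarp G 0 = 0 := by simp [oddWarp]
    have hr : Tendsto (oddWarp G) (𝓝[>] 0) (𝓝 0) := by
      refine hG.2.2.1.congr' ?_
      filter_upwards [self_mem_nhdsWithin] with v hv using (oddWarp_of_pos hv).symm
    have hl : Tendsto (oddWarp G) (𝓝[<] 0) (𝓝 0) := by
      rw [hneg, ← neg_zero (G := ℝ)]
      refine (hr.comp ?_).neg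
      simpa using tendsto_neg_nhdsLT (a := (0 : ℝ))
    rw [continuousAt_iff_continuous_left'_right', ContinuousWithinAt, ContinuousWithinAt, h0]
    exact ⟨hl, hr⟩
  · exact hpos u h

theorem hasDerivAt_warpPrim (hG : IsWarping G) (u : ℝ) :
    HasDerivAt (warpPrim G) (oddWarp G u) u :=
  intervalIntegral.integral_hasDerivAt_right ((continuous_oddWarp hG).intervalIntegrable _ _)
    (continuous_oddWarp hG).stronglyMeasurable.stronglyMeasurableAtFilter
    (continuous_oddWarp hG).continuousAt

theorem hasDerivAt_warpPrim_of_pos (hG : IsWarping G) {u : ℝ} (hu : 0 < u) :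
    HasDerivAt (warpPrim G) (G u) u :=
  oddWarp_of_pos (G := G) hu ▸ hasDerivAt_warpPrim hG u

theorem continuous_warpPrim (hG : IsWarping G) : Continuous (warpPrim G) :=
  continuous_iff_continuousAt.2 fun u => (hasDerivAt_warpPrim hG u).continuousAt

theorem warpPrim_neg (u : ℝ) : warpPrim G (-u) = warpPrim G u := by
  have h := intervalIntegral.integral_comp_neg (f := oddWarp G) (a := 0) (b := u)
  simp only [oddWarp_neg, intervalIntegral.integral_neg, neg_zero] at h
  rw [warpPrim, warpPrim, intervalIntegral.integral_symm, ← h, neg_neg]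

theorem strictMonoOn_warpPrim (hG : IsWarping G) : StrictMonoOn (warpPrim G) (Ici 0) := by
  refine strictMonoOn_of_deriv_pos (convex_Ici 0) (continuous_warpPrim hG).continuousOn ?_
  intro u hu
  rw [interior_Ici] at hu
  rw [(hasDerivAt_warpPrim_of_pos hG hu).deriv]
  exact hG.1 u hu

/-- A Lipschitz curve in polar coordinates staying away from the pole and bounded. -/
structure PolarCurve (ρ : ℝ → ℝ) (η : ℝ → Euc n) : Prop where
  lip_rad : ∃ K, LipschitzWith K ρ
  lip_ang : ∃ K, LipschitzWith K η
  bdd : ∃ R, ∀ t, ρ t ≤ R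
  away : ∃ r > 0, ∀ t, r ≤ ρ t
  norm_ang : ∀ t, ‖η t‖ = 1

/-- The energy density of a curve in polar coordinates. -/
def polarEnergy (G : ℝ → ℝ) (ρ : ℝ → ℝ) (η : ℝ → Euc n) (t : ℝ) : ℝ :=
  deriv ρ t ^ 2 + G (ρ t) ^ 2 * ‖deriv η t‖ ^ 2

namespace PolarCurve

theorem pos (h : PolarCurve ρ η) (t : ℝ) : 0 < ρ t := by
  obtain ⟨r, hr, hρ⟩ := h.away
  exact hr.trans_le (hρ t)

theorem continuous_rad (h : PolarCurve ρ η) : Continuous ρ := by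
  obtain ⟨K, hK⟩ := h.lip_rad
  exact hK.continuous

theorem ae_differentiableAt_rad (h : PolarCurve ρ η) : ∀ᵐ t, DifferentiableAt ℝ ρ t := by
  obtain ⟨K, hK⟩ := h.lip_rad
  exact hK.ae_differentiableAt_real

theorem ae_differentiableAt_ang (h : PolarCurve ρ η) : ∀ᵐ t, DifferentiableAt ℝ η t := by
  obtain ⟨K, hK⟩ := h.lip_ang
  exact hK.ae_differentiableAt_real

theorem continuous_comp (h : PolarCurve ρ η) {g : ℝ → ℝ} (hg : ContinuousOn g (Ioi 0)) :
    Continuous fun t => g (ρ t) :=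
  continuous_iff_continuousAt.2 fun t =>
    (hg.continuousAt (Ioi_mem_nhds (h.pos t))).comp (f := ρ) h.continuous_rad.continuousAt

theorem exists_abs_comp_le (h : PolarCurve ρ η) {g : ℝ → ℝ} (hg : ContinuousOn g (Ioi 0)) :
    ∃ C, ∀ t, |g (ρ t)| ≤ C := by
  obtain ⟨r, hr, hrρ⟩ := h.away
  obtain ⟨R, hR⟩ := h.bdd
  obtain ⟨C, hC⟩ := (isCompact_Icc (a := r) (b := R)).exists_bound_of_continuousOn
    (hg.mono fun x hx => hr.trans_le hx.1)
  exact ⟨C, fun t => hC _ ⟨hrρ t, hR t⟩⟩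

theorem exists_lipschitzWith_comp (h : PolarCurve ρ η) {g g' : ℝ → ℝ}
    (hg : ∀ x, 0 < x → HasDerivAt g (g' x) x) (hg' : ContinuousOn g' (Ioi 0)) :
    ∃ K, LipschitzWith K fun t => g (ρ t) := by
  obtain ⟨r, hr, hrρ⟩ := h.away
  obtain ⟨R, hR⟩ := h.bdd
  exact GrowthComp.exists_lipschitzWith_comp h.lip_rad hrρ hR
    (fun x hx => hg x (hr.trans_le hx.1)) (hg'.mono fun x hx => hr.trans_le hx.1)

theorem exists_abs_deriv_rad_le (h : PolarCurve ρ η) : ∃ C, ∀ t, |deriv ρ t| ≤ C := by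
  obtain ⟨K, hK⟩ := h.lip_rad
  exact ⟨K, fun t => norm_deriv_le_of_lipschitz hK⟩

theorem exists_norm_deriv_ang_le (h : PolarCurve ρ η) : ∃ C, ∀ t, ‖deriv η t‖ ≤ C := by
  obtain ⟨K, hK⟩ := h.lip_ang
  exact ⟨K, fun t => norm_deriv_le_of_lipschitz hK⟩

theorem exists_lipschitzWith_smul (h : PolarCurve ρ η) :
    ∃ K, LipschitzWith K fun t => ρ t • η t := by
  obtain ⟨C, hC⟩ := h.exists_abs_comp_le continuousOn_id
  exact GrowthComp.exists_lipschitzWith_smul h.lip_rad h.lip_ang hC fun t => (h.norm_ang t).le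

theorem inner_deriv_ang (h : PolarCurve ρ η) {t : ℝ} (ht : DifferentiableAt ℝ η t) :
    ⟪η t, deriv η t⟫ = 0 := by
  have h1 := ht.hasDerivAt.inner ℝ ht.hasDerivAt
  have h2 : (fun t => ⟪η t, η t⟫) = fun _ => (1 : ℝ) := by
    funext s; rw [real_inner_self_eq_norm_sq, h.norm_ang]; norm_num
  rw [h2] at h1
  have h3 := h1.unique (hasDerivAt_const t (1 : ℝ))
  rw [real_inner_comm (η t) (deriv η t)] at h3
  linarith

theorem ae_warpSpeed_sq (h : PolarCurve ρ η) :
    ∀ᵐ t, warpSpeed G (fun t => ρ t • η t) t ^ 2 = polarEnergy G ρ η t := by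
  filter_upwards [h.ae_differentiableAt_rad, h.ae_differentiableAt_ang] with t h1 h2
  have h3 : deriv (fun t => ρ t • η t) t = deriv ρ t • η t + ρ t • deriv η t := by
    rw [add_comm]; exact (h1.hasDerivAt.smul h2.hasDerivAt).deriv
  rw [warpSpeed, h3, warpNorm_polar_sq (h.pos t) (h.norm_ang t) (h.inner_deriv_ang h2), polarEnergy]

theorem measurable_comp (h : PolarCurve ρ η) (hG : IsWarping G) :
    Measurable fun t => G (ρ t) := (h.continuous_comp hG.continuousOn).measurable

theorem intervalIntegrable_energy_terms (h : PolarCurve ρ η) (hG : IsWarping G) (a b : ℝ) :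
    IntervalIntegrable (fun t => deriv ρ t ^ 2) volume a b ∧
    IntervalIntegrable (fun t => ‖deriv η t‖ ^ 2) volume a b ∧
    IntervalIntegrable (fun t => G (ρ t) ^ 2 * ‖deriv η t‖ ^ 2) volume a b := by
  obtain ⟨C1, h1⟩ := h.exists_abs_deriv_rad_le
  obtain ⟨C2, h2⟩ := h.exists_norm_deriv_ang_le
  have h3 : IntervalIntegrable (fun t => ‖deriv η t‖ ^ 2) volume a b :=
    intervalIntegrable_of_abs_le (C := C2 ^ 2) ((measurable_deriv η).norm.pow_const 2)
      fun t _ => by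
        rw [abs_pow, abs_norm]; exact pow_le_pow_left₀ (norm_nonneg _) (h2 t) 2
  refine ⟨intervalIntegrable_of_abs_le (C := C1 ^ 2) ((measurable_deriv ρ).pow_const 2)
      fun t _ => ?_, h3,
    h3.continuousOn_mul ((h.continuous_comp hG.continuousOn).pow 2).continuousOn⟩
  rw [abs_pow]; exact pow_le_pow_left₀ (abs_nonneg _) (h1 t) 2

theorem intervalIntegrable_energy (h : PolarCurve ρ η) (hG : IsWarping G) (a b : ℝ) :
    IntervalIntegrable (polarEnergy G ρ η) volume a b :=
  (h.intervalIntegrable_energy_terms hG a b).1.add (h.intervalIntegrable_energy_terms hG a b).2.2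

theorem mul_le_integral_energy {M : Type*} [MetricSpace M] {p : M} {Φ : Euc n ≃ M}
    (h : PolarCurve ρ η) (hsym : IsSphericallySymmetric p G Φ) (hc : NonposCurvWarping G)
    {K : ℝ} (hK : 0 ≤ K) (hab : a ≤ b)
    (hd : K * (b - a) ≤ dist (Φ (ρ a • η a)) (Φ (ρ b • η b))) :
    K ^ 2 * (b - a) ≤ ∫ t in a..b, polarEnergy G ρ η t := by
  obtain ⟨L, hL⟩ := h.exists_lipschitzWith_smul
  have h1 := hd.trans (dist_le_integral_warpSpeed hsym hc hL hab)
  have hi := intervalIntegrable_warpSpeed hsym.1 hc hL a b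
  have hi2 := intervalIntegrable_warpSpeed_sq hsym.1 hc hL a b
  have h2 : ∫ t in a..b, polarEnergy G ρ η t =
      ∫ t in a..b, warpSpeed G (fun t => ρ t • η t) t ^ 2 := by
    refine intervalIntegral.integral_congr_ae ?_
    filter_upwards [h.ae_warpSpeed_sq (G := G)] with t ht _ using ht.symm
  have h3 : ∫ t in a..b, (2 * K * warpSpeed G (fun t => ρ t • η t) t - K ^ 2) ≤
      ∫ t in a..b, warpSpeed G (fun t => ρ t • η t) t ^ 2 := by
    refine intervalIntegral.integral_mono_on hab ((hi.const_mul _).sub intervalIntegrable_const)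
      hi2 fun t _ => ?_
    nlinarith [sq_nonneg (warpSpeed G (fun t => ρ t • η t) t - K)]
  rw [intervalIntegral.integral_sub (hi.const_mul _) intervalIntegrable_const,
    intervalIntegral.integral_const_mul, intervalIntegral.integral_const, smul_eq_mul] at h3
  rw [h2]
  have h4 := mul_le_mul_of_nonneg_left h1 hK
  linarith

end PolarCurve

theorem PolarCurve.ae_energy_eq {M : Type*} [MetricSpace M] {p : M} {Φ : Euc n ≃ M}
    (h : PolarCurve ρ η) (hsym : IsSphericallySymmetric p G Φ) (hc : NonposCurvWarping G)
    {K : ℝ≥0} (hL : LipschitzWith K fun t => Φ (ρ t • η t)) (hab : a ≤ b)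
    (hlen : ENNReal.ofReal (K * (b - a)) ≤ eVariationOn (fun t => Φ (ρ t • η t)) (Icc a b)) :
    ∀ᵐ t ∂volume.restrict (Ioc a b), polarEnergy G ρ η t = K ^ 2 := by
  obtain ⟨L, hcl⟩ := h.exists_lipschitzWith_smul
  have h0 : 0 ≤ ∫ t in a..b, warpSpeed G (fun t => ρ t • η t) t :=
    dist_nonneg.trans (dist_le_integral_warpSpeed hsym hc hcl hab)
  have h1 := (ENNReal.ofReal_le_ofReal_iff h0).1
    (hlen.trans (eVariationOn_le_integral_warpSpeed hsym hc hcl hab))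
  have h2 := ae_warpSpeed_eq hsym hc hL hab (by simpa only [Equiv.symm_apply_apply] using h1)
  simp only [Equiv.symm_apply_apply] at h2
  filter_upwards [h2, ae_restrict_of_ae (h.ae_warpSpeed_sq (G := G))] with t ht1 ht2
  rw [← ht2, ht1]

theorem exists_polarCurve {M : Type*} [MetricSpace M] {p : M} {Φ : Euc n ≃ M}
    (hsym : IsSphericallySymmetric p G Φ) (hc : NonposCurvWarping G) {K : ℝ≥0} {γ : ℝ → M}
    (hab : a ≤ b) (hγ : LipschitzOnWith K γ (Icc a b)) (hp : ∀ t ∈ Icc a b, γ t ≠ p) :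
    ∃ (ρ : ℝ → ℝ) (η : ℝ → Euc n), PolarCurve ρ η ∧
      (LipschitzWith K fun t => Φ (ρ t • η t)) ∧ EqOn (fun t => Φ (ρ t • η t)) γ (Icc a b) ∧
      (∀ t ∈ Icc a b, ρ t = ‖Φ.symm (γ t)‖ ∧ η t = polarTheta Φ (γ t)) := by
  obtain ⟨g, hg, hge, hgr⟩ := exists_lipschitzWith_eqOn_Icc hab hγ
  have hcl := lipschitzWith_symm_comp hsym hc hg
  set c := fun t => Φ.symm (g t) with hcdef
  have hcont := hcl.continuous
  have hc0 : ∀ t, c t ≠ 0 := by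
    intro t h0
    obtain ⟨s, hs, hts⟩ := hgr t
    refine hp s hs ?_
    rw [← hts, ← hsym.2.1, ← h0, hcdef]
    simp
  have hrange : ∀ t, ∃ s ∈ Icc a b, c t = c s := by
    intro t
    obtain ⟨s, hs, hts⟩ := hgr t
    exact ⟨s, hs, by simp only [hcdef]; rw [hts, hge hs]⟩
  obtain ⟨s0, hs0, hmin⟩ := isCompact_Icc.exists_isMinOn (nonempty_Icc.2 hab)
    hcont.norm.continuousOn
  obtain ⟨R, hR⟩ := (isCompact_Icc (a := a) (b := b)).exists_bound_of_continuousOn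
    hcont.continuousOn
  have hrpos : 0 < ‖c s0‖ := norm_pos_iff.2 (hc0 s0)
  have hlow : ∀ t, ‖c s0‖ ≤ ‖c t‖ := fun t => by
    obtain ⟨s, hs, hts⟩ := hrange t
    rw [hts]; exact hmin hs
  have hup : ∀ t, ‖c t‖ ≤ R := fun t => by
    obtain ⟨s, hs, hts⟩ := hrange t
    rw [hts]; exact hR s hs
  have hρl : LipschitzWith K fun t => ‖c t‖ := by
    have := lipschitzWith_one_norm.comp hcl
    rwa [one_mul] at this
  have hinv : ∃ L, LipschitzWith L fun t => ‖c t‖⁻¹ :=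
    exists_lipschitzWith_comp ⟨K, hρl⟩ hlow hup
      (fun x hx => hasDerivAt_inv (hrpos.trans_le hx.1).ne')
      ((continuousOn_id.pow 2).inv₀ fun x hx => (pow_pos (hrpos.trans_le hx.1) 2).ne').neg
  have hang : ∃ L, LipschitzWith L fun t => ‖c t‖⁻¹ • c t :=
    exists_lipschitzWith_smul hinv ⟨K, hcl⟩ (A := ‖c s0‖⁻¹)
      (fun t => by rw [abs_inv, abs_norm]; exact inv_anti₀ hrpos (hlow t)) hup
  have hunit : ∀ t, ‖‖c t‖⁻¹ • c t‖ = 1 := fun t => by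
    rw [norm_smul, norm_inv, norm_norm, inv_mul_cancel₀ (norm_ne_zero_iff.2 (hc0 t))]
  have hpc : PolarCurve (fun t => ‖c t‖) (fun t => ‖c t‖⁻¹ • c t) :=
    ⟨⟨K, hρl⟩, hang, ⟨R, hup⟩, ⟨_, hrpos, hlow⟩, hunit⟩
  have hrec : ∀ t, ‖c t‖ • ‖c t‖⁻¹ • c t = c t := fun t => by
    rw [smul_smul, mul_inv_cancel₀ (norm_ne_zero_iff.2 (hc0 t)), one_smul]
  have hΦ : ∀ t ∈ Icc a b, Φ (c t) = γ t := fun t ht => by simp [hcdef, hge ht]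
  refine ⟨_, _, hpc, ?_, fun t ht => ?_, fun t ht => ?_⟩
  · have hΦg : (fun t => Φ (‖c t‖ • ‖c t‖⁻¹ • c t)) = g :=
      funext fun t => by rw [hrec]; exact Φ.apply_symm_apply _
    rw [hΦg]; exact hg
  · simp only [hrec, hΦ t ht]
  · simp [hcdef, polarTheta, hge ht]

/-- An energy minimizer of constant speed `K` in polar coordinates over `[a, b]`. -/
structure MinPolar (G : ℝ → ℝ) (K a b : ℝ) (ρ : ℝ → ℝ) (η : ℝ → Euc n) : Prop
    extends PolarCurve ρ η where
  energy : ∀ᵐ t ∂volume.restrict (Ioc a b), polarEnergy G ρ η t = K ^ 2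
  min : ∀ (ρ' : ℝ → ℝ) (ζ : ℝ → Euc n), PolarCurve ρ' ζ → ρ' a = ρ a → ρ' b = ρ b →
    ζ a = η a → ζ b = η b → K ^ 2 * (b - a) ≤ ∫ t in a..b, polarEnergy G ρ' ζ t

theorem exists_minPolar {M : Type*} [MetricSpace M] {p : M} {Φ : Euc n ≃ M}
    (hsym : IsSphericallySymmetric p G Φ) (hc : NonposCurvWarping G) {K : ℝ≥0} {γ : ℝ → M}
    (hab : a ≤ b) (hγ : LipschitzOnWith K γ (Icc a b)) (hp : ∀ t ∈ Icc a b, γ t ≠ p)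
    (hd : K * (b - a) ≤ dist (γ a) (γ b)) :
    ∃ (ρ : ℝ → ℝ) (η : ℝ → Euc n), MinPolar G K a b ρ η ∧
      (∀ t ∈ Icc a b, ρ t = ‖Φ.symm (γ t)‖ ∧ η t = polarTheta Φ (γ t)) := by
  obtain ⟨ρ, η, hpc, hL, hE, hval⟩ := exists_polarCurve hsym hc hab hγ hp
  have ha := left_mem_Icc.2 hab
  have hb := right_mem_Icc.2 hab
  have hd' : K * (b - a) ≤ dist (Φ (ρ a • η a)) (Φ (ρ b • η b)) := by
    rw [show Φ (ρ a • η a) = γ a from hE ha, show Φ (ρ b • η b) = γ b from hE hb]; exact hd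
  refine ⟨ρ, η, ⟨hpc, hpc.ae_energy_eq hsym hc hL hab ?_, fun ρ' ζ h' h1 h2 h3 h4 => ?_⟩, hval⟩
  · refine (ENNReal.ofReal_le_ofReal hd').trans ?_
    rw [← edist_dist]
    exact eVariationOn.edist_le (fun t => Φ (ρ t • η t)) ha hb
  · refine h'.mul_le_integral_energy hsym hc K.coe_nonneg hab ?_
    rw [h1, h2, h3, h4]
    exact hd'

end PolarCurves

section EulerLagrange

variable {n : ℕ} {G : ℝ → ℝ} {ρ : ℝ → ℝ} {η : ℝ → Euc n} {K a b : ℝ}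

theorem eq_zero_of_forall_nonneg {A B s₀ : ℝ} (hs₀ : 0 < s₀)
    (h : ∀ s, |s| ≤ s₀ → 0 ≤ 2 * s * A + s ^ 2 * B) : A = 0 := by
  set τ := min (s₀ / (|A| + 1)) (1 / (|B| + 1)) with hτ
  have hτ0 : 0 < τ := lt_min (by positivity) (by positivity)
  have h1 : |-A * τ| ≤ s₀ := by
    rw [abs_mul, abs_neg, abs_of_pos hτ0]
    calc |A| * τ ≤ (|A| + 1) * (s₀ / (|A| + 1)) := by
          gcongr
          · linarith
          · exact min_le_left _ _
      _ = s₀ := by field_simp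
  have h2 : τ * B ≤ 1 := by
    calc τ * B ≤ τ * (|B| + 1) :=
          mul_le_mul_of_nonneg_left (by linarith [le_abs_self B]) hτ0.le
      _ ≤ 1 / (|B| + 1) * (|B| + 1) :=
          mul_le_mul_of_nonneg_right (min_le_right _ _) (by positivity)
      _ = 1 := by field_simp
  have h3 := h _ h1
  have h4 : A ^ 2 * τ * (τ * B) ≤ A ^ 2 * τ * 1 := by gcongr
  have h5 : 0 ≤ -(A ^ 2 * τ) := by nlinarith
  have h6 : A ^ 2 * τ = 0 := le_antisymm (by linarith) (by positivity)
  rcases mul_eq_zero.1 h6 with h | h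
  · exact pow_eq_zero_iff (two_ne_zero) |>.1 h
  · exact absurd h hτ0.ne'

theorem exists_taylor_sq (hG : IsWarping G) {r R : ℝ} (hr : 0 < r) :
    ∃ C, ∀ x ∈ Icc r R, ∀ h, |h| ≤ r / 2 →
      G (x + h) ^ 2 ≤ G x ^ 2 + 2 * (G x * deriv G x) * h + C * h ^ 2 := by
  have hd2 : ∀ x, 0 < x → HasDerivAt (deriv G) (deriv (deriv G) x) x := fun x hx =>
    ((hG.contDiffOn_deriv.differentiableOn (by simp)).differentiableAt
      (Ioi_mem_nhds hx)).hasDerivAt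
  have hc2 : ContinuousOn (deriv (deriv G)) (Ioi 0) :=
    (hG.contDiffOn_deriv.deriv_of_isOpen (m := (⊤ : ℕ∞)) isOpen_Ioi (by simp)).continuousOn
  set H' : ℝ → ℝ := fun x => 2 * (G x * deriv G x) with hH'
  have hH : ∀ x, 0 < x → HasDerivAt (fun x => G x ^ 2) (H' x) x := fun x hx => by
    refine ((hG.hasDerivAt hx).fun_pow 2).congr_deriv ?_
    rw [hH']; push_cast; ring
  have hH2 : ∀ x, 0 < x → HasDerivAt H'
      (2 * (deriv G x * deriv G x + G x * deriv (deriv G) x)) x := fun x hx =>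
    ((hG.hasDerivAt hx).mul (hd2 x hx)).const_mul 2
  have hcont : ContinuousOn
      (fun x => 2 * (deriv G x * deriv G x + G x * deriv (deriv G) x)) (Icc (r / 2) (R + r / 2)) :=
    (continuousOn_const.mul
      ((hG.contDiffOn_deriv.continuousOn.mul hG.contDiffOn_deriv.continuousOn).add
        (hG.continuousOn.mul hc2))).mono fun x hx => (half_pos hr).trans_le hx.1
  obtain ⟨C, hC⟩ := isCompact_Icc.exists_bound_of_continuousOn hcont
  refine ⟨C, fun x hx h hh => ?_⟩
  have hseg : ∀ y ∈ uIcc x (x + h), y ∈ Icc (r / 2) (R + r / 2) ∧ |y - x| ≤ |h| := by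
    intro y hy
    have h1 : |y - x| ≤ |h| := by
      have := abs_sub_left_of_mem_uIcc hy
      simpa using this
    have h2 := abs_le.1 (h1.trans hh)
    exact ⟨⟨by linarith [hx.1], by linarith [hx.2]⟩, h1⟩
  have hC0 : 0 ≤ C := (norm_nonneg _).trans (hC x (hseg x left_mem_uIcc).1)
  have hlip : ∀ y ∈ uIcc x (x + h), ‖H' y - H' x‖ ≤ C * |h| := by
    intro y hy
    have := (convex_Icc (r / 2) (R + r / 2)).norm_image_sub_le_of_norm_hasDerivWithin_le
      (fun z hz => (hH2 z ((half_pos hr).trans_le hz.1)).hasDerivWithinAt) hC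
      (hseg x left_mem_uIcc).1 (hseg y hy).1
    refine this.trans ?_
    rw [Real.norm_eq_abs]
    exact mul_le_mul_of_nonneg_left (hseg y hy).2 hC0
  have hfin := (convex_uIcc x (x + h)).norm_image_sub_le_of_norm_hasDerivWithin_le
    (f := fun y => G y ^ 2 - H' x * y) (f' := fun y => H' y - H' x)
    (fun y hy => by
      have h1 := (hH y ((half_pos hr).trans_le (hseg y hy).1.1)).sub
        ((hasDerivAt_id y).const_mul (H' x))
      rw [mul_one] at h1
      exact h1.hasDerivWithinAt) hlip left_mem_uIcc right_mem_uIcc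
  rw [add_sub_cancel_left, Real.norm_eq_abs, Real.norm_eq_abs] at hfin
  have h3 := (abs_le.1 hfin).2
  have h4 : C * |h| * |h| = C * h ^ 2 := by rw [mul_assoc, abs_mul_abs_self, sq]
  rw [h4] at h3
  simp only [hH'] at h3
  linarith

theorem MinPolar.first_variation (h : MinPolar G K a b ρ η) (hG : IsWarping G) (hab : a < b)
    {ψ : ℝ → ℝ} (hψ : ∃ L, LipschitzWith L ψ) (hψB : ∃ B, ∀ t, |ψ t| ≤ B) (hψa : ψ a = 0)
    (hψb : ψ b = 0) :
    ∫ t in a..b, G (ρ t) * deriv ρ t * deriv ψ t + K ^ 2 * deriv G (ρ t) * ψ t = 0 := by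
  have hpc := h.toPolarCurve
  obtain ⟨r, hr, hrρ⟩ := hpc.away
  obtain ⟨R, hR⟩ := hpc.bdd
  obtain ⟨C, hC⟩ := exists_taylor_sq (R := R) hG hr
  obtain ⟨B, hB⟩ := hψB
  obtain ⟨CG, hCG⟩ := hpc.exists_abs_comp_le hG.continuousOn
  have hGl := hpc.exists_lipschitzWith_comp (fun x hx => hG.hasDerivAt hx)
    hG.contDiffOn_deriv.continuousOn
  have hG'c : Continuous fun t => deriv G (ρ t) :=
    hpc.continuous_comp hG.contDiffOn_deriv.continuousOn
  set w : ℝ → ℝ := fun t => G (ρ t) * ψ t with hw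
  obtain ⟨L, hwl⟩ : ∃ L, LipschitzWith L w := exists_lipschitzWith_smul hGl hψ hCG hB
  have hwc := hwl.continuous
  have hwB : ∀ t, |w t| ≤ CG * B := fun t => by
    rw [hw, abs_mul]
    exact mul_le_mul (hCG t) (hB t) (abs_nonneg _) ((abs_nonneg _).trans (hCG t))
  have hD0 : 0 ≤ CG * B := (abs_nonneg _).trans (hwB 0)
  obtain ⟨Lψ, hψl⟩ := hψ
  have hwd : ∀ᵐ t, DifferentiableAt ℝ w t := hwl.ae_differentiableAt_real
  have hψd : ∀ᵐ t, DifferentiableAt ℝ ψ t := hψl.ae_differentiableAt_real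
  have hterm := hpc.intervalIntegrable_energy_terms hG a b
  have hA1 : IntervalIntegrable (fun t => G (ρ t) * deriv ρ t * deriv ψ t) volume a b := by
    obtain ⟨C1, h1⟩ := hpc.exists_abs_deriv_rad_le
    refine intervalIntegrable_of_abs_le (C := CG * C1 * Lψ)
      (((hpc.measurable_comp hG).mul (measurable_deriv ρ)).mul (measurable_deriv ψ)) fun t _ => ?_
    change |G (ρ t) * deriv ρ t * deriv ψ t| ≤ _
    rw [abs_mul, abs_mul]
    have h3 : |deriv ψ t| ≤ Lψ := norm_deriv_le_of_lipschitz hψl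
    have h2 := h1 t
    have h4 := hCG t
    have h5 := (abs_nonneg _).trans h4
    have h6 := (abs_nonneg _).trans h2
    gcongr
  have hA2 : IntervalIntegrable (fun t => K ^ 2 * deriv G (ρ t) * ψ t) volume a b :=
    ((continuous_const.mul hG'c).mul hψl.continuous).intervalIntegrable _ _
  have hB1 : IntervalIntegrable (fun t => deriv w t ^ 2) volume a b := by
    refine intervalIntegrable_of_abs_le (C := (L : ℝ) ^ 2) ((measurable_deriv w).pow_const 2)
      fun t _ => ?_
    rw [abs_pow]
    exact pow_le_pow_left₀ (abs_nonneg _) (norm_deriv_le_of_lipschitz hwl) 2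
  have hB2 : IntervalIntegrable (fun t => C * w t ^ 2 * ‖deriv η t‖ ^ 2) volume a b :=
    hterm.2.1.continuousOn_mul (continuous_const.mul (hwc.pow 2)).continuousOn
  refine eq_zero_of_forall_nonneg (s₀ := r / 2 / (CG * B + 1))
    (B := ∫ t in a..b, (deriv w t ^ 2 + C * w t ^ 2 * ‖deriv η t‖ ^ 2)) (by positivity) ?_
  intro s hs
  have hsw : ∀ t, |s * w t| ≤ r / 2 := fun t => by
    rw [abs_mul]
    calc |s| * |w t| ≤ r / 2 / (CG * B + 1) * (CG * B + 1) := by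
          gcongr
          linarith [hwB t]
      _ = r / 2 := by field_simp
  have hpc' : PolarCurve (fun t => ρ t + s * w t) η := by
    obtain ⟨Lρ, hρl⟩ := hpc.lip_rad
    refine ⟨⟨Lρ + ‖s‖₊ * L, hρl.add ?_⟩, hpc.lip_ang, ⟨R + r / 2, fun t => ?_⟩,
      ⟨r / 2, half_pos hr, fun t => ?_⟩, hpc.norm_ang⟩
    · exact (lipschitzWith_smul s).comp hwl
    · linarith [hR t, (abs_le.1 (hsw t)).2]
    · linarith [hrρ t, (abs_le.1 (hsw t)).1]
  have hmin := h.min _ _ hpc' (by simp [hw, hψa]) (by simp [hw, hψb]) rfl rfl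
  have hle : ∫ t in a..b, polarEnergy G (fun t => ρ t + s * w t) η t ≤
      ∫ t in a..b, (K ^ 2 + 2 * s * (G (ρ t) * deriv ρ t * deriv ψ t +
        K ^ 2 * deriv G (ρ t) * ψ t) +
        s ^ 2 * (deriv w t ^ 2 + C * w t ^ 2 * ‖deriv η t‖ ^ 2)) := by
    refine intervalIntegral.integral_mono_ae_restrict hab.le
      (hpc'.intervalIntegrable_energy hG a b)
      ((intervalIntegrable_const.add ((hA1.add hA2).const_mul _)).add
        ((hB1.add hB2).const_mul _)) ?_
    rw [← Measure.restrict_congr_set Ioc_ae_eq_Icc]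
    filter_upwards [ae_restrict_of_ae hwd, ae_restrict_of_ae hψd,
      ae_restrict_of_ae hpc.ae_differentiableAt_rad, h.energy] with t h1 h2 h3 h4
    have h5 : deriv (fun t => ρ t + s * w t) t = deriv ρ t + s * deriv w t :=
      (h3.hasDerivAt.add (h1.hasDerivAt.const_mul s)).deriv
    have h6 : deriv w t = deriv G (ρ t) * deriv ρ t * ψ t + G (ρ t) * deriv ψ t :=
      ((HasDerivAt.comp t (hG.hasDerivAt (hpc.pos t)) h3.hasDerivAt).mul h2.hasDerivAt).deriv
    have h7 := hC (ρ t) ⟨hrρ t, hR t⟩ (s * w t) (hsw t)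
    have h8 := mul_le_mul_of_nonneg_right h7 (sq_nonneg ‖deriv η t‖)
    rw [polarEnergy] at h4 ⊢
    rw [h5]
    refine (add_le_add_right h8 _).trans (le_of_eq ?_)
    rw [← h4]
    have h9 : w t = G (ρ t) * ψ t := rfl
    rw [h9, h6]
    ring
  rw [intervalIntegral.integral_add (intervalIntegrable_const.add ((hA1.add hA2).const_mul _))
    ((hB1.add hB2).const_mul _), intervalIntegral.integral_add intervalIntegrable_const
    ((hA1.add hA2).const_mul _), intervalIntegral.integral_const_mul,
    intervalIntegral.integral_const_mul, intervalIntegral.integral_const, smul_eq_mul] at hle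
  linarith

theorem MinPolar.euler_lagrange (h : MinPolar G K a b ρ η) (hG : IsWarping G) (hab : a < b) :
    ∃ V : ℝ → ℝ, (∀ t, HasDerivAt V (K ^ 2 * deriv G (ρ t)) t) ∧
      ∀ t ∈ Ioo a b, HasDerivAt (fun t => warpPrim G (ρ t)) (V t) t := by
  have hpc := h.toPolarCurve
  have hfc : Continuous fun t => K ^ 2 * deriv G (ρ t) :=
    continuous_const.mul (hpc.continuous_comp hG.contDiffOn_deriv.continuousOn)
  obtain ⟨CG, hCG⟩ := hpc.exists_abs_comp_le hG.continuousOn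
  obtain ⟨C1, hC1⟩ := hpc.exists_abs_deriv_rad_le
  obtain ⟨k, hk⟩ := exists_ae_eq_integral_add_const hab
    (v := fun t => G (ρ t) * deriv ρ t) (C := CG * C1)
    ((hpc.measurable_comp hG).mul (measurable_deriv ρ))
    (fun t _ => by
      rw [abs_mul]
      exact mul_le_mul (hCG t) (hC1 t) (abs_nonneg _) ((abs_nonneg _).trans (hCG t)))
    hfc fun ψ h1 h2 h3 h4 => h.first_variation hG hab h1 h2 h3 h4
  set V : ℝ → ℝ := fun t => (∫ s in a..t, K ^ 2 * deriv G (ρ s)) + k with hV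
  have hVd : ∀ t, HasDerivAt V (K ^ 2 * deriv G (ρ t)) t := fun t =>
    (intervalIntegral.integral_hasDerivAt_right (hfc.intervalIntegrable _ _)
      hfc.stronglyMeasurable.stronglyMeasurableAtFilter hfc.continuousAt).add_const k
  have hVc : Continuous V := continuous_iff_continuousAt.2 fun t => (hVd t).continuousAt
  refine ⟨V, hVd, fun t ht => ?_⟩
  obtain ⟨L, hL⟩ := hpc.exists_lipschitzWith_comp
    (fun x hx => hasDerivAt_warpPrim_of_pos hG hx) hG.continuousOn
  have hprim : ∀ s ∈ Icc a b, warpPrim G (ρ s) = warpPrim G (ρ a) + ∫ u in a..s, V u := by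
    intro s hs
    have h1 := integral_deriv_of_lipschitz hL a s
    have h2 : ∫ u in a..s, deriv (fun t => warpPrim G (ρ t)) u = ∫ u in a..s, V u := by
      refine intervalIntegral.integral_congr_ae ?_
      rw [ae_restrict_iff' measurableSet_Ioc] at hk
      filter_upwards [hk, hpc.ae_differentiableAt_rad] with u h3 h4 h5
      rw [uIoc_of_le hs.1] at h5
      refine Eq.trans ?_ (h3 ⟨h5.1, h5.2.trans hs.2⟩)
      exact (HasDerivAt.comp u (hasDerivAt_warpPrim_of_pos hG (hpc.pos u)) h4.hasDerivAt).deriv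
    rw [← h2, h1]; ring
  refine HasDerivAt.congr_of_eventuallyEq
    (f := fun s => warpPrim G (ρ a) + ∫ u in a..s, V u) ?_ ?_
  · exact (intervalIntegral.integral_hasDerivAt_right (hVc.intervalIntegrable _ _)
      hVc.stronglyMeasurable.stronglyMeasurableAtFilter hVc.continuousAt).const_add _
  · filter_upwards [Ioo_mem_nhds ht.1 ht.2] with s hs using hprim s (Ioo_subset_Icc_self hs)

end EulerLagrange

section RadialUniqueness

variable {n : ℕ} {G : ℝ → ℝ} {ρ ρ' : ℝ → ℝ} {η η' : ℝ → Euc n} {K a b : ℝ}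

theorem MinPolar.rad_eq (h : MinPolar G K a b ρ η) (h' : MinPolar G K a b ρ' η')
    (hG : IsWarping G) (hc : NonposCurvWarping G) (hab : a < b)
    (ha : ρ a = ρ' a) (hb : ρ b = ρ' b) : ∀ t ∈ Icc a b, ρ t = ρ' t := by
  obtain ⟨V, hV, hW⟩ := h.euler_lagrange hG hab
  obtain ⟨V', hV', hW'⟩ := h'.euler_lagrange hG hab
  set D : ℝ → ℝ := fun t => warpPrim G (ρ t) - warpPrim G (ρ' t) with hD
  have hDc : Continuous D :=
    ((continuous_warpPrim hG).comp h.continuous_rad).sub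
      ((continuous_warpPrim hG).comp h'.continuous_rad)
  have hDd : ∀ t ∈ Ioo a b, HasDerivAt D (V t - V' t) t := fun t ht => (hW t ht).sub (hW' t ht)
  have key := nonpos_of_deriv_deriv_nonneg (a := a) (b := b) (D := fun t => D t * D t)
    (D' := fun t => (V t - V' t) * D t + D t * (V t - V' t))
    (D'' := fun t => ((K ^ 2 * deriv G (ρ t) - K ^ 2 * deriv G (ρ' t)) * D t +
      (V t - V' t) * (V t - V' t)) + ((V t - V' t) * (V t - V' t) +
      D t * (K ^ 2 * deriv G (ρ t) - K ^ 2 * deriv G (ρ' t))))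
    (hDc.mul hDc).continuousOn (fun t ht => (hDd t ht).mul (hDd t ht))
    (fun t ht => (((hV t).sub (hV' t)).mul (hDd t ht)).add
      ((hDd t ht).mul ((hV t).sub (hV' t)))) ?_ (by simp [hD, ha]) (by simp [hD, hb])
  · intro t ht
    have h0 : D t = 0 := by nlinarith [key t ht, sq_nonneg (D t)]
    exact (strictMonoOn_warpPrim hG).injOn (h.pos t).le (h'.pos t).le (sub_eq_zero.1 h0)
  · intro t _
    have hs : 0 ≤ D t * (deriv G (ρ t) - deriv G (ρ' t)) := by
      rcases le_total (ρ t) (ρ' t) with hle | hle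
      · exact mul_nonneg_of_nonpos_of_nonpos
          (sub_nonpos.2 ((strictMonoOn_warpPrim hG).monotoneOn (h.pos t).le (h'.pos t).le hle))
          (sub_nonpos.2 (hG.deriv_mono hc (h.pos t) (h'.pos t) hle))
      · exact mul_nonneg
          (sub_nonneg.2 ((strictMonoOn_warpPrim hG).monotoneOn (h'.pos t).le (h.pos t).le hle))
          (sub_nonneg.2 (hG.deriv_mono hc (h'.pos t) (h.pos t) hle))
    nlinarith [mul_nonneg (sq_nonneg K) hs, sq_nonneg (V t - V' t)]

theorem MinPolar.abs_sub_rad_le (h : MinPolar G K a b ρ η) (hK : 0 ≤ K) {s u : ℝ}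
    (hs : a ≤ s) (hsu : s ≤ u) (hu : u ≤ b) : |ρ u - ρ s| ≤ K * (u - s) := by
  have h1 : ∀ᵐ t, t ∈ Set.uIoc s u → ‖deriv ρ t‖ ≤ K := by
    filter_upwards [(ae_restrict_iff' measurableSet_Ioc).1 h.energy] with t ht htm
    rw [uIoc_of_le hsu] at htm
    have h2 := ht ⟨hs.trans_lt htm.1, htm.2.trans hu⟩
    rw [polarEnergy] at h2
    exact abs_le_of_sq_le_sq (by nlinarith [sq_nonneg (G (ρ t) * ‖deriv η t‖)]) hK
  have h2 := intervalIntegral.norm_integral_le_of_norm_le_const_ae h1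
  rwa [integral_deriv_of_lipschitz h.lip_rad.choose_spec, Real.norm_eq_abs,
    abs_of_nonneg (sub_nonneg.2 hsu)] at h2

theorem MinPolar.mul_sub_ne_add (h : MinPolar G K a b ρ η) (hG : IsWarping G)
    (hc : NonposCurvWarping G) (hab : a < b) (hK : 0 < K) : K * (b - a) ≠ ρ a + ρ b := by
  intro heq
  obtain ⟨V, hV, hW⟩ := h.euler_lagrange hG hab
  have ha0 := h.pos a
  have hb0 := h.pos b
  set u : ℝ → ℝ := fun t => ρ a - K * (t - a) with hu
  have hud : ∀ t, HasDerivAt u (-K) t := fun t => by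
    have := (((hasDerivAt_id t).sub_const a).const_mul K).const_sub (ρ a)
    simpa using this
  have hlow : ∀ t ∈ Icc a b, |u t| ≤ ρ t := by
    intro t ht
    have h1 := abs_le.1 (h.abs_sub_rad_le hK.le le_rfl ht.1 ht.2)
    have h2 := abs_le.1 (h.abs_sub_rad_le hK.le ht.1 ht.2 le_rfl)
    simp only [hu]
    rw [abs_le]; constructor <;> linarith
  set c := a + ρ a / K with hcdef
  have hKc : K * (c - a) = ρ a := by simp only [hcdef]; field_simp; ring
  have hac : a < c := by simp only [hcdef]; linarith [div_pos ha0 hK]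
  have hcb : c < b := by
    by_contra! hcon
    nlinarith
  set D : ℝ → ℝ := fun t => warpPrim G (ρ t) - warpPrim G (u t) with hD
  set D' : ℝ → ℝ := fun t => V t - oddWarp G (u t) * -K with hD'
  have huc : Continuous u := continuous_iff_continuousAt.2 fun t => (hud t).continuousAt
  have hVc : Continuous V := continuous_iff_continuousAt.2 fun t => (hV t).continuousAt
  have hDc : Continuous D :=
    ((continuous_warpPrim hG).comp h.continuous_rad).sub ((continuous_warpPrim hG).comp huc)
  have hD'c : Continuous D' :=
    hVc.sub (((continuous_oddWarp hG).comp huc).mul continuous_const)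
  have hd : ∀ t ∈ Ioo a b, HasDerivAt D (D' t) t := fun t ht =>
    (hW t ht).sub ((hasDerivAt_warpPrim hG (u t)).comp t (hud t))
  have hdd : ∀ t ∈ Ioo a b, t ≠ c →
      HasDerivAt D' (K ^ 2 * (deriv G (ρ t) - deriv G |u t|)) t := by
    intro t ht htc
    rcases lt_or_gt_of_ne htc with hlt | hgt
    · have hpos : 0 < u t := by simp only [hu]; nlinarith
      have h1 : HasDerivAt (fun t => oddWarp G (u t)) (deriv G (u t) * -K) t := by
        refine ((hG.hasDerivAt hpos).comp t (hud t)).congr_of_eventuallyEq ?_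
        filter_upwards [huc.continuousAt.eventually (lt_mem_nhds hpos)] with s hs
        rw [oddWarp_of_pos hs]; rfl
      refine ((hV t).sub (h1.mul_const (-K))).congr_deriv ?_
      rw [abs_of_pos hpos]; ring
    · have hneg : u t < 0 := by simp only [hu]; nlinarith
      have h1 : HasDerivAt (fun t => oddWarp G (u t)) (-(deriv G (-u t) * -(-K))) t := by
        refine (((hG.hasDerivAt (r := -u t) (by linarith)).comp t (hud t).neg).neg).congr_of_eventuallyEq ?_
        filter_upwards [huc.continuousAt.eventually (gt_mem_nhds hneg)] with s hs
        rw [oddWarp_of_neg hs]; rfl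
      refine ((hV t).sub (h1.mul_const (-K))).congr_deriv ?_
      rw [abs_of_neg hneg]; ring
  have hnn : ∀ t ∈ Ioo a b, t ≠ c → 0 ≤ K ^ 2 * (deriv G (ρ t) - deriv G |u t|) := by
    intro t ht htc
    have hne : u t ≠ 0 := by
      intro h0
      apply htc
      simp only [hu] at h0
      have : K * (t - a) = K * (c - a) := by linarith
      linarith [mul_left_cancel₀ hK.ne' this]
    exact mul_nonneg (sq_nonneg K) (sub_nonneg.2
      (hG.deriv_mono hc (abs_pos.2 hne) (h.pos t) (hlow t ⟨ht.1.le, ht.2.le⟩)))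
  have hm : ∀ x y, a ≤ x → y ≤ b → (∀ t ∈ Ioo x y, t ≠ c) → MonotoneOn D' (Icc x y) := by
    intro x y hx hy hne
    have hsub : ∀ t ∈ Ioo x y, t ∈ Ioo a b := fun t ht => ⟨hx.trans_lt ht.1, ht.2.trans_le hy⟩
    refine monotoneOn_of_deriv_nonneg (convex_Icc x y) hD'c.continuousOn ?_ ?_
    · rw [interior_Icc]
      exact fun t ht => (hdd t (hsub t ht) (hne t ht)).differentiableAt.differentiableWithinAt
    · rw [interior_Icc]
      intro t ht
      rw [(hdd t (hsub t ht) (hne t ht)).deriv]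
      exact hnn t (hsub t ht) (hne t ht)
  have hmono : MonotoneOn D' (Icc a b) := by
    have := (hm a c le_rfl hcb.le fun t ht => ht.2.ne).union_right
      (hm c b hac.le le_rfl fun t ht => ht.1.ne') (isGreatest_Icc hac.le) (isLeast_Icc hcb.le)
    rwa [Icc_union_Icc_eq_Icc hac.le hcb.le] at this
  have hub : u b = -ρ b := by simp only [hu]; linarith
  have key := nonpos_of_monotoneOn_deriv hDc.continuousOn hd (hmono.mono Ioo_subset_Icc_self)
    (by simp [hD, hu]) (by simp only [hD]; rw [hub, warpPrim_neg, sub_self]) c ⟨hac.le, hcb.le⟩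
  have huc0 : u c = 0 := by simp only [hu]; linarith
  have h3 := strictMonoOn_warpPrim hG (Set.mem_Ici.2 le_rfl) (h.pos c).le (h.pos c)
  simp only [hD, huc0] at key
  linarith

end RadialUniqueness

section Angles

variable {n : ℕ} {e e₀ e₁ : Euc n} {η : ℝ → Euc n}

theorem norm_sub_sq_of_unit (h0 : ‖e₀‖ = 1) (h1 : ‖e₁‖ = 1) :
    ‖e₀ - e₁‖ ^ 2 = 2 - 2 * Real.cos (angle e₀ e₁) := by
  rw [norm_sub_sq_real, h0, h1, inner_eq_cos_angle_of_norm_eq_one h0 h1]; ring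

theorem angle_le_mul_norm_sub (h0 : ‖e₀‖ = 1) (h1 : ‖e₁‖ = 1) :
    angle e₀ e₁ ≤ Real.pi / 2 * ‖e₀ - e₁‖ := by
  have hpi := Real.pi_pos
  have h2 := Real.cos_le_one_sub_mul_cos_sq (x := angle e₀ e₁)
    (by rw [abs_of_nonneg (angle_nonneg _ _)]; exact angle_le_pi _ _)
  have h3 := norm_sub_sq_of_unit h0 h1
  refine abs_le_of_sq_le_sq' ?_ (by positivity) |>.2
  rw [mul_pow, h3]
  calc angle e₀ e₁ ^ 2 = Real.pi ^ 2 / 2 * (2 / Real.pi ^ 2 * angle e₀ e₁ ^ 2) := by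
        field_simp
    _ ≤ Real.pi ^ 2 / 2 * (1 - Real.cos (angle e₀ e₁)) := by gcongr; linarith
    _ = _ := by ring

theorem lipschitzWith_angle_left {K : ℝ≥0} (hη : LipschitzWith K η) (hn : ∀ t, ‖η t‖ = 1) :
    ∃ L, LipschitzWith L fun t => angle e (η t) := by
  refine ⟨Real.toNNReal (Real.pi / 2) * K, LipschitzWith.of_dist_le_mul fun s t => ?_⟩
  have hpi := Real.pi_pos
  have key : ∀ s t, angle e (η s) - angle e (η t) ≤ Real.pi / 2 * (K * dist s t) := by
    intro s t
    have h1 := angle_le_angle_add_angle e (η t) (η s)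
    have h2 := angle_le_mul_norm_sub (hn t) (hn s)
    have h3 := hη.dist_le_mul t s
    rw [dist_eq_norm, dist_comm] at h3
    have h4 := mul_le_mul_of_nonneg_left h3 (half_pos hpi).le
    linarith
  rw [NNReal.coe_mul, Real.coe_toNNReal _ (by positivity), Real.dist_eq, abs_le, mul_assoc]
  have h1 := key s t
  have h2 := key t s
  rw [dist_comm] at h2
  constructor <;> linarith

theorem abs_deriv_angle_le (he : ‖e‖ = 1) (hn : ∀ t, ‖η t‖ = 1) {t : ℝ}
    (hd : DifferentiableAt ℝ η t) (hφ : DifferentiableAt ℝ (fun t => angle e (η t)) t)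
    (ho : ⟪η t, deriv η t⟫ = 0) :
    |deriv (fun t => angle e (η t)) t| ≤ ‖deriv η t‖ := by
  set φ : ℝ → ℝ := fun t => angle e (η t) with hφdef
  have hcos : (fun t => Real.cos (φ t)) = fun t => ⟪e, η t⟫ := by
    funext s
    rw [hφdef, inner_eq_cos_angle_of_norm_eq_one he (hn s)]
  by_cases hs : Real.sin (φ t) = 0
  · have h0 : deriv φ t = 0 := by
      rcases sin_eq_zero_iff_angle_eq_zero_or_angle_eq_pi.1 hs with h | h
      · refine IsLocalMin.deriv_eq_zero (Eventually.of_forall fun s => ?_)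
        simp only [hφdef]; rw [h]; exact angle_nonneg _ _
      · refine IsLocalMax.deriv_eq_zero (Eventually.of_forall fun s => ?_)
        simp only [hφdef]; rw [h]; exact angle_le_pi _ _
    rw [h0, abs_zero]; exact norm_nonneg _
  · have hspos : 0 < Real.sin (φ t) :=
      lt_of_le_of_ne (sin_angle_nonneg _ _) (Ne.symm hs)
    have h1 := hφ.hasDerivAt.cos
    have h2 : HasDerivAt (fun t => ⟪e, η t⟫) (⟪e, deriv η t⟫ + ⟪(0 : Euc n), η t⟫) t :=
      (hasDerivAt_const t e).inner ℝ hd.hasDerivAt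
    rw [hcos] at h1
    have h3 := h1.unique h2
    rw [inner_zero_left, add_zero] at h3
    have h4 : ⟪e, deriv η t⟫ = ⟪e - Real.cos (φ t) • η t, deriv η t⟫ := by
      rw [inner_sub_left, real_inner_smul_left, ho, mul_zero, sub_zero]
    have h5 : ‖e - Real.cos (φ t) • η t‖ = Real.sin (φ t) := by
      rw [← sq_eq_sq₀ (norm_nonneg _) hspos.le, norm_sub_sq_real, norm_smul, he, hn t,
        real_inner_smul_right, ← congrFun hcos t, Real.sin_sq, Real.norm_eq_abs, mul_one, sq_abs]
      ring
    have h6 := abs_real_inner_le_norm (e - Real.cos (φ t) • η t) (deriv η t)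
    rw [← h4, h5, ← h3, abs_mul, abs_neg, abs_of_pos hspos] at h6
    exact le_of_mul_le_mul_left h6 hspos

theorem sin_angle_smul_eq_of_angle_eq_add (h0 : ‖e₀‖ = 1) (h : ‖e‖ = 1) (h1 : ‖e₁‖ = 1)
    (hadd : angle e₀ e₁ = angle e₀ e + angle e e₁) :
    Real.sin (angle e₀ e₁) • e = Real.sin (angle e e₁) • e₀ + Real.sin (angle e₀ e) • e₁ := by
  have i1 : ⟪e, e₀⟫ = Real.cos (angle e₀ e) := by
    rw [real_inner_comm]; exact inner_eq_cos_angle_of_norm_eq_one h0 h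
  have i2 : ⟪e, e₁⟫ = Real.cos (angle e e₁) := inner_eq_cos_angle_of_norm_eq_one h h1
  have i3 : ⟪e₀, e₁⟫ = Real.cos (angle e₀ e₁) := inner_eq_cos_angle_of_norm_eq_one h0 h1
  rw [← sub_eq_zero, ← norm_eq_zero, ← pow_eq_zero_iff two_ne_zero, norm_sub_sq_real,
    norm_add_sq_real, inner_add_right, norm_smul, norm_smul, norm_smul, h0, h, h1]
  simp only [real_inner_smul_left, real_inner_smul_right, i1, i2, i3, hadd, Real.sin_add,
    Real.cos_add, Real.norm_eq_abs, mul_one, sq_abs]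
  linear_combination (-(Real.sin (angle e₀ e) ^ 2)) * Real.sin_sq_add_cos_sq (angle e e₁) -
    Real.sin (angle e e₁) ^ 2 * Real.sin_sq_add_cos_sq (angle e₀ e)

theorem exists_arc (h0 : ‖e₀‖ = 1) (h1 : ‖e₁‖ = 1) (hne : angle e₀ e₁ ≠ Real.pi) :
    ∃ f f' : ℝ → Euc n, f 0 = e₀ ∧ f (angle e₀ e₁) = e₁ ∧ (∀ x, ‖f x‖ = 1) ∧
      ∀ x, HasDerivAt f (f' x) x ∧ ‖f' x‖ ≤ 1 := by
  rcases eq_or_ne (angle e₀ e₁) 0 with hz | hz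
  · have he : e₀ = e₁ := by
      have h2 := norm_sub_sq_of_unit h0 h1
      rw [hz, Real.cos_zero] at h2
      exact sub_eq_zero.1 (norm_eq_zero.1 (pow_eq_zero_iff two_ne_zero |>.1 (by linarith)))
    exact ⟨fun _ => e₀, fun _ => 0, rfl, he, fun _ => h0,
      fun x => ⟨hasDerivAt_const x _, by simp⟩⟩
  · set β := angle e₀ e₁ with hβ
    have hs : Real.sin β ≠ 0 := fun h => by
      rcases sin_eq_zero_iff_angle_eq_zero_or_angle_eq_pi.1 h with h | h
      exacts [hz h, hne h]
    set v : Euc n := (Real.sin β)⁻¹ • (e₁ - Real.cos β • e₀) with hv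
    have hin : ⟪e₀, e₁⟫ = Real.cos β := inner_eq_cos_angle_of_norm_eq_one h0 h1
    have h0v : ⟪e₀, v⟫ = 0 := by
      rw [hv, real_inner_smul_right, inner_sub_right, real_inner_smul_right, hin,
        real_inner_self_eq_norm_sq, h0]
      ring
    have hvn : ‖v‖ ^ 2 = 1 := by
      have h2 : ‖e₁ - Real.cos β • e₀‖ ^ 2 = Real.sin β ^ 2 := by
        rw [norm_sub_sq_real, norm_smul, h0, h1, real_inner_smul_right, real_inner_comm, hin,
          Real.sin_sq, Real.norm_eq_abs, mul_one, sq_abs]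
        ring
      rw [hv, norm_smul, mul_pow, h2, norm_inv, Real.norm_eq_abs, inv_pow, sq_abs,
        inv_mul_cancel₀ (pow_ne_zero 2 hs)]
    have hcomb : ∀ c s : ℝ, ‖c • e₀ + s • v‖ ^ 2 = c ^ 2 + s ^ 2 := by
      intro c s
      rw [norm_add_sq_real, norm_smul, norm_smul, mul_pow, mul_pow, hvn, h0, real_inner_smul_left,
        real_inner_smul_right, h0v, Real.norm_eq_abs, Real.norm_eq_abs, sq_abs, sq_abs]
      ring
    refine ⟨fun x => Real.cos x • e₀ + Real.sin x • v,
      fun x => (-Real.sin x) • e₀ + Real.cos x • v, by simp, ?_, fun x => ?_, fun x => ⟨?_, ?_⟩⟩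
    · simp only [hv]
      rw [smul_smul, mul_inv_cancel₀ hs, one_smul]; abel
    · rw [← sq_eq_sq₀ (norm_nonneg _) zero_le_one, hcomb, one_pow, Real.cos_sq_add_sin_sq]
    · exact ((Real.hasDerivAt_cos x).smul_const e₀).add ((Real.hasDerivAt_sin x).smul_const v)
    · refine (abs_le_of_sq_le_sq' ?_ zero_le_one).2
      rw [hcomb, one_pow, neg_sq, Real.sin_sq_add_cos_sq]

end Angles

section PolarAngles

variable {n : ℕ} {G : ℝ → ℝ} {ρ ρ' : ℝ → ℝ} {η η' : ℝ → Euc n} {K a b : ℝ}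

theorem PolarCurve.intervalIntegrable_norm_deriv_ang (h : PolarCurve ρ η) (s u : ℝ) :
    IntervalIntegrable (fun t => ‖deriv η t‖) volume s u := by
  obtain ⟨C, hC⟩ := h.exists_norm_deriv_ang_le
  exact intervalIntegrable_of_abs_le (C := C) (measurable_deriv η).norm fun t _ => by
    rw [abs_norm]; exact hC t

theorem PolarCurve.angle_le_integral (h : PolarCurve ρ η) {s u : ℝ} (hsu : s ≤ u) :
    angle (η s) (η u) ≤ ∫ t in s..u, ‖deriv η t‖ := by
  obtain ⟨L, hL⟩ := lipschitzWith_angle_left (e := η s) h.lip_ang.choose_spec h.norm_ang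
  have h1 := integral_deriv_of_lipschitz hL s u
  have hs : η s ≠ 0 := norm_ne_zero_iff.1 (by rw [h.norm_ang]; exact one_ne_zero)
  rw [angle_self hs, sub_zero] at h1
  rw [← h1]
  refine intervalIntegral.integral_mono_ae hsu
    (intervalIntegrable_of_abs_le (C := L) (measurable_deriv _) fun t _ =>
      norm_deriv_le_of_lipschitz hL) (h.intervalIntegrable_norm_deriv_ang s u) ?_
  filter_upwards [h.ae_differentiableAt_ang, hL.ae_differentiableAt_real] with t ht1 ht2
  exact (le_abs_self _).trans
    (abs_deriv_angle_le (h.norm_ang s) h.norm_ang ht1 ht2 (h.inner_deriv_ang ht1))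

theorem PolarCurve.eq_zero_of_energy_nonpos (h : PolarCurve ρ η) (hG : IsWarping G)
    (hc : NonposCurvWarping G) (hab : a < b)
    (hS : ∫ t in a..b, G (ρ t) ^ 2 * ‖deriv η t‖ ^ 2 ≤ 0) :
    ∫ t in a..b, ‖deriv η t‖ ≤ 0 := by
  obtain ⟨r, hr, hrρ⟩ := h.away
  set A := ∫ t in a..b, ‖deriv η t‖ with hA
  have hi := h.intervalIntegrable_norm_deriv_ang a b
  set c := A / (b - a) with hcdef
  have h1 : ∫ t in a..b, r ^ 2 * (2 * c * ‖deriv η t‖ - c ^ 2) ≤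
      ∫ t in a..b, G (ρ t) ^ 2 * ‖deriv η t‖ ^ 2 := by
    refine intervalIntegral.integral_mono_on hab.le
      (((hi.const_mul _).sub intervalIntegrable_const).const_mul _)
      (h.intervalIntegrable_energy_terms hG a b).2.2 fun t _ => ?_
    have h2 : r ^ 2 ≤ G (ρ t) ^ 2 :=
      pow_le_pow_left₀ hr.le ((hrρ t).trans (hG.self_le hc (h.pos t))) 2
    calc r ^ 2 * (2 * c * ‖deriv η t‖ - c ^ 2) ≤ r ^ 2 * ‖deriv η t‖ ^ 2 := by
          gcongr; nlinarith [sq_nonneg (c - ‖deriv η t‖)]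
      _ ≤ _ := by gcongr
  rw [intervalIntegral.integral_const_mul, intervalIntegral.integral_sub (hi.const_mul _)
    intervalIntegrable_const, intervalIntegral.integral_const_mul, intervalIntegral.integral_const,
    smul_eq_mul, ← hA] at h1
  have hba : 0 < b - a := sub_pos.2 hab
  have h3 : 2 * c * A - (b - a) * c ^ 2 = c ^ 2 * (b - a) := by
    simp only [hcdef]; field_simp; ring
  rw [h3] at h1
  have h4 : r ^ 2 * (c ^ 2 * (b - a)) ≤ 0 := h1.trans hS
  have h5 : c = 0 := by
    by_contra h0
    have : 0 < r ^ 2 * (c ^ 2 * (b - a)) := by positivity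
    linarith
  have : A = 0 := by
    rcases div_eq_zero_iff.1 h5 with h | h
    exacts [h, absurd h hba.ne']
  exact this.le

theorem MinPolar.integral_norm_deriv_ang_le (h : MinPolar G K a b ρ η) (hG : IsWarping G)
    (hc : NonposCurvWarping G) (hab : a < b) (hne : angle (η a) (η b) ≠ Real.pi) :
    ∫ t in a..b, ‖deriv η t‖ ≤ angle (η a) (η b) := by
  by_contra! hlt
  have hpc := h.toPolarCurve
  obtain ⟨f, f', hf0, hf1, hfn, hfd⟩ := exists_arc (h.norm_ang a) (h.norm_ang b) hne
  set β := angle (η a) (η b) with hβ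
  have hβ0 : 0 ≤ β := angle_nonneg _ _
  set A := ∫ t in a..b, ‖deriv η t‖ with hA
  have hA0 : 0 < A := hβ0.trans_lt hlt
  set k := β / A with hk
  have hk0 : 0 ≤ k := by positivity
  have hk1 : k < 1 := (div_lt_one hA0).2 hlt
  set θ : ℝ → ℝ := fun t => k * ∫ s in a..t, ‖deriv η s‖ with hθ
  obtain ⟨C, hC⟩ := hpc.exists_norm_deriv_ang_le
  have hC0 : 0 ≤ C := (norm_nonneg _).trans (hC 0)
  have hθl : LipschitzWith (Real.toNNReal (k * C)) θ := by
    refine LipschitzWith.of_dist_le_mul fun s t => ?_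
    rw [Real.coe_toNNReal _ (by positivity), Real.dist_eq, hθ, ← mul_sub,
      intervalIntegral.integral_interval_sub_left (hpc.intervalIntegrable_norm_deriv_ang _ _)
        (hpc.intervalIntegrable_norm_deriv_ang _ _), abs_mul, abs_of_nonneg hk0, mul_assoc]
    gcongr
    exact intervalIntegral.norm_integral_le_of_norm_le_const (f := fun x => ‖deriv η x‖)
      fun x _ => by rw [norm_norm]; exact hC x
  have hfl : LipschitzWith 1 f := by
    refine lipschitzWith_of_nnnorm_deriv_le (fun x => (hfd x).1.differentiableAt) fun x => ?_
    rw [(hfd x).1.deriv]; exact (hfd x).2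
  have hζ : PolarCurve ρ (f ∘ θ) :=
    ⟨hpc.lip_rad, ⟨_, hfl.comp hθl⟩, hpc.bdd, hpc.away, fun t => hfn _⟩
  have hmin := h.min ρ (f ∘ θ) hζ rfl rfl (by simp [hθ, hf0])
    (by
      have : θ b = β := by simp only [hθ, hk]; rw [← hA]; field_simp
      rw [Function.comp_apply, this, hf1])
  have hloc : LocallyIntegrable (fun t => ‖deriv η t‖) volume := by
    refine (locallyIntegrable_const C).mono (measurable_deriv η).norm.aestronglyMeasurable ?_
    exact Eventually.of_forall fun t => by
      rw [norm_norm]; exact (hC t).trans (le_abs_self C)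
  have hb : ∫ t in a..b, polarEnergy G ρ (f ∘ θ) t ≤
      ∫ t in a..b, (deriv ρ t ^ 2 + k ^ 2 * (G (ρ t) ^ 2 * ‖deriv η t‖ ^ 2)) := by
    have hi := hpc.intervalIntegrable_energy_terms hG a b
    refine intervalIntegral.integral_mono_ae hab.le (hζ.intervalIntegrable_energy hG a b)
      (hi.1.add (hi.2.2.const_mul _)) ?_
    filter_upwards [LocallyIntegrable.ae_hasDerivAt_integral hloc] with t ht
    have h1 : HasDerivAt (f ∘ θ) ((k * ‖deriv η t‖) • f' (θ t)) t :=
      HasDerivAt.scomp t (hfd (θ t)).1 ((ht a).const_mul k)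
    rw [polarEnergy, h1.deriv]
    have h2 : ‖(k * ‖deriv η t‖) • f' (θ t)‖ ≤ k * ‖deriv η t‖ := by
      rw [norm_smul, Real.norm_eq_abs, abs_of_nonneg (by positivity)]
      exact mul_le_of_le_one_right (by positivity) (hfd _).2
    have h3 : ‖(k * ‖deriv η t‖) • f' (θ t)‖ ^ 2 ≤ k ^ 2 * ‖deriv η t‖ ^ 2 := by
      rw [← mul_pow]; exact pow_le_pow_left₀ (norm_nonneg _) h2 2
    have h4 := mul_le_mul_of_nonneg_left h3 (sq_nonneg (G (ρ t)))
    linarith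
  have hi := hpc.intervalIntegrable_energy_terms hG a b
  have he : ∫ t in a..b, polarEnergy G ρ η t = K ^ 2 * (b - a) := by
    rw [intervalIntegral.integral_congr_ae_restrict (g := fun _ => K ^ 2)
      (by rw [uIoc_of_le hab.le]; exact h.energy), intervalIntegral.integral_const, smul_eq_mul,
      mul_comm]
  have he2 : ∫ t in a..b, polarEnergy G ρ η t = (∫ t in a..b, deriv ρ t ^ 2) +
      ∫ t in a..b, G (ρ t) ^ 2 * ‖deriv η t‖ ^ 2 := intervalIntegral.integral_add hi.1 hi.2.2
  rw [intervalIntegral.integral_add hi.1 (hi.2.2.const_mul _),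
    intervalIntegral.integral_const_mul] at hb
  have hS : ∫ t in a..b, G (ρ t) ^ 2 * ‖deriv η t‖ ^ 2 ≤ 0 := by
    by_contra! hpos
    have : k ^ 2 < 1 := by nlinarith
    nlinarith
  exact absurd (hpc.eq_zero_of_energy_nonpos hG hc hab hS) (not_le.2 hA0)

theorem MinPolar.angle_eq (h : MinPolar G K a b ρ η) (hG : IsWarping G)
    (hc : NonposCurvWarping G) (hab : a < b) (hne : angle (η a) (η b) ≠ Real.pi) {t : ℝ}
    (ht : t ∈ Icc a b) :
    angle (η a) (η t) = ∫ s in a..t, ‖deriv η s‖ ∧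
      angle (η t) (η b) = ∫ s in t..b, ‖deriv η s‖ ∧
      angle (η a) (η b) = angle (η a) (η t) + angle (η t) (η b) := by
  have h1 := h.integral_norm_deriv_ang_le hG hc hab hne
  have h2 := h.angle_le_integral ht.1
  have h3 := h.angle_le_integral ht.2
  have h4 := angle_le_angle_add_angle (η a) (η t) (η b)
  have h5 := intervalIntegral.integral_add_adjacent_intervals
    (h.intervalIntegrable_norm_deriv_ang a t) (h.intervalIntegrable_norm_deriv_ang t b)
  refine ⟨?_, ?_, ?_⟩ <;> linarith

theorem MinPolar.unique (h : MinPolar G K a b ρ η) (h' : MinPolar G K a b ρ' η')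
    (hG : IsWarping G) (hc : NonposCurvWarping G) (hab : a < b)
    (ha : ρ a = ρ' a) (hb : ρ b = ρ' b) (hηa : η a = η' a) (hηb : η b = η' b)
    (hne : angle (η a) (η b) ≠ Real.pi) :
    ∀ t ∈ Icc a b, ρ t = ρ' t ∧ η t = η' t := by
  have hrad := h.rad_eq h' hG hc hab ha hb
  have hspeed : ∀ᵐ t, t ∈ Ioo a b → ‖deriv η t‖ = ‖deriv η' t‖ := by
    filter_upwards [(ae_restrict_iff' measurableSet_Ioc).1 h.energy,
      (ae_restrict_iff' measurableSet_Ioc).1 h'.energy] with t h1 h2 ht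
    have h3 := (h1 ⟨ht.1, ht.2.le⟩).trans (h2 ⟨ht.1, ht.2.le⟩).symm
    have h4 : deriv ρ t = deriv ρ' t := by
      refine Filter.EventuallyEq.deriv_eq ?_
      filter_upwards [Ioo_mem_nhds ht.1 ht.2] with s hs using hrad s ⟨hs.1.le, hs.2.le⟩
    have hGp := hG.1 (ρ t) (h.pos t)
    rw [polarEnergy, polarEnergy, h4, ← hrad t ⟨ht.1.le, ht.2.le⟩] at h3
    have h5 := mul_left_cancel₀ (pow_ne_zero 2 hGp.ne') (add_left_cancel h3)
    exact (sq_eq_sq₀ (norm_nonneg _) (norm_nonneg _)).1 h5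
  have hprim : ∀ s u, a ≤ s → s ≤ u → u ≤ b →
      ∫ t in s..u, ‖deriv η t‖ = ∫ t in s..u, ‖deriv η' t‖ := by
    intro s u hs hsu hu
    rw [intervalIntegral.integral_of_le hsu, intervalIntegral.integral_of_le hsu,
      integral_Ioc_eq_integral_Ioo, integral_Ioc_eq_integral_Ioo]
    refine setIntegral_congr_ae measurableSet_Ioo ?_
    filter_upwards [hspeed] with t ht htm using ht ⟨hs.trans_lt htm.1, htm.2.trans_le hu⟩
  intro t ht
  refine ⟨hrad t ht, ?_⟩
  have hne' : angle (η' a) (η' b) ≠ Real.pi := by rw [← hηa, ← hηb]; exact hne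
  obtain ⟨p1, p2, p3⟩ := h.angle_eq hG hc hab hne ht
  obtain ⟨q1, q2, q3⟩ := h'.angle_eq hG hc hab hne' ht
  rw [← hprim _ _ le_rfl ht.1 ht.2] at q1
  rw [← hprim _ _ ht.1 ht.2 le_rfl] at q2
  rcases eq_or_ne (Real.sin (angle (η a) (η b))) 0 with hs | hs
  · have hz : angle (η a) (η b) = 0 := by
      rcases sin_eq_zero_iff_angle_eq_zero_or_angle_eq_pi.1 hs with h0 | h0
      exacts [h0, absurd h0 hne]
    have e1 : angle (η a) (η t) = 0 := by
      linarith [angle_nonneg (η a) (η t), angle_nonneg (η t) (η b)]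
    have e2 : angle (η' a) (η' t) = 0 := by rw [q1, ← p1, e1]
    have r1 := norm_sub_sq_of_unit (h.norm_ang a) (h.norm_ang t)
    have r2 := norm_sub_sq_of_unit (h'.norm_ang a) (h'.norm_ang t)
    rw [e1, Real.cos_zero] at r1
    rw [e2, Real.cos_zero] at r2
    have s1 := sub_eq_zero.1 (norm_eq_zero.1 (pow_eq_zero_iff two_ne_zero |>.1
      (show ‖η a - η t‖ ^ 2 = 0 by linarith)))
    have s2 := sub_eq_zero.1 (norm_eq_zero.1 (pow_eq_zero_iff two_ne_zero |>.1
      (show ‖η' a - η' t‖ ^ 2 = 0 by linarith)))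
    rw [← s1, ← s2, hηa]
  · have x1 := sin_angle_smul_eq_of_angle_eq_add (h.norm_ang a) (h.norm_ang t)
      (h.norm_ang b) p3
    have x2 := sin_angle_smul_eq_of_angle_eq_add (h'.norm_ang a) (h'.norm_ang t)
      (h'.norm_ang b) q3
    rw [q2, q1, ← p2, ← p1, ← hηa, ← hηb, ← x1] at x2
    exact (smul_right_injective _ hs x2).symm

end PolarAngles

section Geodesics

variable {n : ℕ} {p : M} {G : ℝ → ℝ} {Φ : Euc n ≃ M} {K : ℝ≥0} {γ γ' : ℝ → M} {a b : ℝ}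

theorem dist_center (hsym : IsSphericallySymmetric p G Φ) (z : M) : dist z p = ‖Φ.symm z‖ := by
  rw [← hsym.2.2.1, Φ.apply_symm_apply]

/-- Constant speed minimizers joining the same points coincide, provided one avoids the pole. -/
theorem geodesic_unique (hsym : IsSphericallySymmetric p G Φ) (hc : NonposCurvWarping G)
    (hK : 0 < K) (hab : a < b) (hγ : LipschitzOnWith K γ (Icc a b))
    (hγ' : LipschitzOnWith K γ' (Icc a b)) (hp : ∀ t ∈ Icc a b, γ t ≠ p)
    (hd : K * (b - a) ≤ dist (γ a) (γ b)) (ha : γ' a = γ a) (hb : γ' b = γ b) :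
    ∀ t ∈ Icc a b, γ' t = γ t := by
  have hKr : (0 : ℝ) < K := hK
  have hma := left_mem_Icc.2 hab.le
  have hmb := right_mem_Icc.2 hab.le
  obtain ⟨ρ, η, hm, hv⟩ := exists_minPolar hsym hc hab.le hγ hp hd
  have hne := hm.mul_sub_ne_add hsym.1 hc hab hKr
  rw [(hv a hma).1, (hv b hmb).1, ← dist_center hsym, ← dist_center hsym] at hne
  have hp' : ∀ t ∈ Icc a b, γ' t ≠ p := by
    intro t ht h0
    have h1 := hγ'.dist_le_mul a hma t ht
    have h2 := hγ'.dist_le_mul b hmb t ht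
    rw [h0, ha, dist_comm a, Real.dist_eq, abs_of_nonneg (sub_nonneg.2 ht.1)] at h1
    rw [h0, hb, Real.dist_eq, abs_of_nonneg (sub_nonneg.2 ht.2)] at h2
    have h3 := dist_triangle_right (γ a) (γ b) p
    apply hne
    nlinarith
  obtain ⟨ρ', η', hm', hv'⟩ := exists_minPolar hsym hc hab.le hγ' hp' (by rwa [ha, hb])
  have hang : angle (η a) (η b) ≠ Real.pi := by
    intro h0
    have hpos : ∀ t ∈ Icc a b, 0 < ‖Φ.symm (γ t)‖ := fun t ht => (hv t ht).1 ▸ hm.pos t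
    rw [(hv a hma).2, (hv b hmb).2, polarTheta, polarTheta,
      angle_smul_left_of_pos _ _ (inv_pos.2 (hpos a hma)),
      angle_smul_right_of_pos _ _ (inv_pos.2 (hpos b hmb))] at h0
    have h1 := norm_sub_le_dist hsym hc (Φ.symm (γ a)) (Φ.symm (γ b))
    rw [norm_sub_eq_add_norm_of_angle_eq_pi h0, Φ.apply_symm_apply, Φ.apply_symm_apply,
      ← dist_center hsym, ← dist_center hsym] at h1
    have h2 := hγ.dist_le_mul a hma b hmb
    rw [dist_comm a, Real.dist_eq, abs_of_pos (sub_pos.2 hab)] at h2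
    have h3 := dist_triangle_right (γ a) (γ b) p
    apply hne
    linarith
  have key := hm.unique hm' hsym.1 hc hab (by rw [(hv a hma).1, (hv' a hma).1, ha])
    (by rw [(hv b hmb).1, (hv' b hmb).1, hb]) (by rw [(hv a hma).2, (hv' a hma).2, ha])
    (by rw [(hv b hmb).2, (hv' b hmb).2, hb]) hang
  intro t ht
  obtain ⟨h1, h2⟩ := key t ht
  have h3 := hm.pos t
  rw [(hv t ht).1] at h3
  rw [(hv t ht).1, (hv' t ht).1] at h1
  rw [(hv t ht).2, (hv' t ht).2, polarTheta, polarTheta, ← h1] at h2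
  exact Φ.symm.injective (smul_right_injective _ (inv_ne_zero h3.ne') h2).symm

/-- A `K`-Lipschitz curve whose endpoints are as far apart as possible is a geodesic. -/
theorem dist_eq_of_le_dist (hγ : LipschitzOnWith K γ (Icc a b))
    (hd : K * (b - a) ≤ dist (γ a) (γ b)) {s u : ℝ} (hs : s ∈ Icc a b) (hu : u ∈ Icc a b) :
    dist (γ s) (γ u) = K * |s - u| := by
  wlog hsu : s ≤ u generalizing s u
  · rw [dist_comm, abs_sub_comm]; exact this hu hs (le_of_not_ge hsu)
  have hab := hs.1.trans hs.2
  have h1 := hγ.dist_le_mul a (left_mem_Icc.2 hab) s hs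
  have h2 := hγ.dist_le_mul s hs u hu
  have h3 := hγ.dist_le_mul u hu b (right_mem_Icc.2 hab)
  have h4 := dist_triangle4 (γ a) (γ s) (γ u) (γ b)
  rw [dist_comm a, Real.dist_eq, abs_of_nonneg (sub_nonneg.2 hs.1)] at h1
  rw [Real.dist_eq] at h2
  rw [dist_comm u, Real.dist_eq, abs_of_nonneg (sub_nonneg.2 hu.2)] at h3
  refine le_antisymm h2 ?_
  rw [abs_sub_comm, abs_of_nonneg (sub_nonneg.2 hsu)]
  linarith

end Geodesics

section MinimalPaths

variable {p q : M} {lam T : ℝ} {γ : ℝ → M}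

/-- A path of speed `lam` starting at `q` and minimizing length in the complement of `Ω`. -/
structure MinPath (p q : M) (lam T : ℝ) (γ : ℝ → M) : Prop where
  start : γ 0 = q
  out : ∀ t ∈ Icc (0 : ℝ) T, γ t ∉ Omega p q lam
  lip : LipschitzOnWith (Real.toNNReal lam) γ (Icc 0 T)
  dCompl_eq : ∀ t ∈ Icc (0 : ℝ) T, dCompl (Omega p q lam) (γ t) q = ENNReal.ofReal (lam * t)
  length : ∀ x y : M, dCompl (∅ : Set M) x y ≤ ENNReal.ofReal (dist x y)
  ne : q ≠ p
  one_lt : 1 < lam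

namespace MinPath

theorem pos (h : MinPath p q lam T γ) : 0 < lam := zero_lt_one.trans h.one_lt

theorem coe_speed (h : MinPath p q lam T γ) : ((Real.toNNReal lam : ℝ≥0) : ℝ) = lam :=
  Real.coe_toNNReal _ h.pos.le

theorem dist_le (h : MinPath p q lam T γ) {s u : ℝ} (hs : s ∈ Icc 0 T) (hu : u ∈ Icc 0 T) :
    dist (γ s) (γ u) ≤ lam * |s - u| := by
  have := h.lip.dist_le_mul s hs u hu
  rwa [h.coe_speed, Real.dist_eq] at this

theorem le_of_joins (h : MinPath p q lam T γ) {t L : ℝ} (ht : t ∈ Icc 0 T)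
    (hj : Joins (Omega p q lam) q (γ t) L) : lam * t ≤ L := by
  have h1 := hj.symm.dCompl_le
  rw [h.dCompl_eq t ht] at h1
  exact (ENNReal.ofReal_le_ofReal_iff hj.1).1 h1

theorem ne_center (h : MinPath p q lam T γ) {t : ℝ} (ht : t ∈ Icc 0 T) : γ t ≠ p := fun h0 =>
  h.out t ht (by rw [h0]; exact center_mem_Omega h.ne)

variable [ProperSpace M]

theorem joins (h : MinPath p q lam T γ) {t : ℝ} (ht : t ∈ Icc 0 T) :
    Joins (Omega p q lam) q (γ t) (lam * t) :=
  (joins_of_dCompl_le (isOpen_Omega h.pos.le) (mul_nonneg h.pos.le ht.1) (h.dCompl_eq t ht).le).symm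

theorem le_dist (h : MinPath p q lam T γ) {t : ℝ} (ht : t ∈ Icc 0 T) : t ≤ dist (γ t) p :=
  le_of_mul_le_mul_left
    (h.le_of_joins ht (joins_of_notMem_Omega h.pos.le (h.out t ht))) h.pos

theorem dist_eq_of_mem_frontier (h : MinPath p q lam T γ) {t : ℝ} (ht : t ∈ Icc 0 T)
    (hf : γ t ∈ frontier (Omega p q lam)) : dist (γ t) p = t :=
  le_antisymm (dist_le_of_mem_frontier h.pos h.length hf (h.joins ht)) (h.le_dist ht)

theorem mem_frontier (h : MinPath p q lam T γ) {t : ℝ} (ht : t ∈ Icc 0 T)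
    (hf : γ t ∈ closure (Omega p q lam)) : γ t ∈ frontier (Omega p q lam) := by
  rw [(isOpen_Omega h.pos.le).frontier_eq]
  exact ⟨hf, h.out t ht⟩

/-- Off the closure of `Ω`, a minimal path is locally a geodesic of `M`. -/
theorem exists_local_geodesic (h : MinPath p q lam T γ) {t : ℝ} (ht : t ∈ Icc 0 T)
    (hf : γ t ∉ closure (Omega p q lam)) : ∃ ε > 0, ∀ s ∈ Icc 0 T, ∀ u ∈ Icc 0 T, s ≤ u →
      |s - t| ≤ ε → |u - t| ≤ ε → lam * (u - s) ≤ dist (γ s) (γ u) := by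
  obtain ⟨r, hr, hball⟩ := Metric.isOpen_iff.1 isClosed_closure.isOpen_compl _ hf
  have hlam := h.pos
  refine ⟨r / (4 * lam), by positivity, fun s hs u hu hsu hst hut => ?_⟩
  have hε : lam * (r / (4 * lam)) = r / 4 := by field_simp
  have h1 : dist (γ s) (γ t) ≤ r / 4 :=
    (h.dist_le hs ht).trans ((mul_le_mul_of_nonneg_left hst hlam.le).trans hε.le)
  have h2 : dist (γ u) (γ t) ≤ r / 4 :=
    (h.dist_le hu ht).trans ((mul_le_mul_of_nonneg_left hut hlam.le).trans hε.le)
  have h3 : dist (γ s) (γ u) ≤ r / 2 := by linarith [dist_triangle_right (γ s) (γ u) (γ t)]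
  obtain ⟨hL, g, hg, h0, h1', -⟩ := joins_dist h.length (γ s) (γ u)
  have hj : Joins (Omega p q lam) (γ s) (γ u) (dist (γ s) (γ u)) := by
    refine Joins.of_icc hL (hg.lipschitzOnWith (s := Icc 0 _)) h0 h1' fun τ hτ hmem => ?_
    refine hball ?_ (subset_closure hmem)
    have h5 := hg.dist_le_mul τ 0
    rw [h0, Real.dist_eq, sub_zero, abs_of_nonneg hτ.1, NNReal.coe_one, one_mul] at h5
    have h6 := dist_triangle (g τ) (γ s) (γ t)
    rw [mem_ball]
    linarith [hτ.2]
  have h7 := h.le_of_joins hu ((h.joins hs).trans hj)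
  linarith

/-- Up to the first hitting time of the closure of `Ω`, a minimal path is a geodesic of `M`. -/
theorem initial_geodesic {n : ℕ} {G : ℝ → ℝ} {Φ : Euc n ≃ M} (h : MinPath p q lam T γ)
    (hsym : IsSphericallySymmetric p G Φ) (hc : NonposCurvWarping G) {t₀ : ℝ}
    (h₀ : t₀ ∈ Icc 0 T) (hf : ∀ t ∈ Ico 0 t₀, γ t ∉ closure (Omega p q lam)) :
    lam * t₀ ≤ dist (γ 0) (γ t₀) := by
  have hlam := h.pos
  have hsub : ∀ t ∈ Icc 0 t₀, t ∈ Icc 0 T := fun t ht => ⟨ht.1, ht.2.trans h₀.2⟩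
  have hcont : ContinuousOn γ (Icc 0 t₀) := h.lip.continuousOn.mono hsub
  set E := {t ∈ Icc (0 : ℝ) t₀ | lam * t ≤ dist q (γ t)} with hE
  have hEc : IsCompact E := by
    refine isCompact_Icc.of_isClosed_subset ?_ fun t ht => ht.1
    exact (isClosed_Icc).isClosed_le (continuousOn_const.mul continuousOn_id)
      ((continuous_const.dist continuous_id).comp_continuousOn hcont)
  have hE0 : (0 : ℝ) ∈ E := ⟨⟨le_rfl, h₀.1⟩, by rw [mul_zero]; exact dist_nonneg⟩
  set t₁ := sSup E with ht₁
  have hm : t₁ ∈ E := hEc.sSup_mem ⟨0, hE0⟩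
  obtain ⟨hm1, hm2⟩ := hm
  rw [h.start]
  rcases hm1.2.eq_or_lt with heq | hlt
  · rwa [heq] at hm2
  exfalso
  set t : ℕ → ℝ := fun k => t₁ + (t₀ - t₁) * (1 / ((k : ℝ) + 1)) with htdef
  have hk : ∀ k : ℕ, 0 < 1 / ((k : ℝ) + 1) ∧ 1 / ((k : ℝ) + 1) ≤ 1 := fun k =>
    ⟨by positivity, by rw [div_le_one (by positivity)]; linarith [(k.cast_nonneg : (0 : ℝ) ≤ k)]⟩
  have htk : ∀ k, t₁ < t k ∧ t k ≤ t₀ := fun k => by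
    have := hk k
    constructor <;> simp only [htdef] <;> nlinarith
  have htm : ∀ k, t k ∈ Icc 0 t₀ := fun k => ⟨hm1.1.trans (htk k).1.le, (htk k).2⟩
  have htlim : Tendsto t atTop (𝓝 t₁) := by
    have := (tendsto_one_div_add_atTop_nhds_zero_nat (𝕜 := ℝ)).const_mul (t₀ - t₁)
    have h2 := this.const_add t₁
    rw [mul_zero, add_zero] at h2
    exact h2
  have hlt' : ∀ k, dist q (γ (t k)) < lam * t k := by
    intro k
    by_contra! hcon
    exact absurd (le_csSup hEc.bddAbove ⟨htm k, hcon⟩) (not_le.2 (htk k).1)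
  have hj := fun k => joins_dist h.length q (γ (t k))
  choose hL g hg g0 g1 _ using hj
  have hhit : ∀ k, ∃ s ∈ Icc 0 (dist q (γ (t k))), g k s ∈ Omega p q lam := by
    intro k
    by_contra! hcon
    have := h.le_of_joins (hsub _ (htm k))
      (Joins.of_icc (hL k) ((hg k).lipschitzOnWith (s := Icc 0 _)) (g0 k) (g1 k) hcon)
    exact absurd (hlt' k) (not_lt.2 this)
  choose s hs hsΩ using hhit
  obtain ⟨U, g', hU, hUle, hg', hlim⟩ := exists_limit_curve g hg g0
  have hscpt : ∀ k, s k ∈ Icc 0 (lam * t₀) := fun k =>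
    ⟨(hs k).1, (hs k).2.trans ((hlt' k).le.trans (mul_le_mul_of_nonneg_left (htk k).2 hlam.le))⟩
  obtain ⟨s₀, -, hs₀⟩ := isCompact_Icc.ultrafilter_le_nhds ((Ultrafilter.of U).map s)
    (le_principal_iff.2 (show s ⁻¹' Icc 0 (lam * t₀) ∈ (Ultrafilter.of U : Filter ℕ) from
      Filter.univ_mem' hscpt))
  have hV : (Ultrafilter.of U : Filter ℕ) ≤ U := Ultrafilter.of_le U
  have hsl : Tendsto s (Ultrafilter.of U : Filter ℕ) (𝓝 s₀) := hs₀
  have hγlim : Tendsto (fun k => γ (t k)) atTop (𝓝 (γ t₁)) :=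
    (hcont t₁ hm1).tendsto.comp
      (tendsto_nhdsWithin_iff.2 ⟨htlim, Eventually.of_forall htm⟩)
  have hLlim : Tendsto (fun k => dist q (γ (t k))) atTop (𝓝 (dist q (γ t₁))) :=
    tendsto_const_nhds.dist hγlim
  have hd1 : dist q (γ t₁) = lam * t₁ := by
    refine le_antisymm ?_ hm2
    have := h.dist_le (hsub 0 ⟨le_rfl, h₀.1⟩) (hsub _ hm1)
    rwa [h.start, zero_sub, abs_neg, abs_of_nonneg hm1.1] at this
  have hs₀1 : s₀ ≤ lam * t₁ := by
    rw [← hd1]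
    exact le_of_tendsto_of_tendsto hsl (hLlim.mono_left (hV.trans hUle))
      (Eventually.of_forall fun k => (hs k).2)
  have hs₀0 : 0 ≤ s₀ := ge_of_tendsto hsl (Eventually.of_forall fun k => (hs k).1)
  have hg'0 : g' 0 = q := by
    have := hlim (fun _ => 0) 0 tendsto_const_nhds
    simp only [g0] at this
    exact tendsto_nhds_unique this tendsto_const_nhds
  have hg'1 : g' (lam * t₁) = γ t₁ := by
    have := hlim _ _ (hLlim.mono_left hUle)
    simp only [g1] at this
    rw [← hd1]
    exact tendsto_nhds_unique this (hγlim.mono_left hUle)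
  have hlimV : Tendsto (fun k => g k (s k)) (Ultrafilter.of U : Filter ℕ) (𝓝 (g' s₀)) := by
    have h1 : Tendsto (fun k => g k s₀) (Ultrafilter.of U : Filter ℕ) (𝓝 (g' s₀)) :=
      (hlim (fun _ => s₀) s₀ tendsto_const_nhds).mono_left hV
    refine tendsto_of_tendsto_of_dist h1 ?_
    have h2 : Tendsto (fun k => dist s₀ (s k)) (Ultrafilter.of U : Filter ℕ) (𝓝 0) := by
      have := (tendsto_const_nhds (x := s₀)).dist hsl
      rwa [dist_self] at this
    exact squeeze_zero (fun _ => dist_nonneg) (fun k => by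
      simpa using (hg k).dist_le_mul s₀ (s k)) h2
  have hcl : g' s₀ ∈ closure (Omega p q lam) :=
    mem_closure_of_tendsto hlimV (Eventually.of_forall hsΩ)
  rcases hm1.1.eq_or_lt with h0 | h0
  · rw [← h0, mul_zero] at hs₀1
    rw [le_antisymm hs₀1 hs₀0, hg'0] at hcl
    exact hf 0 ⟨le_rfl, by linarith⟩ (by rwa [h.start])
  · have hg'l : LipschitzOnWith (Real.toNNReal lam) (fun t => g' (lam * t)) (Icc 0 t₁) := by
      refine (LipschitzWith.of_dist_le_mul fun x y => ?_).lipschitzOnWith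
      have := hg'.dist_le_mul (lam * x) (lam * y)
      rw [NNReal.coe_one, one_mul, Real.dist_eq, ← mul_sub, abs_mul, abs_of_pos hlam,
        ← Real.dist_eq] at this
      rwa [h.coe_speed]
    have hsub1 : ∀ t ∈ Icc 0 t₁, t ∈ Icc 0 T := fun t ht => hsub t ⟨ht.1, ht.2.trans hm1.2⟩
    have key := geodesic_unique hsym hc (Real.toNNReal_pos.2 hlam) h0 (h.lip.mono hsub1) hg'l
      (fun t ht => h.ne_center (hsub1 t ht))
      (by rw [h.coe_speed, h.start, sub_zero]; exact hm2) (by simp [hg'0, h.start]) hg'1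
      (s₀ / lam) ⟨by positivity, by rwa [div_le_iff₀' hlam]⟩
    rw [mul_div_cancel₀ _ hlam.ne'] at key
    rw [key] at hcl
    refine hf (s₀ / lam) ⟨by positivity, lt_of_le_of_lt ?_ hlt⟩ hcl
    rwa [div_le_iff₀' hlam]

end MinPath

end MinimalPaths

namespace MinPath

variable {p q : M} {lam T : ℝ} {γ : ℝ → M} [ProperSpace M] {n : ℕ} {G : ℝ → ℝ} {Φ : Euc n ≃ M}

/-- Off the closure of `Ω`, the radial coordinate of a minimal path solves the geodesic
equation. -/
theorem exists_hasDerivAt_warpPrim (h : MinPath p q lam T γ)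
    (hsym : IsSphericallySymmetric p G Φ) (hc : NonposCurvWarping G) {t : ℝ} (ht : t ∈ Ioo 0 T)
    (hf : γ t ∉ closure (Omega p q lam)) :
    ∃ V : ℝ → ℝ, HasDerivAt V (lam ^ 2 * deriv G (dist (γ t) p)) t ∧
      ∀ᶠ s in 𝓝 t, HasDerivAt (fun s => warpPrim G (dist (γ s) p)) (V s) s := by
  obtain ⟨ε, hε, hloc⟩ := h.exists_local_geodesic ⟨ht.1.le, ht.2.le⟩ hf
  obtain ⟨δ, hδ, h1, h2, h3⟩ : ∃ δ > 0, δ ≤ ε ∧ δ ≤ t ∧ δ ≤ T - t :=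
    ⟨min ε (min t (T - t)), lt_min hε (lt_min ht.1 (sub_pos.2 ht.2)), min_le_left _ _,
      (min_le_right _ _).trans (min_le_left _ _), (min_le_right _ _).trans (min_le_right _ _)⟩
  have hcd : t - δ < t + δ := by linarith
  have hsub : Icc (t - δ) (t + δ) ⊆ Icc 0 T := Icc_subset_Icc (by linarith) (by linarith)
  have hdist := hloc _ (hsub (left_mem_Icc.2 hcd.le)) _ (hsub (right_mem_Icc.2 hcd.le)) hcd.le
    (by rw [sub_sub_cancel_left, abs_neg, abs_of_pos hδ]; exact h1)
    (by rw [add_sub_cancel_left, abs_of_pos hδ]; exact h1)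
  obtain ⟨ρ, η, hm, hv⟩ := exists_minPolar hsym hc hcd.le (h.lip.mono hsub)
    (fun s hs => h.ne_center (hsub hs)) (by rwa [h.coe_speed])
  have hρ : ∀ s ∈ Ioo (t - δ) (t + δ), ρ s = dist (γ s) p := fun s hs => by
    rw [(hv s (Ioo_subset_Icc_self hs)).1, dist_center hsym]
  obtain ⟨V, hV1, hV2⟩ := hm.euler_lagrange hsym.1 hcd
  have hmem : t ∈ Ioo (t - δ) (t + δ) := ⟨by linarith, by linarith⟩
  refine ⟨V, ?_, ?_⟩
  · rw [← hρ t hmem, ← h.coe_speed]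
    exact hV1 t
  · filter_upwards [Ioo_mem_nhds hmem.1 hmem.2] with s hs
    refine (hV2 s hs).congr_of_eventuallyEq ?_
    filter_upwards [Ioo_mem_nhds hs.1 hs.2] with u hu
    rw [hρ u hu]

/-- A minimal path does not leave the closure of `Ω` between two of its visits. -/
theorem exists_mem_closure_of_dist_eq (h : MinPath p q lam T γ)
    (hsym : IsSphericallySymmetric p G Φ) (hc : NonposCurvWarping G) {a b : ℝ} (ha : 0 ≤ a)
    (hab : a < b) (hb : b ≤ T) (hda : dist (γ a) p = a) (hdb : dist (γ b) p = b) :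
    ∃ t ∈ Ioo a b, γ t ∈ closure (Omega p q lam) := by
  by_contra! hf
  have hG := hsym.1
  have hsub : Icc a b ⊆ Icc 0 T := Icc_subset_Icc ha hb
  have hpos : ∀ t ∈ Ioo a b, 0 < t := fun t ht => ha.trans_lt ht.1
  have hR : ∀ t ∈ Icc a b, t ≤ dist (γ t) p := fun t ht => h.le_dist (hsub ht)
  set D : ℝ → ℝ := fun t => warpPrim G (dist (γ t) p) - warpPrim G t with hDdef
  have hD : ContinuousOn D (Icc a b) :=
    ((continuous_warpPrim hG).comp_continuousOn
      ((continuous_id.dist continuous_const).comp_continuousOn (h.lip.continuousOn.mono hsub))).sub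
      (continuous_warpPrim hG).continuousOn
  have hloc : ∀ t ∈ Ioo a b, HasDerivAt D (deriv D t) t ∧
      HasDerivAt (deriv D) (lam ^ 2 * deriv G (dist (γ t) p) - deriv G t) t := by
    intro t ht
    obtain ⟨V, hV, hev⟩ := h.exists_hasDerivAt_warpPrim hsym hc
      ⟨hpos t ht, ht.2.trans_le hb⟩ (hf t ht)
    have hev' : ∀ᶠ s in 𝓝 t, HasDerivAt D (V s - G s) s := by
      filter_upwards [hev, Ioi_mem_nhds (hpos t ht)] with s hs hs0
      exact hs.sub (hasDerivAt_warpPrim_of_pos hG hs0)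
    refine ⟨hev'.self_of_nhds.differentiableAt.hasDerivAt, ?_⟩
    exact (hV.sub (hG.hasDerivAt (hpos t ht))).congr_of_eventuallyEq
      (hev'.mono fun s hs => hs.deriv)
  have hpos'' : ∀ t ∈ Ioo a b, 0 < lam ^ 2 * deriv G (dist (γ t) p) - deriv G t := by
    intro t ht
    have h1 := hR t (Ioo_subset_Icc_self ht)
    have h2 := hG.deriv_mono hc (hpos t ht) ((hpos t ht).trans_le h1) h1
    have h3 := hc.2 t (hpos t ht)
    have h4 := one_lt_pow₀ h.one_lt two_ne_zero
    nlinarith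
  have hle := nonpos_of_deriv_deriv_nonneg hD (fun t ht => (hloc t ht).1)
    (fun t ht => (hloc t ht).2) (fun t ht => (hpos'' t ht).le) (by simp [hDdef, hda])
    (by simp [hDdef, hdb])
  have hzero : ∀ t ∈ Ioo a b, D t = 0 := by
    intro t ht
    refine le_antisymm (hle t (Ioo_subset_Icc_self ht)) (sub_nonneg.2 ?_)
    exact (strictMonoOn_warpPrim hG).monotoneOn (hpos t ht).le dist_nonneg
      (hR t (Ioo_subset_Icc_self ht))
  obtain ⟨t, ht⟩ := nonempty_Ioo.2 hab
  have hderiv : deriv D =ᶠ[𝓝 t] fun _ => 0 := by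
    filter_upwards [Ioo_mem_nhds ht.1 ht.2] with s hs
    have : D =ᶠ[𝓝 s] fun _ => 0 := by
      filter_upwards [Ioo_mem_nhds hs.1 hs.2] with u hu using hzero u hu
    rw [this.deriv_eq, deriv_const]
  have h1 := (hloc t ht).2.congr_of_eventuallyEq hderiv.symm
  exact (hpos'' t ht).ne' (h1.unique (hasDerivAt_const t 0))

/-- Once a minimal path reaches the closure of `Ω`, it stays there until its last visit. -/
theorem mem_closure_of_mem_Icc (h : MinPath p q lam T γ)
    (hsym : IsSphericallySymmetric p G Φ) (hc : NonposCurvWarping G) {t₀ : ℝ} (h₀ : 0 ≤ t₀)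
    (hm₀ : γ t₀ ∈ closure (Omega p q lam)) (hmT : γ T ∈ closure (Omega p q lam)) {t : ℝ}
    (ht : t ∈ Icc t₀ T) : γ t ∈ closure (Omega p q lam) := by
  by_contra hf
  have hcl : ∀ c d : ℝ, 0 ≤ c → d ≤ T →
      IsCompact {s ∈ Icc c d | γ s ∈ closure (Omega p q lam)} := fun c d h0 hT =>
    isCompact_Icc.of_isClosed_subset
      ((h.lip.continuousOn.mono (Icc_subset_Icc h0 hT)).preimage_isClosed_of_isClosed
        isClosed_Icc isClosed_closure) fun s hs => hs.1
  have hA := hcl t₀ t h₀ ht.2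
  have hB := hcl t T (h₀.trans ht.1) le_rfl
  obtain ⟨ha1, ha2⟩ := hA.sSup_mem ⟨t₀, ⟨le_rfl, ht.1⟩, hm₀⟩
  obtain ⟨hb1, hb2⟩ := hB.sInf_mem ⟨T, ⟨ht.2, le_rfl⟩, hmT⟩
  set a := sSup {s ∈ Icc t₀ t | γ s ∈ closure (Omega p q lam)} with haS
  set b := sInf {s ∈ Icc t T | γ s ∈ closure (Omega p q lam)} with hbS
  have hat : a < t := lt_of_le_of_ne ha1.2 fun h1 => hf (h1 ▸ ha2)
  have htb : t < b := lt_of_le_of_ne hb1.1 fun h1 => hf (h1.symm ▸ hb2)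
  have haT : a ∈ Icc 0 T := ⟨h₀.trans ha1.1, hat.le.trans ht.2⟩
  have hbT : b ∈ Icc 0 T := ⟨haT.1.trans (hat.trans htb).le, hb1.2⟩
  obtain ⟨s, hs, hsm⟩ := h.exists_mem_closure_of_dist_eq hsym hc haT.1 (hat.trans htb) hbT.2
    (h.dist_eq_of_mem_frontier haT (h.mem_frontier haT ha2))
    (h.dist_eq_of_mem_frontier hbT (h.mem_frontier hbT hb2))
  rcases le_total s t with hst | hst
  · exact absurd (le_csSup hA.bddAbove ⟨⟨ha1.1.trans hs.1.le, hst⟩, hsm⟩) (not_le.2 hs.1)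
  · exact absurd (csInf_le hB.bddBelow ⟨⟨hst, hs.2.le.trans hbT.2⟩, hsm⟩) (not_le.2 hs.2)

end MinPath

theorem eVariationOn_le_of_lipschitzOnWith {K : ℝ≥0} {γ : ℝ → M} {a b : ℝ} (hab : a ≤ b)
    (hγ : LipschitzOnWith K γ (Icc a b)) :
    eVariationOn γ (Icc a b) ≤ ENNReal.ofReal (K * (b - a)) := by
  have hm : MonotoneOn (id : ℝ → ℝ) (Icc a b) := monotoneOn_id
  have hv := hm.eVariationOn_eq (left_mem_Icc.2 hab) (right_mem_Icc.2 hab)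
  rw [inter_self, id, id] at hv
  rw [ENNReal.ofReal_mul K.coe_nonneg, ENNReal.ofReal_coe_nnreal, ← hv]
  exact hγ.comp_eVariationOn_le (mapsTo_id _)

namespace MinPath

variable {p q : M} {lam T : ℝ} {γ : ℝ → M} [ProperSpace M]

/-- A minimal path really has constant speed. -/
theorem le_eVariationOn (h : MinPath p q lam T γ) {s u : ℝ} (hs : 0 ≤ s) (hsu : s ≤ u)
    (hu : u ≤ T) : ENNReal.ofReal (lam * (u - s)) ≤ eVariationOn γ (Icc s u) := by
  have hsub : Icc 0 u ⊆ Icc 0 T := Icc_subset_Icc_right hu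
  have h0u := hs.trans hsu
  have hle : dCompl (Omega p q lam) q (γ u) ≤ eVariationOn γ (Icc 0 u) :=
    sInf_le ⟨u, γ, h0u, h.start, rfl, ⟨_, h.lip.mono hsub⟩, fun t ht => h.out t (hsub ht), rfl⟩
  have hfin : eVariationOn γ (Icc 0 u) ≠ ⊤ :=
    ((eVariationOn_le_of_lipschitzOnWith h0u (h.lip.mono hsub)).trans_lt
      ENNReal.ofReal_lt_top).ne
  have hj := h.le_of_joins ⟨h0u, hu⟩ (joins_of_dCompl_le (isOpen_Omega h.pos.le)
    ENNReal.toReal_nonneg (hle.trans (ENNReal.ofReal_toReal hfin).ge))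
  have h1 : ENNReal.ofReal (lam * u) ≤ eVariationOn γ (Icc 0 u) :=
    (ENNReal.ofReal_le_ofReal hj).trans (ENNReal.ofReal_toReal hfin).le
  have h2 := eVariationOn.Icc_add_Icc γ (s := univ) hs hsu (mem_univ s)
  rw [univ_inter, univ_inter, univ_inter] at h2
  have h3 := eVariationOn_le_of_lipschitzOnWith hs
    (h.lip.mono (Icc_subset_Icc_right (hsu.trans hu)))
  rw [h.coe_speed, sub_zero] at h3
  have h4 : ENNReal.ofReal (lam * u) =
      ENNReal.ofReal (lam * s) + ENNReal.ofReal (lam * (u - s)) := by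
    rw [← ENNReal.ofReal_add (mul_nonneg h.pos.le hs) (mul_nonneg h.pos.le (sub_nonneg.2 hsu))]
    congr 1
    ring
  rw [h4, ← h2] at h1
  exact (ENNReal.add_le_add_iff_left ENNReal.ofReal_ne_top).1
    (h1.trans (add_le_add_left h3 _))

/-- Where a minimal path satisfies `dist (γ t) p = t`, its angular coordinate is Lipschitz, with
explicit speed. -/
theorem polarTheta_of_dist_eq {n : ℕ} {G : ℝ → ℝ} {Φ : Euc n ≃ M} (h : MinPath p q lam T γ)
    (hsym : IsSphericallySymmetric p G Φ) (hc : NonposCurvWarping G) {a : ℝ} (ha : 0 < a)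
    (haT : a ≤ T) (hd : ∀ t ∈ Icc a T, dist (γ t) p = t) :
    (∃ K : ℝ≥0, LipschitzOnWith K (fun s => polarTheta Φ (γ s)) (Icc a T)) ∧
      ∀ᵐ t ∂(volume.restrict (Ioo a T)),
        ‖derivWithin (fun s => polarTheta Φ (γ s)) (Icc a T) t‖ =
          Real.sqrt (lam ^ 2 - 1) / G t := by
  have hsub : Icc a T ⊆ Icc 0 T := Icc_subset_Icc_left ha.le
  obtain ⟨ρ, η, hp, hL, hE, hv⟩ := exists_polarCurve hsym hc haT (h.lip.mono hsub)
    (fun t ht => h.ne_center (hsub ht))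
  have hη : EqOn (fun s => polarTheta Φ (γ s)) η (Icc a T) := fun t ht => (hv t ht).2.symm
  constructor
  · obtain ⟨K, hK⟩ := hp.lip_ang
    refine ⟨K, fun s hs u hu => ?_⟩
    rw [hη hs, hη hu]
    exact hK s u
  have hen := hp.ae_energy_eq hsym hc hL haT (by
    rw [eVariationOn.eq_of_eqOn hE, h.coe_speed]
    exact h.le_eVariationOn ha.le haT le_rfl)
  have hen' := ae_restrict_of_ae_restrict_of_subset Ioo_subset_Ioc_self hen
  filter_upwards [hen', ae_restrict_mem measurableSet_Ioo] with t ht hm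
  have hnhds := Icc_mem_nhds hm.1 hm.2
  have hρ : ∀ s ∈ Icc a T, ρ s = s := fun s hs => by
    rw [(hv s hs).1, ← dist_center hsym, hd s hs]
  have hρ' : deriv ρ t = 1 := by
    have : ρ =ᶠ[𝓝 t] id := Filter.eventually_of_mem hnhds hρ
    rw [this.deriv_eq, deriv_id]
  have hη' : derivWithin (fun s => polarTheta Φ (γ s)) (Icc a T) t = deriv η t := by
    rw [derivWithin_of_mem_nhds hnhds]
    exact (hη.eventuallyEq_of_mem hnhds).deriv_eq
  have hG := hsym.1.1 t (ha.trans hm.1)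
  rw [polarEnergy, hρ', hρ t (Ioo_subset_Icc_self hm), h.coe_speed] at ht
  rw [hη', eq_div_iff hG.ne', ← Real.sqrt_sq (mul_nonneg (norm_nonneg (deriv η t)) hG.le)]
  congr 1
  linear_combination ht

end MinPath

/-- structure of minimal paths, from the proof of
Proposition 3.2.  Suppose `M` is spherically symmetric about `p` and
nonpositively curved.  Let `x = (f(θ),θ) ∈ ∂Ω` (automatically
`f(θ) = d(x,p) < ∞`) and let `γ : [0,T] → M ∖ Ω` be a path of constant
speed `λ` from `q` to `x` realizing the intrinsic distance, i.e.
`d_Ω(γ(t), q) = λ t` for all `t`.  Then there is `t₀ ∈ (0,T]` such that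
`γ|[0,t₀]` is a (minimizing, speed-`λ`) geodesic of `M`, while
`γ(t) ∈ ∂Ω` and `d(γ(t),p) = t` for all `t ∈ [t₀,T]` (in particular
`r₀ := d(γ(t₀),p) = t₀`, so `d(γ(t),p) = r₀ + (t − t₀)`).  Consequently
the angular component `η(t) = θ(γ(t))` is Lipschitz on `[t₀,T]` with
`|η′(t)| = √(λ²−1)/G(r₀ + (t−t₀)) = √(λ²−1)/G(t)` almost everywhere. -/
theorem minimal_path_structure
    {M : Type*} [MetricSpace M] [ProperSpace M] {n : ℕ}
    (p : M) (G : ℝ → ℝ) (Φ : Euc n ≃ M)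
    (hsym : IsSphericallySymmetric p G Φ) (hnpc : NonposCurvWarping G)
    (q : M) (hq : q ≠ p) (lam : ℝ) (hlam : 1 < lam)
    (x : M) (hx : x ∈ frontier (Omega p q lam))
    (T : ℝ) (hT : 0 < T) (γ : ℝ → M) (hγ0 : γ 0 = q) (hγT : γ T = x)
    (hγout : ∀ t ∈ Set.Icc (0 : ℝ) T, γ t ∉ Omega p q lam)
    (hlip : LipschitzOnWith (Real.toNNReal lam) γ (Set.Icc 0 T))
    (hmin : ∀ t ∈ Set.Icc (0 : ℝ) T,
      dCompl (Omega p q lam) (γ t) q = ENNReal.ofReal (lam * t)) :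
    ∃ t₀ ∈ Set.Ioc (0 : ℝ) T,
      (∀ s ∈ Set.Icc (0 : ℝ) t₀, ∀ u ∈ Set.Icc (0 : ℝ) t₀,
        dist (γ s) (γ u) = lam * |s - u|) ∧
      (∀ t ∈ Set.Icc t₀ T, γ t ∈ frontier (Omega p q lam) ∧ dist (γ t) p = t) ∧
      (∃ K : ℝ≥0, LipschitzOnWith K (fun s => polarTheta Φ (γ s)) (Set.Icc t₀ T)) ∧
      (∀ᵐ t ∂(volume.restrict (Set.Ioo t₀ T)),
        ‖derivWithin (fun s => polarTheta Φ (γ s)) (Set.Icc t₀ T) t‖ =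
          Real.sqrt (lam ^ 2 - 1) / G t) := by
  have h : MinPath p q lam T γ :=
    ⟨hγ0, hγout, hlip, hmin, isLengthSpace hsym hnpc, hq, hlam⟩
  have hxcl : γ T ∈ closure (Omega p q lam) := hγT ▸ frontier_subset_closure hx
  set S := {t ∈ Icc (0 : ℝ) T | γ t ∈ closure (Omega p q lam)} with hS
  have hScpt : IsCompact S := isCompact_Icc.of_isClosed_subset
    (hlip.continuousOn.preimage_isClosed_of_isClosed isClosed_Icc isClosed_closure)
    fun s hs => hs.1
  obtain ⟨hm, hcl⟩ := hScpt.sInf_mem ⟨T, ⟨hT.le, le_rfl⟩, hxcl⟩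
  set t₀ := sInf S with ht₀
  have hpos : 0 < t₀ := lt_of_le_of_ne hm.1 fun h0 =>
    source_notMem_closure_Omega hlam h.length hq (by rw [← h0, hγ0] at hcl; exact hcl)
  have hgeo := h.initial_geodesic hsym hnpc hm fun t ht hmem =>
    not_le.2 ht.2 (csInf_le hScpt.bddBelow ⟨⟨ht.1, ht.2.le.trans hm.2⟩, hmem⟩)
  have hfr : ∀ t ∈ Icc t₀ T, γ t ∈ frontier (Omega p q lam) ∧ dist (γ t) p = t := by
    intro t ht
    have ht' : t ∈ Icc 0 T := ⟨hm.1.trans ht.1, ht.2⟩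
    have hf := h.mem_frontier ht' (h.mem_closure_of_mem_Icc hsym hnpc hm.1 hcl hxcl ht)
    exact ⟨hf, h.dist_eq_of_mem_frontier ht' hf⟩
  refine ⟨t₀, ⟨hpos, hm.2⟩, fun s hs u hu => ?_, hfr,
    h.polarTheta_of_dist_eq hsym hnpc hpos hm.2 fun t ht => (hfr t ht).2⟩
  rw [dist_eq_of_le_dist (hlip.mono (Icc_subset_Icc_right hm.2))
    (by rw [h.coe_speed, sub_zero]; exact hgeo) hs hu, h.coe_speed]

end GrowthComp
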